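/- There is a positive constant c₁ depending only on K such that for all real x, y ≥ 1 with u := (ln x)/(ln y) ≥ 3, one has ψ_K(x, y) ≥ x · exp[ −u·( ln(u ln u) − 1 + (ln ln u − 1)/ln u + c₁·((ln ln u)/(ln u))² ) ]. -/

import Mathlib

set_option synthInstance.maxHeartbeats 1000000
set_option maxHeartbeats 1000000

open NumberField

/-- `ψ_K(x, y)`: the number of nonzero ideals of `𝒪_K` of norm at most `x` that are
products of prime ideals of norm at most `y`. -/
noncomputable def psiK (K : Type) [Field K] [NumberField K] (x y : ℝ) : ℕ :=
  Set.ncard {I : Ideal (𝓞 K) | I ≠ ⊥ ∧ (Ideal.absNorm I : ℝ) ≤ x ∧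
    ∃ s : Multiset (Ideal (𝓞 K)),
      (∀ P ∈ s, P.IsPrime ∧ (Ideal.absNorm P : ℝ) ≤ y) ∧ I = s.prod}

section LatticeSum
open MeasureTheory

lemma ZSpan.measurable_sub_fract {E ι : Type*} [NormedAddCommGroup E] [NormedSpace ℝ E] [Fintype ι]
    [FiniteDimensional ℝ E] [MeasurableSpace E] [BorelSpace E] (b : Module.Basis ι ℝ E) :
    Measurable (fun x : E => x - ZSpan.fract b x) := by
  have h : (fun x : E => x - ZSpan.fract b x) = fun x => ∑ i, ((⌊b.repr x i⌋ : ℤ) : ℝ) • b i := by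
    ext x
    rw [ZSpan.fract_apply, sub_sub_cancel]
    conv_lhs => rw [← b.sum_repr (ZSpan.floor b x : E)]
    simp [ZSpan.repr_floor_apply]
  rw [h]
  refine Finset.measurable_sum _ fun i _ => ?_
  refine Measurable.smul_const ?_ _
  have h1 : Continuous (fun x : E => b.repr x i) :=
    LinearMap.continuous_of_finiteDimensional (b.coord i)
  have h2 : Measurable (fun t : ℝ => ((⌊t⌋ : ℤ) : ℝ)) :=
    (measurable_from_top (f := fun z : ℤ => (z : ℝ))).comp Int.measurable_floor
  exact h2.comp h1.measurable

/-- Riemann sums of a compactly supported Lipschitz function over a scaled lattice. -/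
theorem ZSpan.exists_tsum_sub_le {E ι : Type*} [NormedAddCommGroup E] [NormedSpace ℝ E] [Fintype ι]
    [FiniteDimensional ℝ E] (b : Module.Basis ι ℝ E) (F : E → ℝ) {k : NNReal}
    (hF : LipschitzWith k F) {ρ : ℝ} (hρ : ∀ x, ρ < ‖x‖ → F x = 0) (hρ0 : 0 ≤ ρ) :
    ∃ c C : ℝ, ∀ R : ℝ, 1 ≤ R →
      |∑' v : Submodule.span ℤ (Set.range b), F (R⁻¹ • (v : E)) - c * R ^ Module.finrank ℝ E| ≤
        C * R ^ Module.finrank ℝ E / R := by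
  borelize E
  let μ : Measure E := Measure.addHaar
  set d := Module.finrank ℝ E with hd
  set D := ZSpan.fundamentalDomain b with hD
  set B : ℝ := ∑ i, ‖b i‖ with hB
  have hB0 : 0 ≤ B := by positivity
  set V : ℝ := (μ D).toReal with hV
  have hVfin : μ D ≠ ⊤ := by
    exact (ZSpan.fundamentalDomain_isBounded b).measure_lt_top.ne
  have hV0 : 0 < V := ENNReal.toReal_pos (ZSpan.measure_fundamentalDomain_ne_zero b) hVfin
  set W : ℝ := (μ (Metric.ball 0 1)).toReal with hW
  refine ⟨(∫ x, F x ∂μ) / V, k * B * (ρ + B) ^ d * W / V, fun R hR => ?_⟩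
  have hR0 : 0 < R := by linarith
  set G : E → ℝ := fun x => F (R⁻¹ • (x - ZSpan.fract b x)) with hG
  have hfrac : ∀ x, ‖ZSpan.fract b x‖ ≤ B := fun x => ZSpan.norm_fract_le b x
  set S := Metric.closedBall (0 : E) ((ρ + B) * R) with hS
  have hSfin : μ S ≠ ⊤ := (Metric.isBounded_closedBall).measure_lt_top.ne
  have hzero : ∀ x, x ∉ S → F (R⁻¹ • x) = 0 ∧ G x = 0 := by
    intro x hx
    have hx' : (ρ + B) * R < ‖x‖ := by simpa [hS] using hx
    have h1 : ρ * R + B ≤ (ρ + B) * R := by nlinarith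
    have key : ∀ z : E, ρ * R < ‖z‖ → F (R⁻¹ • z) = 0 := by
      intro z hz
      apply hρ
      rw [norm_smul, Real.norm_of_nonneg (by positivity), inv_mul_eq_div, lt_div_iff₀ hR0]
      exact hz
    refine ⟨key _ (by linarith), key _ ?_⟩
    have := norm_sub_norm_le x (ZSpan.fract b x)
    linarith [hfrac x]
  have hdiff : ∀ x, |G x - F (R⁻¹ • x)| ≤ S.indicator (fun _ => k * (B / R)) x := by
    intro x
    by_cases hx : x ∈ S
    · rw [Set.indicator_of_mem hx]
      have := hF.dist_le_mul (R⁻¹ • (x - ZSpan.fract b x)) (R⁻¹ • x)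
      rw [Real.dist_eq, dist_eq_norm, ← smul_sub, norm_smul,
        Real.norm_of_nonneg (by positivity)] at this
      refine this.trans ?_
      gcongr
      rw [inv_mul_eq_div]
      gcongr
      simpa using hfrac x
    · rw [Set.indicator_of_notMem hx, (hzero x hx).1, (hzero x hx).2]; simp
  have hFc : Continuous fun x => F (R⁻¹ • x) := hF.continuous.comp (continuous_const_smul _)
  have hFs : HasCompactSupport fun x => F (R⁻¹ • x) := by
    refine HasCompactSupport.intro (isCompact_closedBall (0:E) ((ρ +
      B) * R)) fun x hx => (hzero x hx).1
  have hFi : Integrable (fun x => F (R⁻¹ • x)) μ := hFc.integrable_of_hasCompactSupport hFs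
  have hIi : Integrable (S.indicator (fun _ : E => (k * (B / R) : ℝ))) μ :=
    (integrable_indicator_iff Metric.isClosed_closedBall.measurableSet).2
      (integrableOn_const hSfin)
  have hGm : Measurable G := by
    exact hF.continuous.measurable.comp ((ZSpan.measurable_sub_fract b).const_smul R⁻¹)
  have hdi : Integrable (fun x => G x - F (R⁻¹ • x)) μ := by
    refine hIi.mono' (hGm.sub hFc.measurable).aestronglyMeasurable ?_
    exact Filter.Eventually.of_forall fun x => by simpa using hdiff x
  have hGi : Integrable G μ :=
    (hdi.add hFi).congr (Filter.Eventually.of_forall fun x => by simp)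
  have hFint : ∫ x, F (R⁻¹ • x) ∂μ = R ^ d * ∫ x, F x ∂μ := by
    rw [Measure.integral_comp_inv_smul, abs_of_nonneg (by positivity), smul_eq_mul]
  have hGint : ∫ x, G x ∂μ = V * ∑' v : Submodule.span ℤ (Set.range b), F (R⁻¹ • (v : E)) := by
    have : VAddInvariantMeasure (Submodule.span ℤ (Set.range b)) E μ :=
      inferInstanceAs (VAddInvariantMeasure (Submodule.span ℤ (Set.range b)).toAddSubgroup E μ)
    rw [(ZSpan.isAddFundamentalDomain b μ).integral_eq_tsum'' G hGi, ← tsum_mul_left]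
    refine tsum_congr fun v => ?_
    have : ∀ x ∈ D, G (v +ᵥ x) = F (R⁻¹ • (v : E)) := by
      intro x hx
      simp only [hG, Submodule.vadd_def, vadd_eq_add]
      rw [ZSpan.fract_zSpan_add b x v.2, ZSpan.fract_eq_self.2 hx, add_sub_cancel_right]
    rw [setIntegral_congr_fun (ZSpan.fundamentalDomain_measurableSet b) this]
    simp [hV, Measure.real, hD]
  have hmain : |∫ x, G x ∂μ - ∫ x, F (R⁻¹ • x) ∂μ| ≤ k * (B / R) * (((ρ + B) * R) ^ d * W) := by
    rw [← integral_sub hGi hFi]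
    refine (abs_integral_le_integral_abs).trans ?_
    refine (integral_mono hdi.abs hIi hdiff).trans ?_
    rw [integral_indicator Metric.isClosed_closedBall.measurableSet]
    simp only [integral_const, smul_eq_mul, Measure.real, MeasurableSet.univ,
      Measure.restrict_apply, Set.univ_inter]
    rw [Measure.addHaar_closedBall μ _ (by positivity), ENNReal.toReal_mul,
      ENNReal.toReal_ofReal (by positivity), mul_comm]
  rw [hGint, hFint] at hmain
  have h2 : ∑' v : Submodule.span ℤ (Set.range b), F (R⁻¹ • (v : E)) - (∫ x, F x ∂μ) / V * R ^ d =
      (V * ∑' v : Submodule.span ℤ (Set.range b), F (R⁻¹ • (v : E)) - R ^ d * ∫ x, F x ∂μ) / V := by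
    field_simp
  rw [h2, abs_div, abs_of_pos hV0, div_le_iff₀ hV0]
  refine hmain.trans (le_of_eq ?_)
  rw [mul_pow]
  field_simp
end LatticeSum

section MixedSmooth
open NumberField.mixedEmbedding NumberField.Units NumberField.Units.dirichletUnitTheorem
open NumberField.InfinitePlace
open scoped Classical

variable {K : Type*} [Field K] [NumberField K]

lemma contDiffAt_normAtPlace (w : InfinitePlace K) {v : mixedSpace K} (hv : normAtPlace w v ≠ 0) :
    ContDiffAt ℝ (⊤ : ℕ∞) (fun x : mixedSpace K => normAtPlace w x) v := by
  by_cases hw : IsReal w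
  · simp only [normAtPlace_apply_of_isReal hw] at hv ⊢
    have h1 : ContDiff ℝ (⊤ : ℕ∞) (fun x : mixedSpace K => x.1 ⟨w, hw⟩) :=
      (contDiff_apply ℝ ℝ (⟨w, hw⟩ : {w : InfinitePlace K // IsReal w})).comp contDiff_fst
    exact h1.contDiffAt.norm ℝ (by simpa using hv)
  · have hw := not_isReal_iff_isComplex.1 hw
    simp only [normAtPlace_apply_of_isComplex hw] at hv ⊢
    have h1 : ContDiff ℝ (⊤ : ℕ∞) (fun x : mixedSpace K => x.2 ⟨w, hw⟩) :=
      (contDiff_apply ℝ ℂ (⟨w, hw⟩ : {w : InfinitePlace K // IsComplex w})).comp contDiff_snd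
    exact h1.contDiffAt.norm ℝ (by simpa using hv)

lemma contDiffAt_mixedEmbedding_norm {v : mixedSpace K} (hv : mixedEmbedding.norm v ≠ 0) :
    ContDiffAt ℝ (⊤ : ℕ∞) (fun x : mixedSpace K => mixedEmbedding.norm x) v := by
  simp only [mixedEmbedding.norm_apply]
  exact contDiffAt_prod fun w _ =>
    (contDiffAt_normAtPlace w (mixedEmbedding.norm_ne_zero_iff.1 hv w)).pow _

lemma contDiffAt_logMap {v : mixedSpace K} (hv : mixedEmbedding.norm v ≠ 0) :
    ContDiffAt ℝ (⊤ : ℕ∞) (fun x : mixedSpace K => logMap x) v := by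
  refine contDiffAt_pi.2 fun w => ?_
  simp only [logMap_apply]
  have h1 := (contDiffAt_normAtPlace w.1 (mixedEmbedding.norm_ne_zero_iff.1 hv w.1)).log
    (mixedEmbedding.norm_ne_zero_iff.1 hv w.1)
  have h2 := (contDiffAt_mixedEmbedding_norm hv).log hv
  exact contDiffAt_const.mul (h1.sub (h2.mul contDiffAt_const))

lemma contDiff_logMap_mul_norm {Φ : logSpace K → ℝ} (hΦ : ContDiff ℝ (⊤ : ℕ∞) Φ) {χ : ℝ → ℝ}
    (hχ : ContDiff ℝ (⊤ : ℕ∞) χ) {a : ℝ} (ha : 0 < a) (hχa : ∀ t < a, χ t = 0) :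
    ContDiff ℝ (⊤ : ℕ∞) (fun v : mixedSpace K => Φ (logMap v) * χ (mixedEmbedding.norm v)) := by
  rw [contDiff_iff_contDiffAt]
  intro v
  by_cases hv : mixedEmbedding.norm v = 0
  · have h1 : ∀ᶠ x in nhds v, mixedEmbedding.norm x < a :=
      (mixedEmbedding.continuous_norm K).continuousAt.eventually_lt continuousAt_const (by simpa
        [hv])
    refine (contDiffAt_const (c := (0 : ℝ))).congr_of_eventuallyEq ?_
    filter_upwards [h1] with x hx
    rw [hχa _ hx, mul_zero]
  · exact (hΦ.contDiffAt.comp v (contDiffAt_logMap hv)).mul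
      (hχ.contDiffAt.comp v (contDiffAt_mixedEmbedding_norm hv))

lemma exists_norm_le_of_logMap {A a b : ℝ} (ha : 0 < a) :
    ∃ ρ : ℝ, 0 ≤ ρ ∧ ∀ v : mixedSpace K, ‖logMap v‖ ≤ A → a ≤ mixedEmbedding.norm v →
      mixedEmbedding.norm v ≤ b → ‖v‖ ≤ ρ := by
  set B := max |Real.log a| |Real.log b| with hB
  set M : ℝ := |A| + B with hM
  set N : ℝ := B + ∑ w : InfinitePlace K, (mult w : ℝ) * M with hN
  have hB0 : 0 ≤ B := le_max_of_le_left (abs_nonneg _)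
  have hM0 : 0 ≤ M := by positivity
  refine ⟨Real.exp (M + N), (Real.exp_pos _).le, fun v h1 h2 h3 => ?_⟩
  have hpos : 0 < mixedEmbedding.norm v := ha.trans_le h2
  have hne : ∀ w, normAtPlace w v ≠ 0 := mixedEmbedding.norm_ne_zero_iff.1 hpos.ne'
  have hlog : |Real.log (mixedEmbedding.norm v)| ≤ B := by
    rw [abs_le]
    constructor
    · have := Real.log_le_log ha h2
      have h5 := neg_abs_le (Real.log a)
      have := le_max_left |Real.log a| |Real.log b|
      linarith
    · have := Real.log_le_log hpos h3
      have h5 := le_abs_self (Real.log b)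
      have := le_max_right |Real.log a| |Real.log b|
      linarith
  have hd : (1 : ℝ) ≤ Module.finrank ℚ K := by
    exact_mod_cast Module.finrank_pos
  have hw : ∀ w, w ≠ w₀ → |Real.log (normAtPlace w v)| ≤ M := by
    intro w hw
    have h4 : |logMap v ⟨w, hw⟩| ≤ A := (norm_le_pi_norm (logMap v) ⟨w, hw⟩).trans h1
    rw [logMap_apply, abs_mul] at h4
    have hm : (1 : ℝ) ≤ mult w := by exact_mod_cast NumberField.InfinitePlace.one_le_mult
    have h5 : |Real.log (normAtPlace w v) - Real.log (mixedEmbedding.norm v) *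
        (Module.finrank ℚ K : ℝ)⁻¹| ≤ A := by
      refine le_trans ?_ h4
      simp only [Nat.abs_cast]
      exact le_mul_of_one_le_left (abs_nonneg _) hm
    have h6 : |Real.log (mixedEmbedding.norm v) * (Module.finrank ℚ K : ℝ)⁻¹| ≤ B := by
      rw [abs_mul, abs_of_nonneg (a := (Module.finrank ℚ K : ℝ)⁻¹) (by positivity)]
      refine le_trans (mul_le_of_le_one_right (abs_nonneg _) ?_) hlog
      exact inv_le_one_of_one_le₀ hd
    have h7 := abs_sub_abs_le_abs_sub (Real.log (normAtPlace w v))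
      (Real.log (mixedEmbedding.norm v) * (Module.finrank ℚ K : ℝ)⁻¹)
    have := le_abs_self A
    linarith
  have hsum : Real.log (mixedEmbedding.norm v) =
      ∑ w, (mult w : ℝ) * Real.log (normAtPlace w v) := by
    rw [mixedEmbedding.norm_apply, Real.log_prod (fun w _ => pow_ne_zero _ (hne w))]
    simp
  have hall : ∀ w, Real.log (normAtPlace w v) ≤ M + N := by
    intro w
    have hN0 : 0 ≤ N := by positivity
    by_cases h : w = w₀
    · subst h
      rw [← Finset.add_sum_erase _ _ (Finset.mem_univ w₀)] at hsum
      have h8 : |∑ w ∈ Finset.univ.erase w₀, (mult w : ℝ) * Real.log (normAtPlace w v)| ≤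
          ∑ w : InfinitePlace K, (mult w : ℝ) * M := by
        refine (Finset.abs_sum_le_sum_abs _ _).trans ?_
        refine (Finset.sum_le_sum (g := fun w => (mult w : ℝ) * M) fun w h => ?_).trans
          (Finset.sum_le_sum_of_subset_of_nonneg (Finset.erase_subset _ _) fun
            _ _ _ => by positivity)
        rw [abs_mul, Nat.abs_cast]
        gcongr
        exact hw w (Finset.ne_of_mem_erase h)
      have hm : (1 : ℝ) ≤ mult (w₀ : InfinitePlace K) := by
        exact_mod_cast NumberField.InfinitePlace.one_le_mult
      have h9 : (mult (w₀ : InfinitePlace K) : ℝ) * Real.log (normAtPlace w₀ v) ≤ N := by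
        have := abs_le.1 hlog
        have := abs_le.1 h8
        linarith
      rcases le_or_gt (Real.log (normAtPlace w₀ v)) 0 with h10 | h10
      · linarith
      · nlinarith
    · linarith [le_abs_self (Real.log (normAtPlace w v)), hw w h]
  rw [norm_eq_sup'_normAtPlace]
  refine Finset.sup'_le _ _ fun w _ => ?_
  exact (Real.log_le_iff_le_exp (lt_of_le_of_ne (normAtPlace_nonneg w v) (hne w).symm)).1 (hall w)

end MixedSmooth

section UnitPartition
open NumberField.mixedEmbedding NumberField.Units NumberField.Units.dirichletUnitTheorem
open NumberField.InfinitePlace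
open scoped Classical

/-- A smooth bump whose integer translates sum to one. -/
noncomputable def unitBump (t : ℝ) : ℝ := Real.smoothTransition (t + 1) - Real.smoothTransition t

lemma unitBump_contDiff : ContDiff ℝ (⊤ : ℕ∞) unitBump :=
  (Real.smoothTransition.contDiff.comp (contDiff_id.add contDiff_const)).sub
    Real.smoothTransition.contDiff

lemma unitBump_eq_zero {t : ℝ} (h : 1 ≤ |t|) : unitBump t = 0 := by
  unfold unitBump
  rcases le_abs.1 h with h | h
  · rw [Real.smoothTransition.one_of_one_le (by linarith), Real.smoothTransition.one_of_one_le h,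
      sub_self]
  · rw [Real.smoothTransition.zero_of_nonpos (by linarith),
      Real.smoothTransition.zero_of_nonpos (by linarith), sub_self]

lemma unitBump_sum (z : ℝ) : ∑ n ∈ {⌊-z⌋, ⌊-z⌋ + 1}, unitBump (n + z) = 1 := by
  rw [Finset.sum_pair (by simp)]
  unfold unitBump
  push_cast
  have h1 := Int.floor_le (-z)
  have h2 := Int.lt_floor_add_one (-z)
  rw [Real.smoothTransition.zero_of_nonpos (x := ⌊-z⌋ + z) (by linarith),
    Real.smoothTransition.one_of_one_le (x := (⌊-z⌋ : ℝ) + 1 + z + 1) (by linarith)]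
  have : (⌊-z⌋ : ℝ) + 1 + z = ⌊-z⌋ + z + 1 := by ring
  rw [this]; ring

lemma unitBump_eq_zero_of_notMem {z : ℝ} {n : ℤ} (hn : n ∉ ({⌊-z⌋, ⌊-z⌋ + 1} : Finset ℤ)) :
    unitBump (n + z) = 0 := by
  apply unitBump_eq_zero
  simp only [Finset.mem_insert, Finset.mem_singleton, not_or] at hn
  have h1 := Int.floor_le (-z)
  have h2 := Int.lt_floor_add_one (-z)
  rcases lt_or_gt_of_ne hn.1 with h | h
  · have : (n : ℝ) + 1 ≤ ⌊-z⌋ := by exact_mod_cast h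
    rw [le_abs]; right; linarith
  · have : ⌊-z⌋ + 1 < n := lt_of_le_of_ne h (Ne.symm hn.2)
    have : (⌊-z⌋ : ℝ) + 1 + 1 ≤ n := by exact_mod_cast this
    rw [le_abs]; left; linarith

variable (K : Type*) [Field K] [NumberField K]

/-- A smooth compactly supported function on the log space whose translates by the
unit lattice sum to a constant. -/
lemma exists_unit_partition :
    ∃ Φ : logSpace K → ℝ, ContDiff ℝ (⊤ : ℕ∞) Φ ∧ (∃ A, ∀ z, A < ‖z‖ → Φ z = 0) ∧
      ∀ z, HasSum (fun u : (𝓞 K)ˣ => Φ (logEmbedding K (Additive.ofMul u) +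
        z)) (torsionOrder K) := by
  let B := (basisUnitLattice K).ofZLatticeBasis ℝ (unitLattice K)
  refine ⟨fun z => ∏ i, unitBump (B.repr z i), ?_, ⟨∑ i, ‖B i‖, fun z hz => ?_⟩, fun z => ?_⟩
  · refine contDiff_prod fun i _ => unitBump_contDiff.comp ?_
    exact (LinearMap.toContinuousLinearMap (B.coord i)).contDiff
  · by_contra h
    rw [Finset.prod_eq_zero_iff] at h
    push Not at h
    have : ‖z‖ ≤ ∑ i, ‖B i‖ := by
      conv_lhs => rw [← B.sum_repr z]
      refine (norm_sum_le _ _).trans (Finset.sum_le_sum fun i _ => ?_)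
      rw [_root_.norm_smul]
      refine mul_le_of_le_one_left (norm_nonneg _) ?_
      rw [Real.norm_eq_abs]
      by_contra h'
      exact h i (Finset.mem_univ _) (unitBump_eq_zero (not_le.1 h').le)
    linarith
  · let e : torsion K × (Fin (rank K) → ℤ) ≃ (𝓞 K)ˣ :=
      Equiv.ofBijective (fun ζe => (ζe.1 : (𝓞 K)ˣ) * ∏ i, (fundSystem K i) ^ (ζe.2 i)) (by
        rw [Function.bijective_iff_existsUnique]
        intro x
        obtain ⟨y, hy, hy'⟩ := exist_unique_eq_mul_prod K x
        exact ⟨y, hy.symm, fun z hz => hy' z hz.symm⟩)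
    rw [← e.hasSum_iff]
    have hrepr : ∀ p : torsion K × (Fin (rank K) → ℤ), ∀ i,
        B.repr (logEmbedding K (Additive.ofMul (e p)) + z) i = p.2 i + B.repr z i := by
      intro p i
      have h1 : logEmbedding K (Additive.ofMul (e p)) = ∑ j, ((p.2 j : ℤ) : ℝ) • B j := by
        have h0 : logEmbedding K (Additive.ofMul (p.1 : (𝓞 K)ˣ)) = 0 :=
          logEmbedding_eq_zero_iff.2 p.1.2
        simp only [e, Equiv.ofBijective_apply, ofMul_mul, map_add, h0, zero_add, ofMul_prod,
          map_sum,
          ofMul_zpow, map_zsmul, logEmbedding_fundSystem, B, Module.Basis.ofZLatticeBasis_apply]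
        exact Finset.sum_congr rfl fun j _ => (Int.cast_smul_eq_zsmul ℝ _ _).symm
      rw [map_add, h1, Finsupp.add_apply, map_sum, Finsupp.finsetSum_apply]
      simp [Finsupp.single_apply]
    have hf : (fun u : (𝓞 K)ˣ => ∏ i, unitBump (B.repr (logEmbedding K (Additive.ofMul u) +
        z) i)) ∘ e =
        fun p => ∏ i, unitBump (p.2 i + B.repr z i) := by
      ext p
      simp only [Function.comp_apply, hrepr]
    rw [hf]
    have : Fintype (torsion K) := Fintype.ofFinite _
    have h2 := hasSum_sum_of_ne_finset_zero (L := .unconditional _) (f :=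
        fun p : torsion K × (Fin (rank K) → ℤ) =>
      ∏ i, unitBump (p.2 i + B.repr z i))
      (s := Finset.univ ×ˢ Fintype.piFinset fun i => ({⌊-(B.repr z i)⌋,
        ⌊-(B.repr z i)⌋ + 1} : Finset ℤ)) (by
        intro p hp
        simp only [Finset.mem_product, Finset.mem_univ, true_and, Fintype.mem_piFinset,
          not_forall] at hp
        obtain ⟨i, hi⟩ := hp
        exact Finset.prod_eq_zero (Finset.mem_univ i) (unitBump_eq_zero_of_notMem hi))
    convert h2 using 1
    rw [Finset.sum_product]
    have h3 := Finset.prod_univ_sum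
      (fun i => ({⌊-(B.repr z i)⌋, ⌊-(B.repr z i)⌋ + 1} : Finset ℤ))
      (fun i n => unitBump (n + B.repr z i))
    rw [Finset.prod_congr rfl fun i _ => unitBump_sum (B.repr z i), Finset.prod_const_one] at h3
    simp [torsionOrder, ← h3]

end UnitPartition

section IdealSum
open NumberField.mixedEmbedding NumberField.Units NumberField.Units.dirichletUnitTheorem
open NumberField.InfinitePlace
open scoped Classical nonZeroDivisors

/-- A tent function supported in `[1/4, 1]`. -/
noncomputable def tent (t : ℝ) : ℝ := max 0 (min (2 * t - 1 / 2) (1 - t))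

lemma tent_eq_zero {t : ℝ} (h : t ≤ 1 / 4 ∨ 1 ≤ t) : tent t = 0 := by
  unfold tent
  rcases h with h | h
  · exact max_eq_left ((min_le_left _ _).trans (by linarith))
  · exact max_eq_left ((min_le_right _ _).trans (by linarith))

lemma tent_nonneg (t : ℝ) : 0 ≤ tent t := le_max_left _ _

lemma tent_le_one (t : ℝ) : tent t ≤ 1 := by
  unfold tent
  refine max_le zero_le_one ?_
  rcases le_total t 0 with h | h
  · exact (min_le_left _ _).trans (by linarith)
  · exact (min_le_right _ _).trans (by linarith)

lemma tent_sub_le (s t : ℝ) : |tent s - tent t| ≤ 2 * |s - t| := by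
  unfold tent
  refine (abs_max_sub_max_le_max _ _ _ _).trans ?_
  rw [sub_self, abs_zero]
  refine max_le (by positivity) ?_
  refine (abs_min_sub_min_le_max _ _ _ _).trans (max_le ?_ ?_)
  · rw [show 2 * s - 1 / 2 - (2 * t - 1 / 2) = 2 * (s - t) by ring, abs_mul, abs_two]
  · rw [show 1 - s - (1 - t) = -(s - t) by ring, abs_neg]
    linarith [abs_nonneg (s - t)]

variable (K : Type*) [Field K] [NumberField K]

lemma lipschitz_logMap_mul_tent {Φ : logSpace K → ℝ} (hΦ : ContDiff ℝ (⊤ : ℕ∞) Φ) {A : ℝ}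
    (hA : ∀ z, A < ‖z‖ → Φ z = 0) :
    (∃ k, LipschitzWith k fun v : mixedSpace K => Φ (logMap v) * tent (mixedEmbedding.norm v)) ∧
    ∃ ρ, 0 ≤ ρ ∧ ∀ v : mixedSpace K, ρ < ‖v‖ → Φ (logMap v) * tent (mixedEmbedding.norm v) = 0 := by
  have key : ∀ (Ψ : logSpace K → ℝ) (B : ℝ) (χ : ℝ → ℝ) (a b : ℝ), ContDiff ℝ (⊤ : ℕ∞) Ψ →
      (∀ z, B < ‖z‖ → Ψ z = 0) → ContDiff ℝ (⊤ : ℕ∞) χ → 0 < a → (∀ t < a, χ t = 0) →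
      (∀ t, b < t → χ t = 0) → 
      (∃ k, LipschitzWith k fun v : mixedSpace K => Ψ (logMap v) * χ (mixedEmbedding.norm v)) ∧
      (∃ D, ∀ v : mixedSpace K, |Ψ (logMap v) * χ (mixedEmbedding.norm v)| ≤ D) := by
    intro Ψ B χ a b h1 h2 h3 h4 h5 h6
    obtain ⟨ρ, hρ0, hρ⟩ := exists_norm_le_of_logMap (K := K) (A := B) (b := b) h4
    have hcd := contDiff_logMap_mul_norm (K := K) h1 h3 h4 h5
    have hcs : HasCompactSupport fun v : mixedSpace K => Ψ (logMap v) *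
        χ (mixedEmbedding.norm v) := by
      refine HasCompactSupport.intro (isCompact_closedBall (0 : mixedSpace K) ρ) fun v hv => ?_
      by_contra hne
      have hne := mul_ne_zero_iff.1 hne
      apply hv
      rw [mem_closedBall_zero_iff]
      refine hρ v (not_lt.1 fun h => hne.1 (h2 _ h)) (not_lt.1 fun h => hne.2 (h5 _ h))
        (not_lt.1 fun h => hne.2 (h6 _ h))
    exact ⟨ContDiff.lipschitzWith_of_hasCompactSupport hcs hcd (by simp),
      by simpa using hcd.continuous.bounded_above_of_compact_support hcs⟩
  constructor
  · let χ₀ : ContDiffBump (5 / 8 : ℝ) := ⟨3 / 8, 1 / 2, by norm_num, by norm_num⟩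
    let χ₁ : ContDiffBump (5 / 8 : ℝ) := ⟨1 / 2, 9 / 16, by norm_num, by norm_num⟩
    let β : ContDiffBump (0 : logSpace K) := ⟨|A| + 1, |A| + 2, by positivity, by linarith⟩
    have z0 : ∀ t, (t < 1 / 8 ∨ 9 / 8 < t) → χ₀ t = 0 := by
      intro t ht
      refine χ₀.zero_of_le_dist ?_
      change (1 / 2 : ℝ) ≤ _
      rw [Real.dist_eq, le_abs]
      rcases ht with ht | ht
      · right; linarith
      · left; linarith
    have o0 : ∀ t, 1 / 4 ≤ t → t ≤ 1 → χ₀ t = 1 := by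
      intro t h1 h2
      refine χ₀.one_of_mem_closedBall ?_
      change dist _ _ ≤ (3 / 8 : ℝ)
      rw [Real.dist_eq, abs_le]
      constructor <;> linarith
    have z1 : ∀ t, (t < 1 / 16 ∨ 2 < t) → χ₁ t = 0 := by
      intro t ht
      refine χ₁.zero_of_le_dist ?_
      change (9 / 16 : ℝ) ≤ _
      rw [Real.dist_eq, le_abs]
      rcases ht with ht | ht
      · right; linarith
      · left; linarith
    have o1 : ∀ t, 1 / 8 ≤ t → t ≤ 9 / 8 → χ₁ t = 1 := by
      intro t h1 h2
      refine χ₁.one_of_mem_closedBall ?_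
      change dist _ _ ≤ (1 / 2 : ℝ)
      rw [Real.dist_eq, abs_le]
      constructor <;> linarith
    have zβ : ∀ z, |A| + 2 < ‖z‖ → β z = 0 := by
      intro z hz
      refine β.zero_of_le_dist ?_
      change |A| + 2 ≤ _
      rw [dist_zero_right]; exact hz.le
    have oβ : ∀ z, ‖z‖ ≤ A → β z = 1 := by
      intro z hz
      refine β.one_of_mem_closedBall ?_
      change dist _ _ ≤ |A| + 1
      rw [dist_zero_right]; linarith [le_abs_self A]
    obtain ⟨⟨k₀, hk₀⟩, D, hD⟩ := key Φ A χ₀ (1 / 8) (9 / 8) hΦ hA χ₀.contDiff (by norm_num)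
      (fun t ht => z0 t (Or.inl ht)) (fun t ht => z0 t (Or.inr ht))
    obtain ⟨⟨k₁, hk₁⟩, -⟩ := key β (|A| + 2) (fun t => t * χ₁ t) (1 / 16) 2 β.contDiff zβ
      (contDiff_id.mul χ₁.contDiff) (by norm_num)
      (fun t ht => by rw [z1 t (Or.inl ht), mul_zero]) (fun t ht => by rw [z1 t (Or.inr ht),
        mul_zero])
    set W : mixedSpace K → ℝ := fun v => Φ (logMap v) * χ₀ (mixedEmbedding.norm v) with hW
    set M : mixedSpace K → ℝ := fun v => β (logMap v) *
      (mixedEmbedding.norm v * χ₁ (mixedEmbedding.norm v)) with hM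
    have hF : (fun v : mixedSpace K => Φ (logMap v) * tent (mixedEmbedding.norm v)) =
        fun v => W v * tent (M v) := by
      ext v
      by_cases h1 : Φ (logMap v) = 0
      · simp [hW, h1]
      by_cases h2 : χ₀ (mixedEmbedding.norm v) = 0
      · have : tent (mixedEmbedding.norm v) = 0 := by
          apply tent_eq_zero
          by_contra h
          push Not at h
          rw [o0 _ h.1.le h.2.le] at h2
          exact one_ne_zero h2
        simp [hW, h2, this]
      have h3 : β (logMap v) = 1 := oβ _ (not_lt.1 fun h => h1 (hA _ h))
      have h4 : χ₁ (mixedEmbedding.norm v) = 1 :=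
        o1 _ (not_lt.1 fun h => h2 (z0 _ (Or.inl h))) (not_lt.1 fun h => h2 (z0 _ (Or.inr h)))
      simp only [hW, hM, h3, h4, one_mul, mul_one]
      by_cases h5 : tent (mixedEmbedding.norm v) = 0
      · rw [h5, mul_zero, mul_zero]
      · have : 1 / 4 ≤ mixedEmbedding.norm v ∧ mixedEmbedding.norm v ≤ 1 :=
          ⟨not_lt.1 fun h => h5 (tent_eq_zero (Or.inl h.le)),
            not_lt.1 fun h => h5 (tent_eq_zero (Or.inr h.le))⟩
        rw [o0 _ this.1 this.2, mul_one]
    rw [hF]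
    have hD0 : 0 ≤ D := (abs_nonneg _).trans (hD 0)
    refine ⟨k₀ + D.toNNReal * 2 * k₁, LipschitzWith.of_dist_le_mul fun v w => ?_⟩
    have e1 := hk₀.dist_le_mul v w
    have e2 := hk₁.dist_le_mul v w
    rw [Real.dist_eq] at e1 e2 ⊢
    have e3 : W v * tent (M v) - W w * tent (M w) =
        (W v - W w) * tent (M v) + W w * (tent (M v) - tent (M w)) := by ring
    rw [e3]
    refine (abs_add_le _ _).trans ?_
    rw [abs_mul, abs_mul, abs_of_nonneg (tent_nonneg (M v))]
    push_cast
    rw [Real.coe_toNNReal _ hD0, add_mul]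
    refine add_le_add ((mul_le_of_le_one_right (abs_nonneg _) (tent_le_one _)).trans e1) ?_
    calc |W w| * |tent (M v) - tent (M w)| ≤ D * (2 * |M v - M w|) := by
          gcongr
          · exact hD w
          · exact tent_sub_le _ _
      _ ≤ D * (2 * (k₁ * dist v w)) := by gcongr
      _ = _ := by ring
  · obtain ⟨ρ, hρ0, hρ⟩ := exists_norm_le_of_logMap (K := K) (A := A) (a := 1 / 4) (b :=
        1) (by norm_num)
    refine ⟨ρ, hρ0, fun v hv => ?_⟩
    by_contra hne
    have hne := mul_ne_zero_iff.1 hne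
    refine not_lt.2 (hρ v (not_lt.1 fun h => hne.1 (hA _ h)) ?_ ?_) hv
    · exact not_lt.1 fun h => hne.2 (tent_eq_zero (Or.inl h.le))
    · exact not_lt.1 fun h => hne.2 (tent_eq_zero (Or.inr h.le))

end IdealSum

section PrincipalSum
open NumberField.mixedEmbedding NumberField.Units NumberField.Units.dirichletUnitTheorem
open NumberField.InfinitePlace
open scoped Classical nonZeroDivisors

variable (K : Type*) [Field K] [NumberField K]

lemma hasSum_generators {Φ : logSpace K → ℝ} {w : ℝ}
    (hΦ : ∀ z, HasSum (fun u : (𝓞 K)ˣ => Φ (logEmbedding K (Additive.ofMul u) + z)) w)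
    {R : ℝ} (hR : 0 < R) (I : Ideal (𝓞 K)) (hI : I.IsPrincipal) (J : Ideal (𝓞 K)) (hJ : J ∣ I) :
    HasSum (fun α : {α : J // Ideal.span {(α : 𝓞 K)} = I} =>
      Φ (logMap (R⁻¹ • mixedEmbedding K ((α : J) : 𝓞 K))) *
        tent (mixedEmbedding.norm (R⁻¹ • mixedEmbedding K ((α : J) : 𝓞 K))))
      (w * tent (Ideal.absNorm I / R ^ Module.finrank ℚ K)) := by
  have hnorm : ∀ α : 𝓞 K, mixedEmbedding.norm (R⁻¹ • mixedEmbedding K (α : K)) =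
      Ideal.absNorm (Ideal.span {α}) / R ^ Module.finrank ℚ K := by
    intro α
    rw [mixedEmbedding.norm_smul, norm_eq_norm, Ideal.absNorm_span_singleton,
      abs_of_pos (by positivity),
      inv_pow, inv_mul_eq_div]
    congr 1
    rw [Nat.cast_natAbs, ← Algebra.coe_norm_int]
    push_cast
    rfl
  have hn : ∀ α : {α : J // Ideal.span {(α : 𝓞 K)} = I},
      mixedEmbedding.norm (R⁻¹ • mixedEmbedding K ((α : J) : 𝓞 K)) =
        Ideal.absNorm I / R ^ Module.finrank ℚ K := fun α => by rw [hnorm, α.2]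
  by_cases h0 : I = ⊥
  · have : tent (Ideal.absNorm I / R ^ Module.finrank ℚ K) = 0 := by
      apply tent_eq_zero; left; simp [h0]
    simp only [hn, this, mul_zero]
    exact hasSum_zero
  obtain ⟨α₀, hα₀⟩ := hI
  rw [Ideal.submodule_span_eq] at hα₀
  have hα0 : α₀ ≠ 0 := by
    rintro rfl
    simp at hα₀; exact h0 hα₀
  have hmem : ∀ u : (𝓞 K)ˣ, (u : 𝓞 K) * α₀ ∈ J := fun u =>
    J.mul_mem_left _ (Ideal.le_of_dvd hJ (by rw [hα₀]; exact Ideal.mem_span_singleton_self α₀))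
  let e : (𝓞 K)ˣ ≃ {α : J // Ideal.span {(α : 𝓞 K)} = I} :=
    Equiv.ofBijective (fun u => ⟨⟨u * α₀, hmem u⟩, by
      rw [hα₀, Ideal.span_singleton_eq_span_singleton]
      exact ⟨u⁻¹, by rw [mul_comm, ← mul_assoc]; simp⟩⟩) (by
      constructor
      · intro u v h
        simp only [Subtype.mk.injEq] at h
        exact Units.ext (mul_right_cancel₀ hα0 h)
      · rintro ⟨⟨α, hα⟩, h⟩
        simp only at h
        rw [hα₀, Ideal.span_singleton_eq_span_singleton] at h
        obtain ⟨u, hu⟩ := h.symm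
        exact ⟨u, Subtype.ext (Subtype.ext ((mul_comm _ _).trans hu))⟩)
  rw [← e.hasSum_iff]
  have hne : mixedEmbedding.norm (mixedEmbedding K (α₀ : K)) ≠ 0 := by
    rw [Ne, norm_eq_zero_iff' ⟨_, rfl⟩]
    simpa using hα0
  have h1 := (hΦ (logMap (mixedEmbedding K (α₀ : K)))).mul_right
    (tent (Ideal.absNorm I / R ^ Module.finrank ℚ K))
  refine (congrArg (fun f => HasSum f _) (funext fun u => ?_)).mpr h1
  rw [Function.comp_apply, hn]
  congr 2
  have h2 : mixedEmbedding K (((e u : J) : 𝓞 K) : K) = u • mixedEmbedding K (α₀ : K) := by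
    change mixedEmbedding K (((u : 𝓞 K) * α₀ : 𝓞 K) : K) = _
    rw [unitSMul_smul, ← map_mul]
    exact congrArg _ (map_mul (algebraMap (𝓞 K) K) _ _)
  rw [h2, logMap_real_smul (by rwa [norm_unit_smul]) (by positivity), logMap_unit_smul _ hne]

/-- Tent-weighted count of the principal multiples of a fixed ideal. -/
theorem exists_hasSum_principal (J : (Ideal (𝓞 K))⁰) :
    ∃ c C : ℝ, ∀ R : ℝ, 1 ≤ R → ∃ S : ℝ,
      |S - c * R ^ Module.finrank ℚ K| ≤ C * R ^ Module.finrank ℚ K / R ∧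
      HasSum (fun I : {I : Ideal (𝓞 K) // (J : Ideal (𝓞 K)) ∣ I ∧ I.IsPrincipal} =>
        tent (Ideal.absNorm (I : Ideal (𝓞 K)) / R ^ Module.finrank ℚ K)) S := by
  obtain ⟨Φ, hΦ, ⟨A, hA⟩, hsum⟩ := exists_unit_partition K
  obtain ⟨⟨k, hk⟩, ρ, hρ0, hρ⟩ := lipschitz_logMap_mul_tent K hΦ hA
  set F : mixedSpace K → ℝ := fun v => Φ (logMap v) * tent (mixedEmbedding.norm v) with hF
  set b := fractionalIdealLatticeBasis K (FractionalIdeal.mk0 K J) with hb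
  obtain ⟨c, C, hC⟩ := ZSpan.exists_tsum_sub_le b F hk hρ hρ0
  rw [mixedEmbedding.finrank] at hC
  set w : ℝ := (torsionOrder K : ℝ) with hw
  have hw0 : 0 < w := Nat.cast_pos.2 (torsionOrder_pos K)
  refine ⟨c / w, C / w, fun R hR => ?_⟩
  have hR0 : 0 < R := by linarith
  set T := ∑' v : Submodule.span ℤ (Set.range b), F (R⁻¹ • (v : mixedSpace K)) with hT
  refine ⟨T / w, ?_, ?_⟩
  · rw [show T / w - c / w * R ^ Module.finrank ℚ K = (T - c * R ^ Module.finrank ℚ K) / w by ring,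
      show C / w * R ^ Module.finrank ℚ K / R = C * R ^ Module.finrank ℚ K / R / w by ring, abs_div,
      abs_of_pos hw0]
    gcongr
    exact hC R hR
  have hfin : (Function.support fun v : Submodule.span ℤ (Set.range b) => F (R⁻¹ • (v :
      mixedSpace K))).Finite := by
    have h1 := ZSpan.setFinite_inter b (Metric.isBounded_closedBall (x :=
        (0 : mixedSpace K)) (r := ρ * R))
    refine Set.Finite.of_finite_image (f := Subtype.val) (h1.subset ?_) Subtype.val_injective.injOn
    rintro _ ⟨v, hv, rfl⟩
    refine ⟨?_, v.2⟩
    rw [mem_closedBall_zero_iff]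
    by_contra h
    refine hv (hρ _ ?_)
    rw [_root_.norm_smul, Real.norm_of_nonneg (by positivity), inv_mul_eq_div, lt_div_iff₀ hR0]
    exact not_le.1 h
  have hsummable := (summable_of_hasFiniteSupport (L := .unconditional _) hfin).hasSum
  have hmem : ∀ α : (J : Ideal (𝓞 K)), mixedEmbedding K ((α : 𝓞 K) :
      K) ∈ Submodule.span ℤ (Set.range b) := by
    intro α
    rw [hb, mem_span_fractionalIdealLatticeBasis]
    exact ⟨_, by simp, rfl⟩
  let e : (J : Ideal (𝓞 K)) ≃ Submodule.span ℤ (Set.range b) :=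
    Equiv.ofBijective (fun α => ⟨_, hmem α⟩) (by
      constructor
      · intro α β h
        simp only [Subtype.mk.injEq] at h
        exact Subtype.ext (RingOfIntegers.coe_injective (mixedEmbedding_injective K h))
      · rintro ⟨v, hv⟩
        have hv' := hv
        rw [hb, mem_span_fractionalIdealLatticeBasis] at hv'
        obtain ⟨x, hx, rfl⟩ := hv'
        simp only [FractionalIdeal.coe_mk0, SetLike.mem_coe, FractionalIdeal.mem_coeIdeal] at hx
        obtain ⟨α, hα, rfl⟩ := hx
        exact ⟨⟨α, hα⟩, rfl⟩)
  have he : ∀ α, ((e α : Submodule.span ℤ (Set.range b)) : mixedSpace K) =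
      mixedEmbedding K ((α : 𝓞 K) : K) := fun _ => rfl
  clear_value e
  rw [← hT, ← e.hasSum_iff] at hsummable
  replace hsummable : HasSum (fun α : (J : Ideal (𝓞 K)) =>
      F (R⁻¹ • mixedEmbedding K ((α : 𝓞 K) : K))) T := by
    convert hsummable using 2 with α
    rw [Function.comp_apply, he]
  let p : ↥(J : Ideal (𝓞 K)) → {I : Ideal (𝓞 K) // (J : Ideal (𝓞 K)) ∣ I ∧ I.IsPrincipal} :=
    fun α => ⟨Ideal.span {(α : 𝓞 K)}, Ideal.dvd_span_singleton.2 α.2, ⟨α, rfl⟩⟩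
  rw [← (Equiv.sigmaFiberEquiv p).hasSum_iff] at hsummable
  have h2 : HasSum (fun I : {I : Ideal (𝓞 K) // (J : Ideal (𝓞 K)) ∣ I ∧ I.IsPrincipal} =>
      w * tent (Ideal.absNorm (I : Ideal (𝓞 K)) / R ^ Module.finrank ℚ K)) T := by
    refine HasSum.sigma hsummable fun I => ?_
    have h3 := hasSum_generators K hsum hR0 I I.2.2 J I.2.1
    let e' : {α // p α = I} ≃ {α : (J : Ideal (𝓞 K)) // Ideal.span {(α : 𝓞 K)} = I} :=
      Equiv.subtypeEquivRight fun α => by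
        rw [← Subtype.val_inj]
    have h5 := e'.hasSum_iff.2 h3
    convert h5 using 1
    funext c
    rfl
  have h4 := h2.mul_left w⁻¹
  simp only [inv_mul_cancel_left₀ hw0.ne'] at h4
  rwa [div_eq_inv_mul]

end PrincipalSum

section Dyadic
open Finset

lemma abs_sub_sq_le_of_dyadic {f h : ℝ → ℝ} {c C p lam : ℝ} (hf : ∀ x ≤ 1, f x = 0)
    (hfh : ∀ x, f x = h x + lam * f (x / 2)) (hh : ∀ x, 1 ≤ x → |h x - c * x ^ 2| ≤ C * x ^ p)
    (hp2 : p ≤ 2) (hlam0 : 0 ≤ lam) (hlam : lam * 2 ^ (-p) < 1) :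
    ∃ c' C' : ℝ, 0 ≤ C' ∧ ∀ x, 0 < x → |f x - c' * x ^ 2| ≤ C' * x ^ p := by
  have hl4 : lam < 4 := by
    have h1 : (2 : ℝ) ^ (-2 : ℝ) ≤ 2 ^ (-p) :=
      Real.rpow_le_rpow_of_exponent_le (by norm_num) (by linarith)
    have h2 : (2 : ℝ) ^ (-2 : ℝ) = 1 / 4 := by
      rw [Real.rpow_neg (by norm_num)]; norm_num
    rw [h2] at h1
    by_contra! h
    linarith [mul_le_mul h h1 (by norm_num) hlam0]
  set r := lam * 2 ^ (-p) with hr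
  set c' := c / (1 - lam / 4) with hc'
  have hcc : c = c' * (1 - lam / 4) := by
    rw [hc', div_mul_cancel₀]; linarith
  set C' := max |c'| (C / (1 - r)) with hC'
  have hC1 : |c'| ≤ C' := le_max_left _ _
  have hC2 : C + r * C' ≤ C' := by
    have := le_max_right |c'| (C / (1 - r))
    rw [← hC', div_le_iff₀ (by linarith)] at this
    linarith
  have hC0 : 0 ≤ C' := (abs_nonneg _).trans hC1
  have hsmall : ∀ x, 0 < x → x ≤ 1 → |f x - c' * x ^ 2| ≤ C' * x ^ p := by
    intro x hx hx1
    rw [hf x hx1, zero_sub, abs_neg, abs_mul, abs_of_nonneg (sq_nonneg x)]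
    gcongr
    rw [← Real.rpow_natCast]
    exact Real.rpow_le_rpow_of_exponent_ge hx hx1 (by exact_mod_cast hp2)
  refine ⟨c', C', hC0, ?_⟩
  have key : ∀ n : ℕ, ∀ x, 0 < x → x ≤ 2 ^ n → |f x - c' * x ^ 2| ≤ C' * x ^ p := by
    intro n
    induction n with
    | zero => intro x hx hx1; exact hsmall x hx (by simpa using hx1)
    | succ n ih =>
      intro x hx hxn
      rcases le_total x 1 with h1 | h1
      · exact hsmall x hx h1
      have h2 := ih (x / 2) (by positivity) (by rw [pow_succ] at hxn; linarith)
      have h3 := hh x h1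
      have h4 : f x - c' * x ^ 2 = (h x - c * x ^ 2) + lam * (f (x / 2) - c' * (x / 2) ^ 2) := by
        rw [hfh x]; clear_value c'; linear_combination x ^ 2 * hcc
      rw [h4]
      have h5 : (x / 2) ^ p = x ^ p * 2 ^ (-p) := by
        rw [Real.div_rpow hx.le (by norm_num), Real.rpow_neg (by norm_num), div_eq_mul_inv]
      calc _ ≤ C * x ^ p + lam * (C' * (x / 2) ^ p) := by
            refine (abs_add_le _ _).trans (add_le_add h3 ?_)
            rw [abs_mul, abs_of_nonneg hlam0]
            gcongr
        _ = (C + r * C') * x ^ p := by rw [h5, hr]; ring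
        _ ≤ C' * x ^ p := by gcongr
  intro x hx
  obtain ⟨n, hn⟩ := pow_unbounded_of_one_lt x (by norm_num : (1 : ℝ) < 2)
  exact key n x hx hn.le

/-- The first Riesz mean of a sequence. -/
noncomputable def rieszSum (a : ℕ → ℝ) (x : ℝ) : ℝ :=
  ∑ n ∈ range (⌊x⌋₊ + 1), a n * max 0 (x - n)

lemma rieszSum_eq (a : ℕ → ℝ) {x : ℝ} {M : ℕ} (hM : x ≤ M) :
    rieszSum a x = ∑ n ∈ range M, a n * max 0 (x - n) := by
  have hz : ∀ n : ℕ, x ≤ n → a n * max 0 (x - n) = 0 := fun n hn => by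
    rw [max_eq_left (by linarith), mul_zero]
  have h1 : ∀ k l : ℕ, k ≤ l → x ≤ k →
      ∑ n ∈ range l, a n * max 0 (x - n) = ∑ n ∈ range k, a n * max 0 (x - n) := by
    intro k l hkl hk
    symm
    apply sum_subset (range_mono hkl)
    intro n _ hn
    rw [mem_range, not_lt] at hn
    exact hz n (hk.trans (by exact_mod_cast hn))
  have h2 : x ≤ (⌊x⌋₊ + 1 : ℕ) := by push_cast; exact (Nat.lt_floor_add_one x).le
  rw [rieszSum]
  rcases le_total (⌊x⌋₊ + 1) M with h | h
  · exact (h1 _ _ h h2).symm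
  · exact h1 _ _ h hM

lemma mul_tent_div {x : ℝ} (hx : 0 < x) (t : ℝ) (ht : 0 ≤ t) :
    x * tent (t / x) = max 0 (x - t) - 3 * max 0 (x / 2 - t) + 2 * max 0 (x / 2 / 2 - t) := by
  obtain ⟨s, rfl⟩ : ∃ s, t = s * x := ⟨t / x, by field_simp⟩
  have hs : 0 ≤ s := by
    by_contra h
    nlinarith
  rw [mul_div_cancel_right₀ _ hx.ne', tent]
  have e1 : x - s * x = x * (1 - s) := by ring
  have e2 : x / 2 - s * x = x * (1 / 2 - s) := by ring
  have e3 : x / 2 / 2 - s * x = x * (1 / 4 - s) := by ring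
  have hm : ∀ u, max 0 (x * u) = x * max 0 u := fun u => by
    rw [mul_max_of_nonneg _ _ hx.le, mul_zero]
  rw [e1, e2, e3, hm, hm, hm]
  have : max 0 (min (2 * s - 1 / 2) (1 - s)) =
      max 0 (1 - s) - 3 * max 0 (1 / 2 - s) + 2 * max 0 (1 / 4 - s) := by
    rcases le_total s (1 / 4) with h | h
    · rw [max_eq_right (by linarith : 0 ≤ 1 - s), max_eq_right (by linarith : 0 ≤ 1 / 2 - s),
        max_eq_right (by linarith : 0 ≤ 1 / 4 - s), min_eq_left (by linarith),
        max_eq_left (by linarith)]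
      ring
    rcases le_total s (1 / 2) with h' | h'
    · rw [max_eq_right (by linarith : 0 ≤ 1 - s), max_eq_right (by linarith : 0 ≤ 1 / 2 - s),
        max_eq_left (by linarith : 1 / 4 - s ≤ 0), min_eq_left (by linarith),
        max_eq_right (by linarith)]
      ring
    rw [max_eq_left (by linarith : 1 / 2 - s ≤ 0), max_eq_left (by linarith : 1 / 4 - s ≤ 0),
      min_eq_right (by linarith)]
    ring
  rw [this]; ring

lemma exists_rieszSum_of_tent {a : ℕ → ℝ} (h0 : a 0 = 0) {c C δ : ℝ} (hδ : 0 < δ) (hδ1 : δ < 1)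
    (h : ∀ x : ℝ, 1 ≤ x →
      |∑ n ∈ range (⌊x⌋₊ + 1), a n * tent (n / x) - c * x| ≤ C * x ^ (1 - δ)) :
    ∃ κ C' : ℝ, 0 ≤ C' ∧ ∀ x, 0 < x → |rieszSum a x - κ * x ^ 2| ≤ C' * x ^ (2 - δ) := by
  have hN1 : ∀ x ≤ 1, rieszSum a x = 0 := by
    intro x hx
    rw [rieszSum_eq a (M := 1) (by exact_mod_cast hx)]
    simp [h0]
  set D : ℝ → ℝ := fun x => rieszSum a x - 2 * rieszSum a (x / 2) with hD
  have hD0 : ∀ x ≤ 1, D x = 0 := by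
    intro x hx
    simp only [hD]
    rw [hN1 x hx]
    rcases le_total x 0 with h | h
    · rw [hN1 (x / 2) (by linarith)]; ring
    · rw [hN1 (x / 2) (by linarith)]; ring
  have hG : ∀ x : ℝ, 1 ≤ x → x * ∑ n ∈ range (⌊x⌋₊ + 1), a n * tent (n / x) = D x - D (x / 2) := by
    intro x hx
    have hM : x ≤ (⌊x⌋₊ + 1 : ℕ) := by push_cast; exact (Nat.lt_floor_add_one x).le
    simp only [hD]
    rw [rieszSum_eq a hM, rieszSum_eq a (x := x / 2) (by linarith : _ ≤ ((⌊x⌋₊ + 1 : ℕ) : ℝ)),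
      rieszSum_eq a (x := x / 2 / 2) (by linarith : _ ≤ ((⌊x⌋₊ + 1 : ℕ) : ℝ))]
    simp only [mul_sum, ← sum_sub_distrib]
    refine sum_congr rfl fun n _ => ?_
    have := mul_tent_div (x := x) (by linarith) n (Nat.cast_nonneg n)
    linear_combination a n * this
  have hp2 : (2 : ℝ) ^ (-(2 - δ)) < 1 / 2 := by
    have : (1 / 2 : ℝ) = 2 ^ (-1 : ℝ) := by rw [Real.rpow_neg_one]; norm_num
    rw [this]
    exact Real.rpow_lt_rpow_of_exponent_lt (by norm_num) (by linarith)
  obtain ⟨c1, C1, hC1, h1⟩ := abs_sub_sq_le_of_dyadic (f := D) (h := fun x => D x - D (x / 2))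
    (c := c) (C := C) (p := 2 - δ) (lam := 1) hD0 (fun x => by ring) (by
      intro x hx
      have hx0 : 0 < x := by linarith
      rw [← hG x hx, show ∀ S : ℝ, x * S - c * x ^ 2 = x * (S - c * x) from fun S => by ring,
        abs_mul, abs_of_pos hx0, show 2 - δ = 1 + (1 - δ) by ring, Real.rpow_add hx0, Real.rpow_one]
      have := mul_le_mul_of_nonneg_left (h x hx) hx0.le
      linarith) (by linarith) (by norm_num) (by linarith)
  obtain ⟨c2, C2, hC2, h2⟩ := abs_sub_sq_le_of_dyadic (f := rieszSum a) (h := D)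
    (c := c1) (C := C1) (p := 2 - δ) (lam := 2) hN1 (fun x => by simp only [hD]; ring)
    (fun x hx => h1 x (by linarith)) (by linarith) (by norm_num) (by linarith)
  exact ⟨c2, C2, hC2, h2⟩

lemma mul_sum_le_rieszSum_sub {a : ℕ → ℝ} (ha : ∀ n, 0 ≤ a n) {x H : ℝ} (hx : 0 ≤ x) (hH : 0 ≤ H) :
    H * ∑ n ∈ range (⌊x⌋₊ + 1), a n ≤ rieszSum a (x + H) - rieszSum a x := by
  have hM : x + H ≤ (⌊x + H⌋₊ + 1 : ℕ) := by push_cast; exact (Nat.lt_floor_add_one _).le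
  rw [rieszSum, rieszSum_eq a (x := x) (by linarith : _ ≤ ((⌊x + H⌋₊ + 1 : ℕ) : ℝ)),
    ← sum_sub_distrib, mul_sum]
  have hsub : range (⌊x⌋₊ + 1) ⊆ range (⌊x + H⌋₊ + 1) :=
    range_mono (Nat.succ_le_succ (Nat.floor_mono (by linarith)))
  have hmax : ∀ n : ℕ, max 0 (x - n) ≤ max 0 (x + H - n) := fun n =>
    max_le_max le_rfl (by linarith)
  refine (sum_le_sum fun n hn => ?_).trans (sum_le_sum_of_subset_of_nonneg hsub fun n _ _ => ?_)
  · have hn' : (n : ℝ) ≤ x := by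
      rw [mem_range, Nat.lt_succ_iff] at hn
      exact (Nat.le_floor_iff hx).1 hn
    rw [max_eq_right (by linarith), max_eq_right (by linarith)]
    linarith
  · rw [← mul_sub]
    exact mul_nonneg (ha n) (by linarith [hmax n])

lemma rieszSum_sub_le_mul_sum {a : ℕ → ℝ} (ha : ∀ n, 0 ≤ a n) {x H : ℝ} (hH : 0 ≤ H) :
    rieszSum a x - rieszSum a (x - H) ≤ H * ∑ n ∈ range (⌊x⌋₊ + 1), a n := by
  have hM : x ≤ (⌊x⌋₊ + 1 : ℕ) := by push_cast; exact (Nat.lt_floor_add_one _).le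
  rw [rieszSum, rieszSum_eq a (x := x - H) (by linarith : _ ≤ ((⌊x⌋₊ + 1 : ℕ) : ℝ)),
    ← sum_sub_distrib, mul_sum]
  refine sum_le_sum fun n hn => ?_
  rw [← mul_sub, mul_comm]
  refine mul_le_mul_of_nonneg_right ?_ (ha n)
  rcases le_total 0 (x - n) with h | h
  · rw [max_eq_right h]
    have := le_max_right 0 (x - H - n)
    linarith
  · rw [max_eq_left h]
    have := le_max_left 0 (x - H - n)
    linarith

/-- Asymptotics with a power saving for the Riesz mean of a nonnegative sequence give the same
for its partial sums. -/
lemma exists_sum_of_rieszSum {a : ℕ → ℝ} (ha : ∀ n, 0 ≤ a n) {κ C δ : ℝ} (hδ : 0 < δ) (hδ1 : δ < 1)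
    (hC : 0 ≤ C) (h : ∀ x, 0 < x → |rieszSum a x - κ * x ^ 2| ≤ C * x ^ (2 - δ)) :
    ∃ C' : ℝ, ∀ x, 1 ≤ x → |∑ n ∈ range (⌊x⌋₊ + 1), a n - 2 * κ * x| ≤ C' * x ^ (1 - δ / 2) := by
  refine ⟨|κ| + 10 * C, fun x hx => ?_⟩
  have hx0 : 0 < x := by linarith
  set y := x ^ (1 - δ / 2) with hy
  have hy0 : 0 < y := by positivity
  have hyx : y ≤ x := by
    calc y ≤ x ^ (1 : ℝ) := Real.rpow_le_rpow_of_exponent_le hx (by linarith)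
      _ = x := Real.rpow_one x
  have hyy : x ^ (2 - δ) = y ^ 2 := by
    rw [hy, ← Real.rpow_natCast, ← Real.rpow_mul hx0.le]; congr 1; push_cast; ring
  set H := y / 2 with hH
  have hH0 : 0 < H := by positivity
  have hb : ∀ z, 0 < z → z ≤ 2 * x → |rieszSum a z - κ * z ^ 2| ≤ 4 * C * y ^ 2 := by
    intro z hz hzx
    refine (h z hz).trans ?_
    calc C * z ^ (2 - δ) ≤ C * (2 * x) ^ (2 - δ) := by
          gcongr; linarith
      _ = C * (2 ^ (2 - δ) * y ^ 2) := by rw [Real.mul_rpow (by norm_num) hx0.le, hyy]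
      _ ≤ C * (4 * y ^ 2) := by
          gcongr
          calc (2 : ℝ) ^ (2 - δ) ≤ 2 ^ (2 : ℝ) :=
                Real.rpow_le_rpow_of_exponent_le (by norm_num) (by linarith)
            _ = 4 := by norm_num
      _ = _ := by ring
  have h1 : |rieszSum a x - κ * x ^ 2| ≤ C * y ^ 2 := by rw [← hyy]; exact h x hx0
  have h2 := hb (x + H) (by linarith) (by linarith)
  have h3 := hb (x - H) (by linarith) (by linarith)
  have u1 := mul_sum_le_rieszSum_sub ha hx0.le hH0.le
  have u2 := rieszSum_sub_le_mul_sum ha (x := x) hH0.le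
  set N := ∑ n ∈ range (⌊x⌋₊ + 1), a n
  rw [abs_le] at h1 h2 h3
  have hk := abs_le.1 (le_refl |κ|)
  have hkH : |κ * H ^ 2| ≤ |κ| * H ^ 2 := by rw [abs_mul, abs_of_nonneg (sq_nonneg H)]
  rw [abs_le] at hkH
  have hyH : y = 2 * H := by rw [hH]; ring
  have hkH2 : |κ| * H ^ 2 ≤ |κ| * (2 * H ^ 2) := by
    have := abs_nonneg κ
    have := sq_nonneg H
    nlinarith [mul_nonneg ‹0 ≤ |κ|› this]
  rw [hyH] at h1 h2 h3
  rw [abs_le, hyH]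
  constructor
  · refine le_of_mul_le_mul_left ?_ hH0
    nlinarith [h1, h3, u2, hkH, hkH2]
  · refine le_of_mul_le_mul_left ?_ hH0
    nlinarith [h1, h2, u1, hkH, hkH2]

end Dyadic

section IdealCount
open Ideal Filter Topology
open scoped nonZeroDivisors

variable (K : Type*) [Field K] [NumberField K]

lemma exists_hasSum_class (C : ClassGroup (𝓞 K)) :
    ∃ c C' : ℝ, ∀ x : ℝ, 1 ≤ x → ∃ S : ℝ,
      |S - c * x| ≤ C' * x ^ (1 - (Module.finrank ℚ K : ℝ)⁻¹) ∧
      HasSum (fun I : {I : (Ideal (𝓞 K))⁰ // ClassGroup.mk0 I = C} =>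
        tent (absNorm ((I : (Ideal (𝓞 K))⁰) : Ideal (𝓞 K)) / x)) S := by
  obtain ⟨J, hJ⟩ := ClassGroup.mk0_surjective C⁻¹
  obtain ⟨c, C', h⟩ := exists_hasSum_principal K J
  set d := Module.finrank ℚ K with hd
  have hd0 : d ≠ 0 := Module.finrank_pos.ne'
  set N : ℝ := ((absNorm (J : Ideal (𝓞 K)) : ℕ) : ℝ) with hN
  have hN1 : 1 ≤ N := by
    rw [hN]; exact_mod_cast absNorm_pos_of_nonZeroDivisors J
  refine ⟨c * N, C' * N ^ (1 - (d : ℝ)⁻¹), fun x hx => ?_⟩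
  have hx0 : 0 < x := by linarith
  have hN0 : 0 < N := by linarith
  set R : ℝ := (x * N) ^ (d : ℝ)⁻¹ with hR
  have hR1 : 1 ≤ R := Real.one_le_rpow (by nlinarith) (by positivity)
  have hRd : R ^ d = x * N := Real.rpow_inv_natCast_pow (by positivity) hd0
  obtain ⟨S, hS, hsum⟩ := h R hR1
  refine ⟨S, ?_, ?_⟩
  · rw [hRd] at hS
    calc |S - c * N * x| = |S - c * (x * N)| := by ring_nf
      _ ≤ _ := hS
      _ = _ := by
        rw [hR, mul_assoc C', ← Real.mul_rpow hN0.le hx0.le, mul_comm N x,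
          Real.rpow_sub (by positivity),
          Real.rpow_one]
        ring
  · let e : {I : (Ideal (𝓞 K))⁰ // ClassGroup.mk0 I = C} →
        {I : Ideal (𝓞 K) // (J : Ideal (𝓞 K)) ∣ I ∧ I.IsPrincipal} := fun I =>
      ⟨J * I, dvd_mul_right _ _, by
        have h1 : ClassGroup.mk0 (J * (I : (Ideal (𝓞 K))⁰)) = 1 :=
            by rw [map_mul, hJ, I.2, inv_mul_cancel]
        exact (ClassGroup.mk0_eq_one_iff (J * (I : (Ideal (𝓞 K))⁰)).2).1 h1⟩
    have he : Function.Injective e := by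
      intro I I' h
      have h1 : (J : Ideal (𝓞 K)) * I = J * I' := congrArg Subtype.val h
      exact Subtype.ext (Subtype.ext (mul_left_cancel₀ (nonZeroDivisors.coe_ne_zero J) h1))
    have hz : ∀ I ∉ Set.range e, tent (absNorm (I : Ideal (𝓞 K)) / R ^ d) = 0 := by
      rintro ⟨I, ⟨I', rfl⟩, hI⟩ hr
      by_cases h0 : I' = 0
      · apply tent_eq_zero; left; simp [h0]
      · exfalso
        apply hr
        have hm : I' ∈ (Ideal (𝓞 K))⁰ := mem_nonZeroDivisors_of_ne_zero h0
        refine ⟨⟨⟨I', hm⟩, ?_⟩, rfl⟩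
        have h1 := (ClassGroup.mk0_eq_one_iff (J * (⟨I', hm⟩ : (Ideal (𝓞 K))⁰)).2).2 hI
        have h2 : ClassGroup.mk0 J * ClassGroup.mk0 ⟨I', hm⟩ = 1 := by
          rw [← map_mul]; exact h1
        rw [hJ, inv_mul_eq_one] at h2
        exact h2.symm
    have h3 := (he.hasSum_iff hz).2 hsum
    convert h3 using 1
    funext I
    simp only [Function.comp_apply, e, map_mul, hRd, Nat.cast_mul]
    rw [mul_comm x N, ← hN, mul_div_mul_left _ _ hN0.ne']

/-- The number of nonzero ideals of given norm. -/
noncomputable def idealCard (n : ℕ) : ℕ :=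
  Nat.card {I : (Ideal (𝓞 K))⁰ // absNorm (I : Ideal (𝓞 K)) = n}

lemma finite_absNorm_eq (n : ℕ) : Finite {I : (Ideal (𝓞 K))⁰ // absNorm (I : Ideal (𝓞 K)) = n} := by
  have h := finite_setOfPred_absNorm_le₀ (S := 𝓞 K) n
  have h2 : ({I : (Ideal (𝓞 K))⁰ | absNorm (I : Ideal (𝓞 K)) = n}).Finite :=
    Set.Finite.subset h fun I hI => le_of_eq hI
  exact h2

lemma idealCard_zero : idealCard K 0 = 0 := by
  unfold idealCard
  rw [Nat.card_eq_zero]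
  left
  exact ⟨fun I => (absNorm_pos_of_nonZeroDivisors (I : (Ideal (𝓞 K))⁰)).ne' I.2⟩

lemma exists_sum_idealCard_tent : ∃ c C' : ℝ, ∀ x : ℝ, 1 ≤ x →
      |∑ n ∈ Finset.range (⌊x⌋₊ + 1), (idealCard K n : ℝ) * tent (n / x) - c * x| ≤
        C' * x ^ (1 - (Module.finrank ℚ K : ℝ)⁻¹) := by
  choose c C' h using exists_hasSum_class K
  refine ⟨∑ C, c C, ∑ C, C' C, fun x hx => ?_⟩
  have hx0 : 0 < x := by linarith
  choose S hS hsum using fun C => h C x hx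
  have h1 : HasSum (fun I : (Ideal (𝓞 K))⁰ => tent (absNorm (I : Ideal (𝓞 K)) / x)) (∑ C, S C) := by
    rw [← (Equiv.sigmaFiberEquiv (ClassGroup.mk0 : (Ideal (𝓞 K))⁰ → _)).hasSum_iff]
    refine HasSum.sigma_of_hasSum (hasSum_fintype S) (fun C => hsum C) ?_
    refine (summable_sigma_of_nonneg fun _ => tent_nonneg _).2 ?_
    exact ⟨fun C => (hsum C).summable, (hasSum_fintype _).summable⟩
  rw [← (Equiv.sigmaFiberEquiv (fun I : (Ideal (𝓞 K))⁰ => absNorm (I :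
    Ideal (𝓞 K)))).hasSum_iff] at h1
  have h2 : HasSum (fun n : ℕ => (idealCard K n : ℝ) * tent (n / x)) (∑ C, S C) := by
    refine h1.sigma fun n => ?_
    have := finite_absNorm_eq K n
    have := Fintype.ofFinite {I : (Ideal (𝓞 K))⁰ // absNorm (I : Ideal (𝓞 K)) = n}
    convert hasSum_fintype _ using 1
    rw [Finset.sum_congr rfl (g := fun _ => tent (n / x))]
    · rw [Finset.sum_const, nsmul_eq_mul, idealCard, Nat.card_eq_fintype_card, Finset.card_univ]
    · intro I _
      have h3 : absNorm ((I : (Ideal (𝓞 K))⁰) : Ideal (𝓞 K)) = n := I.2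
      simp only [Function.comp_apply, Equiv.sigmaFiberEquiv_apply]
      rw [h3]
  have h4 : ∑ n ∈ Finset.range (⌊x⌋₊ + 1), (idealCard K n : ℝ) * tent (n / x) = ∑ C, S C := by
    refine (hasSum_sum_of_ne_finset_zero fun n hn => ?_).unique h2
    rw [Finset.mem_range, not_lt] at hn
    rw [tent_eq_zero, mul_zero]
    right
    rw [one_le_div hx0]
    exact (Nat.lt_floor_add_one x).le.trans (by exact_mod_cast hn)
  rw [h4, Finset.sum_mul, Finset.sum_mul, ← Finset.sum_sub_distrib]
  exact (Finset.abs_sum_le_sum_abs _ _).trans (Finset.sum_le_sum fun C _ => hS C)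

lemma sum_idealCard (x : ℝ) (hx : 0 ≤ x) : ∑ n ∈ Finset.range (⌊x⌋₊ + 1), (idealCard K n : ℝ) =
    Nat.card {I : (Ideal (𝓞 K))⁰ // (absNorm (I : Ideal (𝓞 K)) : ℝ) ≤ x} := by
  rw [← Nat.cast_sum]
  congr 1
  simp_rw [← Nat.le_floor_iff hx]
  have hf : Finite {I : (Ideal (𝓞 K))⁰ // absNorm (I : Ideal (𝓞 K)) ≤ ⌊x⌋₊} :=
    finite_setOfPred_absNorm_le₀ ⌊x⌋₊
  have := Fintype.ofFinite {I : (Ideal (𝓞 K))⁰ // absNorm (I : Ideal (𝓞 K)) ≤ ⌊x⌋₊}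
  rw [Nat.card_eq_fintype_card, ← Finset.card_univ, Finset.card_eq_sum_card_fiberwise
    (f := fun I : {I : (Ideal (𝓞 K))⁰ // absNorm (I : Ideal (𝓞 K)) ≤ ⌊x⌋₊} =>
      absNorm ((I : (Ideal (𝓞 K))⁰) : Ideal (𝓞 K))) (t := Finset.range (⌊x⌋₊ + 1))
    (fun I _ => Finset.mem_coe.2 (Finset.mem_range.2 (Nat.lt_succ_of_le I.2)))]
  refine Finset.sum_congr rfl fun n hn => ?_
  rw [idealCard, ← Fintype.card_subtype, ← Nat.card_eq_fintype_card]
  refine Nat.card_congr ?_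
  rw [Finset.mem_range, Nat.lt_succ_iff] at hn
  exact (Equiv.subtypeSubtypeEquivSubtype (p :=
    fun I : (Ideal (𝓞 K))⁰ => absNorm (I : Ideal (𝓞 K)) ≤ ⌊x⌋₊)
    (q := fun I : (Ideal (𝓞 K))⁰ => absNorm (I : Ideal (𝓞 K)) = n) (fun h => h.trans_le hn)).symm

/-- Counting ideals by norm, with a power saving in the error term. -/
theorem exists_sum_idealCard_sub_le : ∃ κ C δ : ℝ, 0 < κ ∧ 0 < δ ∧ δ < 1 ∧ ∀ x : ℝ, 1 ≤ x →
    |∑ n ∈ Finset.range (⌊x⌋₊ + 1), (idealCard K n : ℝ) - κ * x| ≤ C * x ^ (1 - δ) := by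
  obtain ⟨c, C, h⟩ := exists_sum_idealCard_tent K
  have hC : 0 ≤ C := by
    have := (abs_nonneg _).trans (h 1 le_rfl)
    simpa using this
  have hd : (1 : ℝ) ≤ Module.finrank ℚ K := by exact_mod_cast (Module.finrank_pos (R := ℚ) (M := K))
  have hd' : (0 : ℝ) < (Module.finrank ℚ K : ℝ)⁻¹ := by positivity
  obtain ⟨κ, C1, hC1, h1⟩ := exists_rieszSum_of_tent (a := fun n => (idealCard K n : ℝ))
    (by simp [idealCard_zero]) (δ := (Module.finrank ℚ K : ℝ)⁻¹ / 2) (c := c) (C :=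
      C) (by positivity)
    (by have := inv_le_one_of_one_le₀ hd; linarith) (by
      intro x hx
      refine (h x hx).trans ?_
      gcongr
      linarith)
  have hδ1 : (Module.finrank ℚ K : ℝ)⁻¹ / 2 < 1 := by have := inv_le_one_of_one_le₀ hd; linarith
  obtain ⟨C2, h2⟩ := exists_sum_of_rieszSum (fun n => Nat.cast_nonneg (idealCard K n))
    (by positivity) hδ1 hC1 h1
  refine ⟨2 * κ, C2, (Module.finrank ℚ K : ℝ)⁻¹ / 2 / 2, ?_, by positivity, by linarith, h2⟩
  set δ := (Module.finrank ℚ K : ℝ)⁻¹ / 2 / 2 with hδ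
  have hlim := tendsto_norm_le_div_atTop₀ K
  have hlim2 : Tendsto (fun s : ℝ ↦
      (Nat.card {I : (Ideal (𝓞 K))⁰ // absNorm (I : Ideal (𝓞 K)) ≤ s} : ℝ) / s) atTop
      (𝓝 (2 * κ)) := by
    rw [tendsto_iff_norm_sub_tendsto_zero]
    have h0 : Tendsto (fun s : ℝ => C2 * s ^ (-δ)) atTop (𝓝 0) := by
      have := (tendsto_rpow_neg_atTop (y := δ) (by positivity)).const_mul C2
      simpa using this
    refine squeeze_zero' (Eventually.of_forall fun _ => norm_nonneg _) ?_ h0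
    filter_upwards [eventually_ge_atTop 1] with s hs
    have hs0 : 0 < s := by linarith
    have h3 := h2 s hs
    rw [sum_idealCard K s hs0.le] at h3
    rw [Real.norm_eq_abs, div_sub' hs0.ne', abs_div, abs_of_pos hs0, div_le_iff₀ hs0, mul_comm s]
    refine h3.trans (le_of_eq ?_)
    rw [mul_assoc, sub_eq_neg_add, Real.rpow_add hs0, Real.rpow_one]
  rw [tendsto_nhds_unique hlim2 hlim]
  have := Units.regulator_pos K
  have := Units.torsionOrder_pos K
  have := discr_ne_zero K
  have := classNumber_pos K
  positivity

end IdealCount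

section RegZeta
open Complex Filter Asymptotics MeasureTheory Set
open scoped Topology

/-- A nonnegative sequence whose summatory function is linear up to a power saving. -/
structure PowerSaving (a : ℕ → ℝ) (κ C δ : ℝ) : Prop where
  nonneg : ∀ n, 0 ≤ a n
  map_zero : a 0 = 0
  map_one : a 1 = 1
  residue_pos : 0 < κ
  exponent_pos : 0 < δ
  exponent_lt : δ < 1
  bound : ∀ x : ℝ, 1 ≤ x → |∑ n ∈ Finset.range (⌊x⌋₊ + 1), a n - κ * x| ≤ C * x ^ (1 - δ)

/-- The error term of the summatory function, cut off below `1`. -/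
noncomputable def sumError (a : ℕ → ℝ) (κ : ℝ) (t : ℝ) : ℝ :=
  (Ioi (1 : ℝ)).indicator (fun t => ∑ n ∈ Finset.range (⌊t⌋₊ + 1), a n - κ * t) t

/-- The continuation of `(s - 1) * L(a, s)`. -/
noncomputable def regZeta (a : ℕ → ℝ) (κ : ℝ) (s : ℂ) : ℂ :=
  κ * s + (s - 1) * s * mellin (fun t => (sumError a κ t : ℂ)) (-s)

lemma sum_Icc_one_eq {M : Type*} [AddCommMonoid M] (a : ℕ → M) (h : a 0 = 0) (n : ℕ) :
    ∑ k ∈ Finset.Icc 1 n, a k = ∑ k ∈ Finset.range (n + 1), a k := by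
  rw [Finset.range_eq_Ico, Finset.sum_eq_sum_Ico_succ_bot (Nat.succ_pos n), h, zero_add]
  rfl

namespace PowerSaving

variable {a : ℕ → ℝ} {κ C δ : ℝ}

lemma const_nonneg (h : PowerSaving a κ C δ) : 0 ≤ C := by
  have := (abs_nonneg _).trans (h.bound 1 le_rfl)
  simpa using this

lemma abs_sumError_le (h : PowerSaving a κ C δ) {t : ℝ} (ht : 0 < t) :
    |sumError a κ t| ≤ C * t ^ (1 - δ) := by
  unfold sumError
  by_cases h1 : 1 < t
  · rw [indicator_of_mem (mem_Ioi.2 h1)]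
    exact h.bound t h1.le
  · rw [indicator_of_notMem (by simpa using h1), abs_zero]
    have := h.const_nonneg
    positivity

lemma monotone_sum (h : PowerSaving a κ C δ) :
    Monotone fun t : ℝ => ∑ n ∈ Finset.range (⌊t⌋₊ + 1), a n := fun _ _ hxy =>
  Finset.sum_le_sum_of_subset_of_nonneg
    (Finset.range_mono (Nat.succ_le_succ (Nat.floor_mono hxy))) fun n _ _ => h.nonneg n

lemma locallyIntegrable_sumError (h : PowerSaving a κ C δ) : LocallyIntegrable (sumError a κ) := by
  have h1 : LocallyIntegrable (fun t : ℝ => ∑ n ∈ Finset.range (⌊t⌋₊ + 1), a n - κ * t) :=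
    h.monotone_sum.locallyIntegrable.sub (by fun_prop : Continuous fun
      t : ℝ => κ * t).locallyIntegrable
  exact h1.indicator measurableSet_Ioi

lemma locallyIntegrable_sumError_ofReal (h : PowerSaving a κ C δ) :
    LocallyIntegrable (fun t => (sumError a κ t : ℂ)) := by
  intro x
  obtain ⟨s, hs, hi⟩ := h.locallyIntegrable_sumError x
  exact ⟨s, hs, Integrable.ofReal hi⟩

lemma differentiableAt_mellin (h : PowerSaving a κ C δ) {s : ℂ} (hs : 1 - δ < s.re) :
    DifferentiableAt ℂ (fun s => mellin (fun t => (sumError a κ t : ℂ)) (-s)) s := by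
  have h1 : DifferentiableAt ℂ (mellin (fun t => (sumError a κ t : ℂ))) (-s) := by
    refine mellin_differentiableAt_of_isBigO_rpow (a := -(1 - δ)) (b := (-s).re - 1) ?_ ?_
      (by rw [neg_re]; linarith) ?_ (by linarith)
    · exact h.locallyIntegrable_sumError_ofReal.locallyIntegrableOn _
    · refine IsBigO.of_bound C ?_
      filter_upwards [eventually_gt_atTop 0] with t ht
      rw [neg_neg, norm_real, Real.norm_eq_abs, Real.norm_of_nonneg (by positivity)]
      exact h.abs_sumError_le ht
    · refine IsBigO.of_bound 1 ?_
      filter_upwards [Ioo_mem_nhdsGT (show (0 : ℝ) < 1 by norm_num)] with t ht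
      have : sumError a κ t = 0 := indicator_of_notMem (by simpa using ht.2.le) _
      rw [this]
      simp
  exact DifferentiableAt.comp (g := mellin fun t => (sumError a κ t : ℂ)) (f := fun s => -s) s h1
    (by fun_prop)

lemma differentiableAt_regZeta (h : PowerSaving a κ C δ) {s : ℂ} (hs : 1 - δ < s.re) :
    DifferentiableAt ℂ (regZeta a κ) s := by
  have := h.differentiableAt_mellin hs
  unfold regZeta
  fun_prop

lemma mellin_eq (s : ℂ) : mellin (fun t => (sumError a κ t : ℂ)) (-s) =
    ∫ t in Ioi (1 : ℝ), (t : ℂ) ^ (-s - 1) * (sumError a κ t : ℂ) := by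
  rw [mellin]
  simp only [smul_eq_mul]
  refine (setIntegral_eq_of_subset_of_forall_sdiff_eq_zero measurableSet_Ioi
    (Ioi_subset_Ioi zero_le_one) ?_)
  intro t ht
  rw [sumError, indicator_of_notMem ht.2, ofReal_zero, mul_zero]

lemma norm_mellin_le (h : PowerSaving a κ C δ) {s : ℂ} (hs : 1 - δ < s.re) :
    ‖mellin (fun t => (sumError a κ t : ℂ)) (-s)‖ ≤ C / (s.re - (1 - δ)) := by
  rw [mellin_eq]
  have h1 : IntegrableOn (fun t : ℝ => C * t ^ (-s.re - δ)) (Ioi 1) :=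
    (integrableOn_Ioi_rpow_of_lt (by linarith) one_pos).const_mul _
  refine (norm_integral_le_of_norm_le h1 ?_).trans (le_of_eq ?_)
  · refine (ae_restrict_iff' measurableSet_Ioi).2 (Eventually.of_forall fun t ht => ?_)
    have ht0 : 0 < t := one_pos.trans ht
    rw [norm_mul, norm_cpow_eq_rpow_re_of_pos ht0, norm_real, Real.norm_eq_abs]
    calc t ^ (-s - 1).re * |sumError a κ t| ≤ t ^ (-s - 1).re * (C * t ^ (1 - δ)) := by
          gcongr; exact h.abs_sumError_le ht0
      _ = C * (t ^ (-s.re - 1) * t ^ (1 - δ)) := by simp; ring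
      _ = _ := by rw [← Real.rpow_add ht0]; ring_nf
  · rw [integral_const_mul, integral_Ioi_rpow_of_lt (by linarith) one_pos, Real.one_rpow]
    rw [neg_div, ← div_neg, mul_one_div]
    congr 1; ring

lemma isBigO_sum (h : PowerSaving a κ C δ) :
    (fun n ↦ ∑ k ∈ Finset.Icc 1 n, a k) =O[atTop] fun n ↦ (n : ℝ) ^ (1 : ℝ) := by
  refine IsBigO.of_bound (C + κ) ?_
  filter_upwards [eventually_ge_atTop 1] with n hn
  have hn1 : (1 : ℝ) ≤ n := by exact_mod_cast hn
  have h1 := h.bound n hn1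
  rw [Nat.floor_natCast] at h1
  rw [sum_Icc_one_eq a h.map_zero, Real.rpow_one,
    Real.norm_of_nonneg (Finset.sum_nonneg fun i _ => h.nonneg i),
    Real.norm_of_nonneg (by positivity)]
  have h2 : (n : ℝ) ^ (1 - δ) ≤ n := by
    conv_rhs => rw [← Real.rpow_one (n : ℝ)]
    exact Real.rpow_le_rpow_of_exponent_le hn1 (by linarith [h.exponent_pos])
  have := mul_le_mul_of_nonneg_left h2 h.const_nonneg
  linarith [(abs_le.1 h1).2]

lemma lseriesSummable (h : PowerSaving a κ C δ) {s : ℂ} (hs : 1 < s.re) :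
    LSeriesSummable (fun n => (a n : ℂ)) s :=
  LSeriesSummable_of_sum_norm_bigO_and_nonneg h.isBigO_sum h.nonneg zero_le_one hs

lemma regZeta_eq (h : PowerSaving a κ C δ) {s : ℂ} (hs : 1 < s.re) :
    regZeta a κ s = (s - 1) * LSeries (fun n => (a n : ℂ)) s := by
  have hs1 : s - 1 ≠ 0 := fun h => by
    rw [sub_eq_zero] at h
    rw [h] at hs; simp at hs
  have hs0 : s ≠ 0 := ne_zero_of_re_pos (by linarith)
  rw [LSeries_eq_mul_integral_of_nonneg a zero_le_one hs h.isBigO_sum h.nonneg, regZeta, mellin_eq]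
  have hI1 : IntegrableOn (fun t : ℝ => (t : ℂ) ^ (-s - 1) * (sumError a κ t : ℂ)) (Ioi 1) := by
    have h1 : IntegrableOn (fun t : ℝ => C * t ^ (-s.re - δ)) (Ioi 1) :=
      (integrableOn_Ioi_rpow_of_lt (by linarith [h.exponent_pos]) one_pos).const_mul _
    refine h1.mono' ?_ ?_
    · refine AEStronglyMeasurable.mul ?_
        h.locallyIntegrable_sumError_ofReal.aestronglyMeasurable.restrict
      refine ContinuousOn.aestronglyMeasurable (fun t ht => ?_) measurableSet_Ioi
      exact (continuousAt_ofReal_cpow_const _ _ (Or.inr (one_pos.trans ht).ne')).continuousWithinAt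
    · refine (ae_restrict_iff' measurableSet_Ioi).2 (Eventually.of_forall fun t ht => ?_)
      have ht0 : 0 < t := one_pos.trans ht
      rw [norm_mul, norm_cpow_eq_rpow_re_of_pos ht0, norm_real, Real.norm_eq_abs]
      calc t ^ (-s - 1).re * |sumError a κ t| ≤ t ^ (-s - 1).re * (C * t ^ (1 - δ)) := by
            gcongr; exact h.abs_sumError_le ht0
        _ = C * (t ^ (-s.re - 1) * t ^ (1 - δ)) := by simp; ring
        _ = _ := by rw [← Real.rpow_add ht0]; ring_nf
  have hI2 : IntegrableOn (fun t : ℝ => (κ : ℂ) * (t : ℂ) ^ (-s)) (Ioi 1) :=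
    (integrableOn_Ioi_cpow_of_lt (by simpa using hs) one_pos).const_mul _
  have h3 : ∫ t in Ioi (1 : ℝ), (∑ k ∈ Finset.Icc 1 ⌊t⌋₊, (a k : ℂ)) * (t : ℂ) ^ (-(s + 1)) =
      ∫ t in Ioi (1 : ℝ), ((t : ℂ) ^ (-s - 1) * (sumError a κ t : ℂ) + κ * (t : ℂ) ^ (-s)) := by
    refine setIntegral_congr_fun measurableSet_Ioi fun t ht => ?_
    have ht0 : (t : ℂ) ≠ 0 := by exact_mod_cast (one_pos.trans ht).ne'
    rw [sumError, indicator_of_mem ht, sum_Icc_one_eq _ (by simp [h.map_zero]),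
      show -(s + 1) = -s - 1 by ring, cpow_sub _ _ ht0, cpow_one]
    push_cast
    field_simp
    ring
  rw [h3, integral_add hI1 hI2, integral_const_mul,
    integral_Ioi_cpow_of_lt (by simpa using hs) one_pos]
  simp only [ofReal_one, one_cpow]
  have : -s + 1 = -(s - 1) := by ring
  rw [this]
  field_simp
  ring

lemma regZeta_one : regZeta a κ 1 = κ := by
  simp [regZeta]

/-- Crude polynomial bound. -/
lemma exists_norm_regZeta_le_sq (h : PowerSaving a κ C δ) : ∃ B, 0 ≤ B ∧ ∀ s : ℂ, 1 - δ / 2 ≤ s.re →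
    s.re ≤ 4 → ‖regZeta a κ s‖ ≤ B * (1 + |s.im|) ^ 2 := by
  have hC := h.const_nonneg
  have hδ := h.exponent_pos
  have hδ1 := h.exponent_lt
  have hκ := h.residue_pos
  refine ⟨4 * κ + 12 * (C / (δ / 2)), by positivity, fun s h1 h2 => ?_⟩
  have hm := h.norm_mellin_le (s := s) (by linarith)
  have hm2 : C / (s.re - (1 - δ)) ≤ C / (δ / 2) := by gcongr; linarith
  have e1 : ‖s‖ ≤ 4 * (1 + |s.im|) := by
    refine (norm_le_abs_re_add_abs_im s).trans ?_
    rw [abs_of_nonneg (by linarith : 0 ≤ s.re)]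
    linarith [abs_nonneg s.im]
  have e2 : ‖s - 1‖ ≤ 3 * (1 + |s.im|) := by
    refine (norm_le_abs_re_add_abs_im _).trans ?_
    simp only [sub_re, one_re, sub_im, one_im, sub_zero]
    have : |s.re - 1| ≤ 3 := abs_le.2 ⟨by linarith, by linarith⟩
    linarith [abs_nonneg s.im]
  set T := 1 + |s.im|
  have hT : 1 ≤ T := by simp [T]
  set m := mellin (fun t => (sumError a κ t : ℂ)) (-s)
  set D := C / (δ / 2)
  have hD : 0 ≤ D := by positivity
  calc ‖regZeta a κ s‖ ≤ κ * ‖s‖ + ‖s - 1‖ * ‖s‖ * ‖m‖ := by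
        refine (norm_add_le _ _).trans (le_of_eq ?_)
        rw [norm_mul, norm_mul, norm_mul, norm_real, Real.norm_of_nonneg hκ.le]
    _ ≤ κ * (4 * T) + (3 * T) * (4 * T) * D := by
        gcongr
        exact hm.trans hm2
    _ ≤ κ * (4 * T ^ 2) + (3 * T) * (4 * T) * D := by
        gcongr; nlinarith
    _ = _ := by ring

lemma norm_lseries_le (h : PowerSaving a κ C δ) {σ : ℝ} (hσ : 1 < σ) {s : ℂ} (hs : σ ≤ s.re) :
    ‖LSeries (fun n => (a n : ℂ)) s‖ ≤ ∑' n, ‖LSeries.term (fun n => (a n : ℂ)) σ n‖ := by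
  have h1 : Summable fun n => ‖LSeries.term (fun n => (a n : ℂ)) σ n‖ :=
    (h.lseriesSummable (s := (σ : ℂ)) (by simpa using hσ)).norm
  refine tsum_of_norm_bounded h1.hasSum fun n => ?_
  exact LSeries.norm_term_le_of_re_le_re _ (by simpa using hs) n

/-- Linear bound to the right of the critical line. -/
lemma exists_norm_regZeta_le (h : PowerSaving a κ C δ) {η : ℝ} (hη : 0 < η) : ∃ B, 0 ≤ B ∧ ∀ s : ℂ,
    1 + η ≤ s.re → s.re ≤ 4 → ‖regZeta a κ s‖ ≤ B * (1 + |s.im|) := by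
  refine ⟨3 * ∑' n, ‖LSeries.term (fun n => (a n : ℂ)) ((1 + η : ℝ) : ℂ) n‖,
    mul_nonneg (by norm_num) (tsum_nonneg fun _ => norm_nonneg _), fun s h1 h2 => ?_⟩
  rw [h.regZeta_eq (by linarith), norm_mul]
  have e2 : ‖s - 1‖ ≤ 3 * (1 + |s.im|) := by
    refine (norm_le_abs_re_add_abs_im _).trans ?_
    simp only [sub_re, one_re, sub_im, one_im, sub_zero]
    have : |s.re - 1| ≤ 3 := abs_le.2 ⟨by linarith, by linarith⟩
    linarith [abs_nonneg s.im]
  have e3 := h.norm_lseries_le (σ := 1 + η) (by linarith) h1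
  calc _ ≤ 3 * (1 + |s.im|) * _ := mul_le_mul e2 e3 (norm_nonneg _) (by positivity)
    _ = _ := by ring

end PowerSaving
end RegZeta

section ThreeLines
open Complex Filter MeasureTheory Set
open scoped Topology

namespace PowerSaving

variable {a : ℕ → ℝ} {κ C δ : ℝ}

lemma one_add_abs_sq_le_two_mul_exp (v : ℝ) : (1 + |v|) ^ 2 ≤ 2 * Real.exp (v ^ 2) := by
  have h1 := Real.add_one_le_exp (v ^ 2)
  have h2 : |v| ^ 2 = v ^ 2 := sq_abs v
  nlinarith [sq_nonneg (|v| - 1)]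

/-- Convexity bound just to the left of the edge of absolute convergence. -/
lemma exists_norm_regZeta_le_rpow (h : PowerSaving a κ C δ) :
    ∃ B, 0 < B ∧ ∀ s : ℂ, 1 - δ / 200 ≤ s.re → s.re ≤ 4 →
      ‖regZeta a κ s‖ ≤ B * (1 + |s.im|) ^ (51 / 50 : ℝ) := by
  have hδ := h.exponent_pos
  have hδ1 := h.exponent_lt
  obtain ⟨B₁, hB₁, h1⟩ := h.exists_norm_regZeta_le_sq
  obtain ⟨B₂, hB₂, h2⟩ := h.exists_norm_regZeta_le (η := δ / 200) (by linarith)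
  set M : ℝ := 2 * Real.exp 4 * (B₁ + B₂ + 1) with hM
  have hM0 : 0 < M := by positivity
  have hM2 : B₂ ≤ M := by
    have := Real.add_one_le_exp (4 : ℝ)
    nlinarith
  refine ⟨M, hM0, fun s₀ hl hu => ?_⟩
  set T := 1 + |s₀.im| with hT
  have hT1 : 1 ≤ T := by simp [T]
  by_cases hs : 1 + δ / 200 ≤ s₀.re
  · calc ‖regZeta a κ s₀‖ ≤ B₂ * T := h2 s₀ hs hu
      _ ≤ M * T ^ (51 / 50 : ℝ) := by
        gcongr
        conv_lhs => rw [← Real.rpow_one T]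
        exact Real.rpow_le_rpow_of_exponent_le hT1 (by norm_num)
  push Not at hs
  set l : ℝ := 1 - δ / 2 with hl_def
  set u : ℝ := 1 + δ / 200 with hu_def
  set f : ℂ → ℂ := fun s => regZeta a κ s * exp ((s - s₀.im * I) ^ 2) with hf
  have hexp : ∀ s : ℂ, l ≤ s.re → s.re ≤ u → (1 + |s.im - s₀.im|) ^ 2 * ‖exp ((s - s₀.im * I) ^ 2)‖
      ≤ 2 * Real.exp 4 := fun s hs1 hs2 => by
    have : ((s - s₀.im * I) ^ 2).re = s.re ^ 2 - (s.im - s₀.im) ^ 2 := by simp [pow_two]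
    rw [norm_exp, this, sub_eq_add_neg (s.re ^ 2), Real.exp_add, Real.exp_neg]
    have e1 := one_add_abs_sq_le_two_mul_exp (s.im - s₀.im)
    have e2 : Real.exp (s.re ^ 2) ≤ Real.exp 4 := Real.exp_le_exp.2 (by nlinarith)
    calc _ ≤ 2 * Real.exp ((s.im - s₀.im) ^ 2) *
          (Real.exp 4 * (Real.exp ((s.im - s₀.im) ^ 2))⁻¹) := by gcongr
      _ = _ := by field_simp
  have hTT : ∀ s : ℂ, 1 + |s.im| ≤ T * (1 + |s.im - s₀.im|) := fun s => by
    have : |s.im| ≤ |s₀.im| + |s.im - s₀.im| := by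
      calc |s.im| = |s₀.im + (s.im - s₀.im)| := by ring_nf
        _ ≤ _ := abs_add_le _ _
    have := mul_nonneg (abs_nonneg s₀.im) (abs_nonneg (s.im - s₀.im))
    simp only [T]; nlinarith
  have hA : ∀ s : ℂ, l ≤ s.re → s.re ≤ u → ‖f s‖ ≤ M * T ^ 2 := fun s hs1 hs2 => by
    rw [hf, norm_mul]
    calc _ ≤ B₁ * (T * (1 + |s.im - s₀.im|)) ^ 2 * ‖exp ((s - s₀.im * I) ^ 2)‖ := by
          gcongr
          exact (h1 s hs1 (by linarith)).trans (by gcongr; exact hTT s)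
      _ = B₁ * T ^ 2 * ((1 + |s.im - s₀.im|) ^ 2 * ‖exp ((s - s₀.im * I) ^ 2)‖) := by ring
      _ ≤ B₁ * T ^ 2 * (2 * Real.exp 4) :=
        mul_le_mul_of_nonneg_left (hexp s hs1 hs2) (by positivity)
      _ = 2 * Real.exp 4 * B₁ * T ^ 2 := by ring
      _ ≤ _ := by gcongr; rw [hM]; gcongr; linarith
  have hB : ∀ s : ℂ, s.re = u → ‖f s‖ ≤ M * T := fun s hs => by
    rw [hf, norm_mul]
    have e1 : 1 + |s.im - s₀.im| ≤ (1 + |s.im - s₀.im|) ^ 2 := by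
      nlinarith [abs_nonneg (s.im - s₀.im)]
    calc _ ≤ B₂ * (T * (1 + |s.im - s₀.im|) ^ 2) * ‖exp ((s - s₀.im * I) ^ 2)‖ := by
          gcongr
          exact (h2 s hs.ge (by linarith)).trans (by gcongr; exact (hTT s).trans (by gcongr))
      _ = B₂ * T * ((1 + |s.im - s₀.im|) ^ 2 * ‖exp ((s - s₀.im * I) ^ 2)‖) := by ring
      _ ≤ B₂ * T * (2 * Real.exp 4) := mul_le_mul_of_nonneg_left (hexp s (by linarith) hs.le) (by
        positivity)
      _ = 2 * Real.exp 4 * B₂ * T := by ring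
      _ ≤ _ := by gcongr; rw [hM]; gcongr; linarith
  have hd : DiffContOnCl ℂ f (HadamardThreeLines.verticalStrip l u) := by
    refine DifferentiableOn.diffContOnCl fun s hs => ?_
    have hs' : s ∈ re ⁻¹' Icc l u := closure_minimal (s := HadamardThreeLines.verticalStrip l u)
      (preimage_mono Ioo_subset_Icc_self) (isClosed_Icc.preimage continuous_re) hs
    have := h.differentiableAt_regZeta (s := s) (by linarith [hs'.1])
    exact DifferentiableAt.differentiableWithinAt (by rw [hf]; fun_prop)
  have key := HadamardThreeLines.norm_le_interp_of_mem_verticalClosedStrip' (f := f) (l :=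
      l) (u := u)
    (a := M * T ^ 2) (b := M * T) (z := s₀) (by linarith) ⟨by linarith, hs.le⟩ hd
    ⟨M * T ^ 2, by rintro _ ⟨s, hs, rfl⟩; exact hA s hs.1 hs.2⟩
    (fun s hs => hA s (mem_preimage.1 hs).ge (by rw [mem_preimage.1 hs]; linarith))
    (fun s hs => hB s hs)
  have hlow : ‖regZeta a κ s₀‖ ≤ ‖f s₀‖ := by
    rw [hf, norm_mul, norm_exp]
    have : ((s₀ - s₀.im * I) ^ 2).re = s₀.re ^ 2 := by simp [pow_two]
    rw [this]
    exact le_mul_of_one_le_right (norm_nonneg _) (Real.one_le_exp (sq_nonneg _))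
  refine (hlow.trans key).trans ?_
  set θ := (s₀.re - l) / (u - l)
  have hθ : 1 - θ ≤ 1 / 50 := by
    have hul : 0 < u - l := by linarith
    have : 1 - θ = (u - s₀.re) / (u - l) := by simp only [θ]; field_simp; ring
    rw [this, div_le_iff₀ hul]
    linarith
  have hT0 : 0 < T := by linarith
  have e1 : M ^ (1 - θ) * M ^ θ = M := by rw [← Real.rpow_add hM0]; simp
  have e2 : (T ^ 2) ^ (1 - θ) * T ^ θ = T ^ (1 + (1 - θ)) := by
    rw [← Real.rpow_natCast, ← Real.rpow_mul hT0.le, ← Real.rpow_add hT0]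
    congr 1; push_cast; ring
  rw [Real.mul_rpow hM0.le (by positivity), Real.mul_rpow hM0.le hT0.le]
  calc _ = (M ^ (1 - θ) * M ^ θ) * ((T ^ 2) ^ (1 - θ) * T ^ θ) := by ring
    _ ≤ _ := by
      rw [e1, e2]
      gcongr
      linarith

lemma exists_norm_deriv_regZeta_le (h : PowerSaving a κ C δ) :
    ∃ B, 0 < B ∧ ∀ s : ℂ, 1 - δ / 400 ≤ s.re → s.re ≤ 3 →
      ‖regZeta a κ s‖ ≤ B * (1 + |s.im|) ^ (51 / 50 : ℝ) ∧
      ‖deriv (regZeta a κ) s‖ ≤ B * (1 + |s.im|) ^ (51 / 50 : ℝ) := by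
  have hδ := h.exponent_pos
  have hδ1 := h.exponent_lt
  obtain ⟨B, hB, hb⟩ := h.exists_norm_regZeta_le_rpow
  refine ⟨B * 4 / (δ / 400), by positivity, fun s h1 h2 => ?_⟩
  set r := δ / 400
  have hr : 0 < r := by positivity
  have hr1 : r ≤ 1 := by simp only [r]; linarith
  set T := 1 + |s.im| with hT
  have hT1 : 1 ≤ T := by simp [T]
  have hT2 : ∀ z ∈ Metric.closedBall s r, ‖regZeta a κ z‖ ≤ B * 4 * T ^ (51 / 50 : ℝ) :=
    fun z hz => by
    rw [mem_closedBall_iff_norm] at hz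
    have e1 := (abs_re_le_norm (z - s)).trans hz
    have e2 := (abs_im_le_norm (z - s)).trans hz
    rw [sub_re, abs_le] at e1
    rw [sub_im] at e2
    have e3 : |z.im| ≤ |s.im| + |z.im - s.im| := by
      calc |z.im| = |s.im + (z.im - s.im)| := by ring_nf
        _ ≤ _ := abs_add_le _ _
    calc _ ≤ B * (1 + |z.im|) ^ (51 / 50 : ℝ) :=
          hb z (by simp only [r] at *; linarith) (by linarith)
      _ ≤ B * (2 * T) ^ (51 / 50 : ℝ) := by gcongr; linarith
      _ = B * (2 ^ (51 / 50 : ℝ) * T ^ (51 / 50 : ℝ)) := by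
        rw [Real.mul_rpow (by norm_num) (by linarith)]
      _ ≤ B * (2 ^ (2 : ℝ) * T ^ (51 / 50 : ℝ)) := by
        gcongr
        · norm_num
        · norm_num
      _ = _ := by norm_num; ring
  constructor
  · refine (hT2 s (Metric.mem_closedBall_self hr.le)).trans ?_
    gcongr
    exact le_div_self (by positivity) hr hr1
  · have hd : DiffContOnCl ℂ (regZeta a κ) (Metric.ball s r) := by
      refine DifferentiableOn.diffContOnCl fun z hz => ?_
      have hz := Metric.closure_ball_subset_closedBall hz
      rw [mem_closedBall_iff_norm] at hz
      have e1 := (abs_re_le_norm (z - s)).trans hz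
      rw [sub_re, abs_le] at e1
      exact (h.differentiableAt_regZeta (by simp only [r] at *; linarith)).differentiableWithinAt
    refine (norm_deriv_le_of_forall_mem_sphere_norm_le hr hd fun z hz =>
      hT2 z (Metric.sphere_subset_closedBall hz)).trans (le_of_eq ?_)
    ring

end PowerSaving
end ThreeLines

section LogDeriv
open Complex Filter Set
open scoped Topology

/-- `Λ` is the nonnegative von Mangoldt function of the sequence `a`. -/
structure IsVonMangoldt (a Λ : ℕ → ℝ) : Prop where
  nonneg : ∀ n, 0 ≤ Λ n
  map_zero : Λ 0 = 0
  convolution : ∀ n : ℕ, ∑ p ∈ n.divisorsAntidiagonal, a p.1 * Λ p.2 = a n * Real.log n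

namespace PowerSaving

variable {a Λ : ℕ → ℝ} {κ C δ : ℝ}

lemma abscissa_le (h : PowerSaving a κ C δ) :
    LSeries.abscissaOfAbsConv (fun n => (a n : ℂ)) ≤ (1 : ℝ) :=
  LSeries.abscissaOfAbsConv_le_of_forall_lt_LSeriesSummable fun _ hy =>
    h.lseriesSummable (by simpa using hy)

lemma abscissa_lt (h : PowerSaving a κ C δ) {s : ℂ} (hs : 1 < s.re) :
    LSeries.abscissaOfAbsConv (fun n => (a n : ℂ)) < s.re :=
  h.abscissa_le.trans_lt (by exact_mod_cast hs)

lemma vonMangoldt_le (h : PowerSaving a κ C δ) (hΛ : IsVonMangoldt a Λ) {n : ℕ} (hn : n ≠ 0) :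
    Λ n ≤ a n * Real.log n := by
  rw [← hΛ.convolution n]
  have := Finset.single_le_sum (f := fun p : ℕ × ℕ => a p.1 * Λ p.2)
    (fun p _ => mul_nonneg (h.nonneg _) (hΛ.nonneg _))
    (show ((1, n) : ℕ × ℕ) ∈ n.divisorsAntidiagonal by simp [hn])
  simpa [h.map_one] using this

lemma lseriesSummable_vonMangoldt (h : PowerSaving a κ C δ) (hΛ : IsVonMangoldt a Λ) {s : ℂ}
    (hs : 1 < s.re) : LSeriesSummable (fun n => (Λ n : ℂ)) s := by
  have h1 := LSeriesSummable_logMul_of_lt_re (h.abscissa_lt hs)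
  refine Summable.of_norm_bounded h1.norm fun n => ?_
  rcases eq_or_ne n 0 with rfl | hn
  · simp
  refine LSeries.norm_term_le _ ?_
  have h2 := h.vonMangoldt_le hΛ hn
  rw [LSeries.logMul, ← natCast_log, ← ofReal_mul, norm_real, norm_real,
    Real.norm_of_nonneg (hΛ.nonneg n), mul_comm]
  exact h2.trans (le_abs_self _)

lemma lseries_mul_vonMangoldt (h : PowerSaving a κ C δ) (hΛ : IsVonMangoldt a Λ) {s : ℂ}
    (hs : 1 < s.re) : LSeries (fun n => (a n : ℂ)) s * LSeries (fun n => (Λ n : ℂ)) s =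
      LSeries (LSeries.logMul fun n => (a n : ℂ)) s := by
  rw [← LSeries_convolution' (h.lseriesSummable hs) (h.lseriesSummable_vonMangoldt hΛ hs)]
  congr 1
  ext n
  rw [LSeries.convolution_def, LSeries.logMul, ← natCast_log, ← ofReal_mul, mul_comm,
    ← hΛ.convolution]
  push_cast
  rfl

lemma hasDerivAt_lseries (h : PowerSaving a κ C δ) (hΛ : IsVonMangoldt a Λ) {s : ℂ}
    (hs : 1 < s.re) : HasDerivAt (LSeries fun n => (a n : ℂ))
      (-(LSeries (fun n => (Λ n : ℂ)) s * LSeries (fun n => (a n : ℂ)) s)) s := by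
  have := LSeries_hasDerivAt (h.abscissa_lt hs)
  rwa [← h.lseries_mul_vonMangoldt hΛ hs, mul_comm] at this

lemma tendsto_lseries (h : PowerSaving a κ C δ) (t : ℝ) :
    Tendsto (fun σ : ℝ => LSeries (fun n => (a n : ℂ)) (σ + t * I)) atTop (𝓝 1) := by
  have key : ∀ σ : ℝ, LSeries.term (fun n : ℕ => (a n : ℂ) * (n : ℂ) ^ (-(t * I))) σ =
      LSeries.term (fun n => (a n : ℂ)) (σ + t * I) := fun σ => by
    ext n
    rcases eq_or_ne n 0 with rfl | hn
    · simp
    have hn' : (n : ℂ) ≠ 0 := by exact_mod_cast hn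
    rw [LSeries.term_of_ne_zero hn, LSeries.term_of_ne_zero hn, cpow_add _ _ hn', cpow_neg]
    field_simp
  have h1 : LSeries.abscissaOfAbsConv (fun n : ℕ => (a n : ℂ) * (n : ℂ) ^ (-(t * I))) ≤ (1 : ℝ) :=
    LSeries.abscissaOfAbsConv_le_of_forall_lt_LSeriesSummable fun y hy => by
      rw [LSeriesSummable, key]
      exact h.lseriesSummable (by simpa using hy)
  have h2 := LSeries.tendsto_atTop (h1.trans_lt (EReal.coe_lt_top 1))
  simp only [h.map_one, Nat.cast_one, one_cpow, ofReal_one, mul_one] at h2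
  refine h2.congr fun σ => ?_
  rw [LSeries, key, LSeries]

lemma re_three_four_one_nonneg (h : PowerSaving a κ C δ) (hΛ : IsVonMangoldt a Λ) {σ : ℝ}
    (hσ : 1 < σ) (t : ℝ) :
    0 ≤ (3 * LSeries (fun n => (Λ n : ℂ)) σ + 4 * LSeries (fun n => (Λ n : ℂ)) (σ + t * I) +
      LSeries (fun n => (Λ n : ℂ)) (σ + (2 * t : ℝ) * I)).re := by
  have hs : ∀ v : ℝ, Summable (LSeries.term (fun n => (Λ n : ℂ)) (σ + v * I)) := fun v =>
    h.lseriesSummable_vonMangoldt hΛ (by simpa using hσ)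
  have h0 := hs 0
  simp only [ofReal_zero, zero_mul, add_zero] at h0
  have e : 3 * LSeries (fun n => (Λ n : ℂ)) σ + 4 * LSeries (fun n => (Λ n : ℂ)) (σ + t * I) +
      LSeries (fun n => (Λ n : ℂ)) (σ + (2 * t : ℝ) * I) =
      ∑' n, (3 * LSeries.term (fun n => (Λ n : ℂ)) σ n +
        4 * LSeries.term (fun n => (Λ n : ℂ)) (σ + t * I) n +
        LSeries.term (fun n => (Λ n : ℂ)) (σ + (2 * t : ℝ) * I) n) := by
    rw [Summable.tsum_add ((h0.mul_left 3).add ((hs t).mul_left 4)) (hs (2 * t)),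
      Summable.tsum_add (h0.mul_left 3) ((hs t).mul_left 4), tsum_mul_left, tsum_mul_left]
    rfl
  rw [e, re_tsum (((h0.mul_left 3).add ((hs t).mul_left 4)).add (hs (2 * t)))]
  refine tsum_nonneg fun n => ?_
  rcases eq_or_ne n 0 with rfl | hn
  · simp
  have hn0 : (0 : ℝ) < n := by exact_mod_cast Nat.pos_of_ne_zero hn
  have hn' : (n : ℂ) ≠ 0 := by exact_mod_cast hn
  have hterm : ∀ v : ℝ, LSeries.term (fun n => (Λ n : ℂ)) (σ + v * I) n =
      ((Λ n * (n : ℝ) ^ (-σ) : ℝ) : ℂ) * exp ((-(v * Real.log n) : ℝ) * I) := fun v => by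
    rw [LSeries.term_of_ne_zero hn, div_eq_mul_inv, ← cpow_neg, neg_add, cpow_add _ _ hn',
      ofReal_mul,
      ofReal_cpow hn0.le, cpow_def_of_ne_zero hn' (-(v * I)), ← natCast_log]
    push_cast
    rw [mul_assoc]
    congr 3
    ring
  have hterm0 := hterm 0
  simp only [ofReal_zero, zero_mul, add_zero, neg_zero, exp_zero, mul_one] at hterm0
  rw [hterm t, hterm (2 * t), hterm0]
  have hre : ∀ v : ℝ, (((Λ n * (n : ℝ) ^ (-σ) : ℝ) : ℂ) * exp ((v : ℝ) * I)).re =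
      Λ n * (n : ℝ) ^ (-σ) * Real.cos v := fun v => by
    rw [re_ofReal_mul, exp_ofReal_mul_I_re]
  have hre0 : (3 * ((Λ n * (n : ℝ) ^ (-σ) : ℝ) : ℂ)).re = 3 * (Λ n * (n : ℝ) ^ (-σ)) := by
    rw [← ofReal_ofNat, ← ofReal_mul, ofReal_re]
  have h4 : ∀ z : ℂ, (4 * z).re = 4 * z.re := fun z => by simp
  rw [add_re, add_re, h4, hre, hre, hre0,
    show -(2 * t * Real.log n) = 2 * -(t * Real.log n) by ring, Real.cos_two_mul]
  have := mul_nonneg (hΛ.nonneg n) (Real.rpow_nonneg hn0.le (-σ))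
  nlinarith [mul_nonneg this (sq_nonneg (1 + Real.cos (-(t * Real.log n))))]

/-- The inequality of Hadamard, de la Vallée Poussin and Mertens. -/
lemma one_le_three_four_one (h : PowerSaving a κ C δ) (hΛ : IsVonMangoldt a Λ) {σ : ℝ}
    (hσ : 1 < σ) (t : ℝ) :
    1 ≤ ‖LSeries (fun n => (a n : ℂ)) σ‖ ^ 3 * ‖LSeries (fun n => (a n : ℂ)) (σ + t * I)‖ ^ 4 *
      ‖LSeries (fun n => (a n : ℂ)) (σ + (2 * t : ℝ) * I)‖ := by
  set f := LSeries fun n => (a n : ℂ)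
  set F := LSeries fun n => (Λ n : ℂ)
  set P : ℝ → ℂ := fun σ => f σ ^ 3 * f (σ + t * I) ^ 4 * f (σ + (2 * t : ℝ) * I) with hP
  set W : ℝ → ℂ := fun σ => 3 * F σ + 4 * F (σ + t * I) + F (σ + (2 * t : ℝ) * I) with hW
  have hf : ∀ v x : ℝ, 1 < x → HasDerivAt (fun x : ℝ => f (x + v * I))
      (-(F (x + v * I) * f (x + v * I))) x := fun v x hx => by
    have h1 := h.hasDerivAt_lseries hΛ (s := x + v * I) (by simpa using hx)
    have h2 : HasDerivAt (fun x : ℝ => (x : ℂ) + v * I) 1 x :=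
      (HasDerivAt.ofReal_comp (hasDerivAt_id x)).add_const _
    simpa [Function.comp_def] using HasDerivAt.comp (h₂ := f) x h1 h2
  have hf0 : ∀ x : ℝ, 1 < x → HasDerivAt (fun x : ℝ => f x) (-(F x * f x)) x := fun x hx => by
    simpa using hf 0 x hx
  have hPd : ∀ x : ℝ, 1 < x → HasDerivAt P (-(W x * P x)) x := fun x hx => by
    refine ((((hf0 x hx).pow 3).mul ((hf t x hx).pow 4)).mul (hf (2 * t) x hx)).congr_deriv ?_
    simp only [hP, hW, Pi.mul_apply, Pi.pow_apply]
    push_cast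
    ring
  have hN : ∀ x : ℝ, 1 < x → HasDerivAt (fun x => ‖P x‖ ^ 2) (-(2 * ‖P x‖ ^ 2 * (W x).re)) x :=
    fun x hx => by
    refine (hPd x hx).norm_sq.congr_deriv ?_
    rw [Complex.inner, ← Complex.normSq_eq_norm_sq, normSq_apply]
    simp
    ring
  have hanti : AntitoneOn (fun x => ‖P x‖ ^ 2) (Ioi 1) := by
    refine antitoneOn_of_deriv_nonpos (convex_Ioi 1)
      (fun x hx => (hN x hx).continuousAt.continuousWithinAt) ?_ ?_
    · rw [interior_Ioi]
      exact fun x hx => (hN x hx).differentiableAt.differentiableWithinAt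
    · rw [interior_Ioi]
      intro x hx
      rw [(hN x hx).deriv, neg_nonpos]
      exact mul_nonneg (by positivity) (h.re_three_four_one_nonneg hΛ hx t)
  have hlim : Tendsto (fun x => ‖P x‖ ^ 2) atTop (𝓝 1) := by
    have h0 := h.tendsto_lseries 0
    simp only [ofReal_zero, zero_mul, add_zero] at h0
    have := ((((h0.pow 3).mul ((h.tendsto_lseries t).pow 4)).mul
      (h.tendsto_lseries (2 * t))).norm).pow 2
    simpa [hP, f] using this
  have : 1 ≤ ‖P σ‖ ^ 2 := by
    refine le_of_tendsto hlim ?_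
    filter_upwards [eventually_ge_atTop σ] with x hx
    exact hanti hσ (hσ.trans_le hx) hx
  have h1 : 1 ≤ ‖P σ‖ := by
    by_contra! hc
    nlinarith [norm_nonneg (P σ)]
  simpa [hP] using h1

end PowerSaving
end LogDeriv

section ZeroFree
open Complex Filter Set
open scoped Topology

namespace PowerSaving

variable {a Λ : ℕ → ℝ} {κ C δ : ℝ}

lemma le_regZeta_three_four_one (h : PowerSaving a κ C δ) (hΛ : IsVonMangoldt a Λ) {s : ℂ}
    (hs : 1 < s.re) : (s.re - 1) ^ 3 * ‖s - 1‖ ^ 4 * ‖(s.re - 1 : ℂ) + (2 * s.im : ℝ) * I‖ ≤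
      ‖regZeta a κ s.re‖ ^ 3 * ‖regZeta a κ s‖ ^ 4 * ‖regZeta a κ (s.re + (2 * s.im : ℝ) * I)‖ := by
  have h1 := h.one_le_three_four_one hΛ hs s.im
  rw [re_add_im] at h1
  rw [h.regZeta_eq hs, h.regZeta_eq (s := s.re) (by simpa using hs),
    h.regZeta_eq (s := s.re + (2 * s.im : ℝ) * I) (by simpa using hs)]
  simp only [norm_mul, mul_pow]
  have e1 : ‖(s.re : ℂ) - 1‖ = s.re - 1 := by
    rw [← ofReal_one, ← ofReal_sub, norm_real, Real.norm_of_nonneg (by linarith)]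
  rw [e1, add_sub_right_comm]
  refine (le_mul_of_one_le_right ?_ h1).trans (le_of_eq (by ring))
  have : 0 ≤ s.re - 1 := by linarith
  positivity

lemma exists_le_norm_regZeta_pow (h : PowerSaving a κ C δ) (hΛ : IsVonMangoldt a Λ) :
    ∃ c, 0 < c ∧ ∀ s : ℂ, 1 < s.re → s.re ≤ 3 →
      c * ((s.re - 1) ^ 3 * ‖s - 1‖ ^ 5) ≤
        ‖regZeta a κ s‖ ^ 4 * (1 + |s.im|) ^ (51 / 50 : ℝ) := by
  have hδ := h.exponent_pos
  obtain ⟨B, hB, hb⟩ := h.exists_norm_deriv_regZeta_le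
  refine ⟨1 / (4 * B ^ 4), by positivity, fun s h1 h2 => ?_⟩
  have key := h.le_regZeta_three_four_one hΛ h1
  have e1 : ‖regZeta a κ s.re‖ ≤ B := by
    simpa using (hb s.re (by simp; linarith) (by simpa using h2)).1
  have e2 : ‖regZeta a κ (s.re + (2 * s.im : ℝ) * I)‖ ≤ B * (4 * (1 + |s.im|) ^ (51 / 50 : ℝ)) := by
    refine (hb (s.re + (2 * s.im : ℝ) * I) (by simp; linarith) (by simpa using h2)).1.trans ?_
    have : (s.re + (2 * s.im : ℝ) * I : ℂ).im = 2 * s.im := by simp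
    rw [this, abs_mul, abs_two]
    gcongr
    calc (1 + 2 * |s.im|) ^ (51 / 50 : ℝ) ≤ (2 * (1 + |s.im|)) ^ (51 / 50 : ℝ) := by
          gcongr; linarith
      _ = 2 ^ (51 / 50 : ℝ) * (1 + |s.im|) ^ (51 / 50 : ℝ) := by
        rw [Real.mul_rpow (by norm_num) (by positivity)]
      _ ≤ 2 ^ (2 : ℝ) * (1 + |s.im|) ^ (51 / 50 : ℝ) := by
        gcongr
        · norm_num
        · norm_num
      _ = _ := by norm_num
  have e3 : ‖s - 1‖ ≤ ‖(s.re - 1 : ℂ) + (2 * s.im : ℝ) * I‖ := by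
    rw [← sq_le_sq₀ (norm_nonneg _) (norm_nonneg _), ← normSq_eq_norm_sq, ← normSq_eq_norm_sq,
      normSq_apply, normSq_apply]
    simp
    nlinarith [mul_self_nonneg s.im]
  have h3 : 0 ≤ s.re - 1 := by linarith
  have : (s.re - 1) ^ 3 * ‖s - 1‖ ^ 5 ≤
      4 * B ^ 4 * (‖regZeta a κ s‖ ^ 4 * (1 + |s.im|) ^ (51 / 50 : ℝ)) := by
    calc (s.re - 1) ^ 3 * ‖s - 1‖ ^ 5 = (s.re - 1) ^ 3 * ‖s - 1‖ ^ 4 * ‖s - 1‖ := by ring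
      _ ≤ (s.re - 1) ^ 3 * ‖s - 1‖ ^ 4 * ‖(s.re - 1 : ℂ) + (2 * s.im : ℝ) * I‖ := by gcongr
      _ ≤ _ := key
      _ ≤ B ^ 3 * ‖regZeta a κ s‖ ^ 4 * (B * (4 * (1 + |s.im|) ^ (51 / 50 : ℝ))) := by gcongr
      _ = _ := by ring
  rw [one_div, inv_mul_le_iff₀ (by positivity)]
  exact this

lemma exists_norm_regZeta_sub_le (h : PowerSaving a κ C δ) :
    ∃ ρ, 0 < ρ ∧ ρ ≤ 1 ∧ ∀ s : ℂ, ‖s - 1‖ ≤ ρ → κ / 2 ≤ ‖regZeta a κ s‖ := by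
  have hκ := h.residue_pos
  have h1 : ContinuousAt (regZeta a κ) 1 :=
    (h.differentiableAt_regZeta (by simpa using h.exponent_pos)).continuousAt
  obtain ⟨ε, hε, h2⟩ := Metric.continuousAt_iff.1 h1 (κ / 2) (by linarith)
  refine ⟨min (ε / 2) 1, by positivity, min_le_right _ _, fun s hs => ?_⟩
  have h3 := h2 (x := s) (by rw [dist_eq_norm]; linarith [min_le_left (ε / 2) 1])
  rw [dist_eq_norm, regZeta_one] at h3
  have h4 := norm_sub_norm_le (κ : ℂ) (regZeta a κ s)
  rw [norm_sub_rev, norm_real, Real.norm_of_nonneg hκ.le] at h4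
  linarith

/-- Lower bound away from the real axis, in a region slightly to the left of `re s = 1`. -/
lemma exists_le_norm_regZeta_of_le_im (h : PowerSaving a κ C δ) (hΛ : IsVonMangoldt a Λ) {t₀ : ℝ}
    (ht₀ : 0 < t₀) : ∃ β₀, 0 < β₀ ∧ ∀ β, 0 < β → β ≤ β₀ → ∃ c, 0 < c ∧ ∀ s : ℂ,
      1 - β * (1 + |s.im|) ^ (-(1 / 10) : ℝ) ≤ s.re → s.re ≤ 2 → t₀ ≤ |s.im| →
      c * (1 + |s.im|) ^ (23 / 25 : ℝ) ≤ ‖regZeta a κ s‖ := by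
  have hδ := h.exponent_pos
  have hδ1 := h.exponent_lt
  obtain ⟨B, hB, hb⟩ := h.exists_norm_deriv_regZeta_le
  obtain ⟨c₁, hc₁, h1⟩ := h.exists_le_norm_regZeta_pow hΛ
  set c₀ := t₀ / (1 + t₀) with hc₀
  have hc₀' : 0 < c₀ := by positivity
  set c₂ := min (c₁ * c₀ ^ 5) 1 with hc₂
  have hc₂' : 0 < c₂ := by positivity
  have hc24 : c₂ ^ 4 ≤ c₁ * c₀ ^ 5 :=
    (pow_le_of_le_one hc₂'.le (min_le_right _ _) (by norm_num)).trans (min_le_left _ _)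
  -- the bound to the right
  have hright : ∀ b : ℝ, 0 < b → ∀ s : ℂ, 1 + b ^ 4 * (1 + |s.im|) ^ (-(1 / 10) : ℝ) ≤ s.re →
      s.re ≤ 3 → t₀ ≤ |s.im| → c₂ * b ^ 3 * (1 + |s.im|) ^ (23 / 25 : ℝ) ≤ ‖regZeta a κ s‖ := by
    intro b hb0 s hs1 hs2 hst
    set T := 1 + |s.im| with hT
    have hT1 : 1 ≤ T := by simp [T]
    have hT0 : 0 < T := by linarith
    have hτ : b ^ 4 * T ^ (-(1 / 10) : ℝ) ≤ s.re - 1 := by linarith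
    have hτ0 : 0 < b ^ 4 * T ^ (-(1 / 10) : ℝ) := by positivity
    have e1 : c₀ * T ≤ ‖s - 1‖ := by
      have : |s.im| ≤ ‖s - 1‖ := by simpa using abs_im_le_norm (s - 1)
      refine le_trans ?_ this
      rw [hc₀, div_mul_eq_mul_div, div_le_iff₀ (by positivity)]
      simp only [T]; nlinarith
    have e2 := h1 s (by linarith) hs2
    have e3 : c₁ * ((b ^ 4 * T ^ (-(1 / 10) : ℝ)) ^ 3 * (c₀ * T) ^ 5) ≤
        ‖regZeta a κ s‖ ^ 4 * T ^ (51 / 50 : ℝ) := by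
      refine le_trans ?_ e2
      have : 0 ≤ s.re - 1 := hτ0.le.trans hτ
      gcongr
    refine le_of_pow_le_pow_left₀ (n := 4) (by norm_num) (norm_nonneg _) ?_
    have e4 : T ^ (51 / 50 : ℝ) * (T ^ (23 / 25 : ℝ)) ^ 4 = (T ^ (-(1 / 10) : ℝ)) ^ 3 * T ^ 5 := by
      rw [← Real.rpow_natCast, ← Real.rpow_natCast, ← Real.rpow_natCast, ← Real.rpow_mul hT0.le,
        ← Real.rpow_mul hT0.le, ← Real.rpow_add hT0, ← Real.rpow_add hT0]
      norm_num
    refine le_of_mul_le_mul_right ?_ (show 0 < T ^ (51 / 50 : ℝ) by positivity)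
    refine le_trans ?_ e3
    calc (c₂ * b ^ 3 * T ^ (23 / 25 : ℝ)) ^ 4 * T ^ (51 / 50 : ℝ)
        = c₂ ^ 4 * b ^ 12 * (T ^ (51 / 50 : ℝ) * (T ^ (23 / 25 : ℝ)) ^ 4) := by ring
      _ = c₂ ^ 4 * (b ^ 12 * ((T ^ (-(1 / 10) : ℝ)) ^ 3 * T ^ 5)) := by rw [e4]; ring
      _ ≤ c₁ * c₀ ^ 5 * (b ^ 12 * ((T ^ (-(1 / 10) : ℝ)) ^ 3 * T ^ 5)) := by gcongr
      _ = _ := by ring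
  set b₀ := min (c₂ / (4 * B)) (δ / 400) with hb₀
  have hb₀' : 0 < b₀ := by positivity
  refine ⟨b₀ ^ 4, by positivity, fun β hβ hββ => ?_⟩
  -- a fourth root of `β`
  set b := β ^ (1 / 4 : ℝ) with hb_def
  have hbpos : 0 < b := by positivity
  have hb4 : b ^ 4 = β := by
    rw [hb_def, ← Real.rpow_natCast, ← Real.rpow_mul hβ.le]; norm_num
  have hbb : b ≤ b₀ := le_of_pow_le_pow_left₀ (n := 4) (by norm_num) hb₀'.le (hb4.trans_le hββ)
  have hb1 : b ≤ c₂ / (4 * B) := hbb.trans (min_le_left _ _)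
  have hb2 : b ≤ δ / 400 := hbb.trans (min_le_right _ _)
  have hbβ : β ≤ b := by rw [← hb4]; exact pow_le_of_le_one hbpos.le (by linarith) (by norm_num)
  refine ⟨c₂ * b ^ 3 / 2, by positivity, fun s hs1 hs2 hst => ?_⟩
  set T := 1 + |s.im| with hT
  have hT1 : 1 ≤ T := by simp [T]
  have hT0 : 0 < T := by linarith
  have hTP : T ^ (-(1 / 10) : ℝ) ≤ 1 := Real.rpow_le_one_of_one_le_of_nonpos hT1 (by norm_num)
  have hTP0 : 0 < T ^ (-(1 / 10) : ℝ) := by positivity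
  set τ := β * T ^ (-(1 / 10) : ℝ) with hτ
  have hτ0 : 0 < τ := by positivity
  have hτβ : τ ≤ β := mul_le_of_le_one_right hβ.le hTP
  by_cases hs : 1 + τ ≤ s.re
  · refine le_trans ?_ (hright b hbpos s (by rw [hb4]; exact hs) (by linarith) hst)
    gcongr
    exact half_le_self (by positivity)
  push Not at hs
  set s₁ : ℂ := (1 + τ : ℝ) + s.im * I with hs₁
  have hre : s₁.re = 1 + τ := by simp [hs₁]
  have him : s₁.im = s.im := by simp [hs₁]
  have e1 := hright b hbpos s₁ (by rw [hb4, hre, him]) (by rw [hre]; linarith) (by rwa [him])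
  rw [him] at e1
  have e2 : ‖regZeta a κ s₁ - regZeta a κ s‖ ≤ B * T ^ (51 / 50 : ℝ) * ‖s₁ - s‖ := by
    refine (convex_segment s s₁).norm_image_sub_le_of_norm_deriv_le (𝕜 := ℂ) ?_ ?_
      (left_mem_segment ℝ s s₁) (right_mem_segment ℝ s s₁)
    all_goals
      intro z hz
      rw [segment_eq_image_lineMap] at hz
      obtain ⟨v, hv, rfl⟩ := hz
      have hzre : (AffineMap.lineMap s s₁ v).re = (1 - v) * s.re + v * (1 + τ) := by
        rw [AffineMap.lineMap_apply_module]; simp [hs₁]; ring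
      have hzim : (AffineMap.lineMap s s₁ v).im = s.im := by
        rw [AffineMap.lineMap_apply_module]; simp [hs₁]; ring
      have hz1 : 1 - δ / 400 ≤ (AffineMap.lineMap s s₁ v).re := by
        rw [hzre]
        have q1 := mul_nonneg (sub_nonneg.2 hv.2) (sub_nonneg.2 hs1)
        have q2 := mul_nonneg hv.1 hτ0.le
        linarith
      have hz2 : (AffineMap.lineMap s s₁ v).re ≤ 3 := by
        rw [hzre]
        have q1 := mul_nonneg (sub_nonneg.2 hv.2) (sub_nonneg.2 hs.le)
        linarith
    · exact h.differentiableAt_regZeta (by linarith)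
    · have := (hb _ hz1 hz2).2
      rwa [hzim] at this
  have e3 : ‖s₁ - s‖ ≤ 2 * τ := by
    have : s₁ - s = ((1 + τ - s.re : ℝ) : ℂ) := by
      apply Complex.ext <;> simp [hs₁]
    rw [this, norm_real, Real.norm_of_nonneg (by linarith)]
    linarith
  have e4 : T ^ (51 / 50 : ℝ) * T ^ (-(1 / 10) : ℝ) = T ^ (23 / 25 : ℝ) := by
    rw [← Real.rpow_add hT0]; norm_num
  have e5 : B * T ^ (51 / 50 : ℝ) * ‖s₁ - s‖ ≤ c₂ * b ^ 3 / 2 * T ^ (23 / 25 : ℝ) := by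
    calc B * T ^ (51 / 50 : ℝ) * ‖s₁ - s‖ ≤ B * T ^ (51 / 50 : ℝ) * (2 * τ) := by gcongr
      _ = 2 * B * b * b ^ 3 * (T ^ (51 / 50 : ℝ) * T ^ (-(1 / 10) : ℝ)) := by
        rw [hτ, ← hb4]; ring
      _ ≤ 2 * B * (c₂ / (4 * B)) * b ^ 3 * T ^ (23 / 25 : ℝ) := by rw [e4]; gcongr
      _ = _ := by field_simp; ring
  have e6 := norm_sub_norm_le (regZeta a κ s₁) (regZeta a κ s)
  have e7 : c₂ * b ^ 3 * T ^ (23 / 25 : ℝ) = c₂ * b ^ 3 / 2 * T ^ (23 / 25 : ℝ) +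
    c₂ * b ^ 3 / 2 * T ^ (23 / 25 : ℝ) := by ring
  linarith

/-- Zero-free region with a bound for the logarithmic derivative. -/
lemma exists_norm_logDeriv_regZeta_le (h : PowerSaving a κ C δ) (hΛ : IsVonMangoldt a Λ) :
    ∃ β D, 0 < β ∧ β < δ ∧ 0 < D ∧ ∀ s : ℂ,
      1 - β * (1 + |s.im|) ^ (-(1 / 10) : ℝ) ≤ s.re → s.re ≤ 2 →
      regZeta a κ s ≠ 0 ∧
        ‖deriv (regZeta a κ) s / regZeta a κ s‖ ≤ D * (1 + |s.im|) ^ (1 / 10 : ℝ) := by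
  have hδ := h.exponent_pos
  have hκ := h.residue_pos
  have hδ1 := h.exponent_lt
  obtain ⟨B, hB, hb⟩ := h.exists_norm_deriv_regZeta_le
  obtain ⟨ρ, hρ, hρ1, h0⟩ := h.exists_norm_regZeta_sub_le
  obtain ⟨c₁, hc₁, h1⟩ := h.exists_le_norm_regZeta_pow hΛ
  obtain ⟨β₀, hβ₀, h2⟩ := h.exists_le_norm_regZeta_of_le_im hΛ (t₀ := ρ / 2) (by positivity)
  set β := min β₀ (min (ρ / 2) (δ / 400)) with hβ
  have hβ0 : 0 < β := by positivity
  have hββ : β ≤ β₀ := min_le_left _ _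
  have hβρ : β ≤ ρ / 2 := (min_le_right _ _).trans (min_le_left _ _)
  have hβδ : β ≤ δ / 400 := (min_le_right _ _).trans (min_le_right _ _)
  obtain ⟨c₂, hc₂, h3⟩ := h2 β hβ0 hββ
  set m := min 1 (c₁ * (ρ / 2) ^ 8 / 4) with hm
  have hm0 : 0 < m := by positivity
  set c := min c₂ (min (κ / 4) (m / 2)) with hc
  have hc0 : 0 < c := by positivity
  have key : ∀ s : ℂ, 1 - β * (1 + |s.im|) ^ (-(1 / 10) : ℝ) ≤ s.re → s.re ≤ 2 →
      c * (1 + |s.im|) ^ (23 / 25 : ℝ) ≤ ‖regZeta a κ s‖ := fun s hs1 hs2 => by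
    by_cases hst : ρ / 2 ≤ |s.im|
    · refine le_trans ?_ (h3 s hs1 hs2 hst)
      gcongr
      exact min_le_left _ _
    push Not at hst
    set T := 1 + |s.im| with hT
    have hT1 : 1 ≤ T := by simp [T]
    have hT2 : T ≤ 2 := by simp only [T]; linarith
    have hTP : T ^ (-(1 / 10) : ℝ) ≤ 1 := Real.rpow_le_one_of_one_le_of_nonpos hT1 (by norm_num)
    have hre : 1 - ρ / 2 ≤ s.re := by nlinarith
    have hT3 : T ^ (23 / 25 : ℝ) ≤ 2 := by
      calc T ^ (23 / 25 : ℝ) ≤ T ^ (1 : ℝ) := Real.rpow_le_rpow_of_exponent_le hT1 (by norm_num)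
        _ ≤ 2 := by rwa [Real.rpow_one]
    have hcT : c * T ^ (23 / 25 : ℝ) ≤ c * 2 := by gcongr
    by_cases hs : s.re ≤ 1 + ρ / 2
    · have : κ / 2 ≤ ‖regZeta a κ s‖ := h0 s (by
        refine (norm_le_abs_re_add_abs_im _).trans ?_
        have : |(s - 1).re| ≤ ρ / 2 := abs_le.2 ⟨by simp; linarith, by simp; linarith⟩
        have : |(s - 1).im| = |s.im| := by simp
        linarith)
      have : c ≤ κ / 4 := (min_le_right _ _).trans (min_le_left _ _)
      linarith
    · push Not at hs
      have e1 := h1 s (by linarith) (by linarith)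
      have e2 : ρ / 2 ≤ ‖s - 1‖ := by
        have := (le_abs_self _).trans (abs_re_le_norm (s - 1))
        simp at this
        linarith
      have e3 : T ^ (51 / 50 : ℝ) ≤ 4 := by
        calc T ^ (51 / 50 : ℝ) ≤ T ^ (2 : ℝ) := Real.rpow_le_rpow_of_exponent_le hT1 (by norm_num)
          _ ≤ 2 ^ (2 : ℝ) := by gcongr
          _ = 4 := by norm_num
      have e4 : c₁ * ((ρ / 2) ^ 3 * (ρ / 2) ^ 5) ≤ ‖regZeta a κ s‖ ^ 4 * 4 := by
        have e6 : ρ / 2 ≤ s.re - 1 := by linarith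
        have e7 : 0 ≤ s.re - 1 := by linarith
        calc _ ≤ c₁ * ((s.re - 1) ^ 3 * ‖s - 1‖ ^ 5) := by gcongr
          _ ≤ _ := e1
          _ ≤ _ := by gcongr
      have e5 : m ≤ ‖regZeta a κ s‖ := by
        refine le_of_pow_le_pow_left₀ (n := 4) (by norm_num) (norm_nonneg _) ?_
        refine (pow_le_of_le_one hm0.le (min_le_left _ _) (by norm_num)).trans ?_
        refine (min_le_right _ _).trans ?_
        rw [div_le_iff₀ (by norm_num)]
        refine le_trans (le_of_eq ?_) e4
        ring
      have : c ≤ m / 2 := (min_le_right _ _).trans (min_le_right _ _)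
      linarith
  refine ⟨β, B / c, hβ0, by linarith, by positivity, fun s hs1 hs2 => ?_⟩
  have hk := key s hs1 hs2
  set T := 1 + |s.im| with hT
  have hT1 : 1 ≤ T := by simp [T]
  have hT0 : 0 < T := by linarith
  have hTP : T ^ (-(1 / 10) : ℝ) ≤ 1 := Real.rpow_le_one_of_one_le_of_nonpos hT1 (by norm_num)
  have hpos : 0 < ‖regZeta a κ s‖ := lt_of_lt_of_le (by positivity) hk
  refine ⟨norm_pos_iff.1 hpos, ?_⟩
  rw [norm_div, div_le_iff₀ hpos]
  calc _ ≤ B * T ^ (51 / 50 : ℝ) := (hb s (by nlinarith) (by linarith)).2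
    _ = B / c * T ^ (1 / 10 : ℝ) * (c * T ^ (23 / 25 : ℝ)) := by
      have : T ^ (51 / 50 : ℝ) = T ^ (1 / 10 : ℝ) * T ^ (23 / 25 : ℝ) := by
        rw [← Real.rpow_add hT0]; norm_num
      rw [this]
      field_simp
    _ ≤ _ := by gcongr

end PowerSaving
end ZeroFree

section Decay
open Complex Filter Set
open scoped Topology

/-- Mellin transform of the error term in the smoothed prime number theorem. -/
noncomputable def logKernel (a : ℕ → ℝ) (κ : ℝ) (s : ℂ) : ℂ :=
  -(deriv (regZeta a κ) s / regZeta a κ s) / (s * (s + 1))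

namespace PowerSaving

variable {a Λ : ℕ → ℝ} {κ C δ : ℝ}

lemma analyticAt_regZeta (h : PowerSaving a κ C δ) {s : ℂ} (hs : 1 - δ < s.re) :
    AnalyticAt ℂ (regZeta a κ) s :=
  DifferentiableOn.analyticAt (s := {s : ℂ | 1 - δ < s.re})
    (fun _ hz => (h.differentiableAt_regZeta hz).differentiableWithinAt)
    ((isOpen_lt continuous_const continuous_re).mem_nhds hs)

lemma analyticAt_logKernel (h : PowerSaving a κ C δ) {s : ℂ} (hs : 1 - δ < s.re) (hs0 : 0 < s.re)
    (hz : regZeta a κ s ≠ 0) : AnalyticAt ℂ (logKernel a κ) s := by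
  have h1 := h.analyticAt_regZeta hs
  have h2 : s ≠ 0 := ne_zero_of_re_pos hs0
  have h3 : s + 1 ≠ 0 := ne_zero_of_re_pos (by simp; linarith)
  exact ((h1.deriv.div h1 hz).neg).div (by fun_prop) (mul_ne_zero h2 h3)

lemma one_add_abs_im_le {z : ℂ} (hz : 1 / 2 ≤ z.re) : 1 + |z.im| ≤ 3 * ‖z‖ := by
  have h1 := abs_im_le_norm z
  have h2 := (le_abs_self _).trans (abs_re_le_norm z)
  linarith

lemma exists_norm_iteratedDeriv_logKernel_le (h : PowerSaving a κ C δ) (hΛ : IsVonMangoldt a Λ) :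
    ∃ K, 0 < K ∧ ∀ s : ℂ, 1 < s.re → s.re ≤ 3 / 2 → AnalyticAt ℂ (logKernel a κ) s ∧
      ∀ n ≤ 4, ‖iteratedDeriv n (logKernel a κ) s‖ ≤ K * (1 + |s.im|) ^ (-(3 / 2) : ℝ) := by
  obtain ⟨β, D, hβ, hβδ, hD, hlog⟩ := h.exists_norm_logDeriv_regZeta_le hΛ
  have hδ1 := h.exponent_lt
  set r₀ := β / 2 with hr₀
  have hr₀0 : 0 < r₀ := by positivity
  have hr₀1 : r₀ ≤ 1 / 2 := by linarith
  refine ⟨24 * (36 * D) / r₀ ^ 4, by positivity, fun s hs1 hs2 => ?_⟩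
  set T := 1 + |s.im| with hT
  have hT1 : 1 ≤ T := by simp [T]
  have hT0 : 0 < T := by linarith
  have hTP : T ^ (-(1 / 10) : ℝ) ≤ 1 := Real.rpow_le_one_of_one_le_of_nonpos hT1 (by norm_num)
  have hTP0 : 0 < T ^ (-(1 / 10) : ℝ) := by positivity
  set r := r₀ * T ^ (-(1 / 10) : ℝ) with hr
  have hr0 : 0 < r := by positivity
  have hrr : r ≤ r₀ := mul_le_of_le_one_right hr₀0.le hTP
  have hball : ∀ z ∈ Metric.closedBall s r, AnalyticAt ℂ (logKernel a κ) z ∧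
      ‖logKernel a κ z‖ ≤ 36 * D * T ^ (-(19 / 10) : ℝ) := fun z hz => by
    rw [mem_closedBall_iff_norm] at hz
    have e1 := (abs_re_le_norm (z - s)).trans hz
    have e2 := (abs_im_le_norm (z - s)).trans hz
    rw [sub_re, abs_le] at e1
    rw [sub_im] at e2
    have e3 : |z.im| ≤ |s.im| + |z.im - s.im| := by
      calc |z.im| = |s.im + (z.im - s.im)| := by ring_nf
        _ ≤ _ := abs_add_le _ _
    have e4 : |s.im| ≤ |z.im| + |z.im - s.im| := by
      calc |s.im| = |z.im - (z.im - s.im)| := by ring_nf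
        _ ≤ _ := abs_sub _ _
    set V := 1 + |z.im| with hV
    have hV1 : 1 ≤ V := by simp [V]
    have hV0 : 0 < V := by linarith
    have hVT : V ≤ 2 * T := by simp only [V, T]; linarith [abs_nonneg s.im]
    have hTV : T ≤ 2 * V := by simp only [V, T]; linarith [abs_nonneg z.im]
    have e5 : T ^ (-(1 / 10) : ℝ) / 2 ≤ V ^ (-(1 / 10) : ℝ) := by
      calc T ^ (-(1 / 10) : ℝ) / 2 = 2 ^ (-1 : ℝ) * T ^ (-(1 / 10) : ℝ) := by
            rw [Real.rpow_neg_one]; ring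
        _ ≤ 2 ^ (-(1 / 10) : ℝ) * T ^ (-(1 / 10) : ℝ) := by
          gcongr <;> norm_num
        _ = (2 * T) ^ (-(1 / 10) : ℝ) := (Real.mul_rpow (by norm_num) hT0.le).symm
        _ ≤ _ := Real.rpow_le_rpow_of_nonpos hV0 hVT (by norm_num)
    have e6 : 1 - β * V ^ (-(1 / 10) : ℝ) ≤ z.re := by
      have : r ≤ β * V ^ (-(1 / 10) : ℝ) := by
        calc r = β * (T ^ (-(1 / 10) : ℝ) / 2) := by rw [hr, hr₀]; ring
          _ ≤ _ := by gcongr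
      linarith
    obtain ⟨hz0, hzb⟩ := hlog z e6 (by linarith)
    have hre : 1 / 2 ≤ z.re := by linarith
    refine ⟨h.analyticAt_logKernel (by linarith) (by linarith) hz0, ?_⟩
    have n1 := one_add_abs_im_le hre
    have n2 : 1 + |z.im| ≤ 3 * ‖z + 1‖ := by
      have := one_add_abs_im_le (z := z + 1) (by simp; linarith)
      simpa using this
    have n3 : V * V ≤ 9 * (‖z‖ * ‖z + 1‖) := by
      calc V * V ≤ (3 * ‖z‖) * (3 * ‖z + 1‖) := by gcongr
        _ = _ := by ring
    have hzz : 0 < ‖z‖ * ‖z + 1‖ := by nlinarith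
    rw [logKernel, norm_div, norm_neg, norm_mul, div_le_iff₀ hzz]
    have e7 : V ^ (-(19 / 10) : ℝ) ≤ 4 * T ^ (-(19 / 10) : ℝ) := by
      calc V ^ (-(19 / 10) : ℝ) ≤ (T / 2) ^ (-(19 / 10) : ℝ) :=
            Real.rpow_le_rpow_of_nonpos (by positivity) (by linarith) (by norm_num)
        _ = (2 : ℝ) ^ (19 / 10 : ℝ) * T ^ (-(19 / 10) : ℝ) := by
          rw [Real.div_rpow hT0.le (by norm_num), Real.rpow_neg (by norm_num : (0 : ℝ) ≤ 2)]
          field_simp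
        _ ≤ (2 : ℝ) ^ (2 : ℝ) * T ^ (-(19 / 10) : ℝ) := by
          gcongr <;> norm_num
        _ = _ := by norm_num
    have e8 : V ^ (-(19 / 10) : ℝ) * (V * V) = V ^ (1 / 10 : ℝ) := by
      have : V * V = V ^ (2 : ℝ) := by rw [Real.rpow_two]; ring
      rw [this, ← Real.rpow_add hV0]; norm_num
    calc _ ≤ D * V ^ (1 / 10 : ℝ) := hzb
      _ = D * (V ^ (-(19 / 10) : ℝ) * (V * V)) := by rw [e8]
      _ ≤ D * (4 * T ^ (-(19 / 10) : ℝ) * (9 * (‖z‖ * ‖z + 1‖))) := by gcongr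
      _ = _ := by ring
  refine ⟨(hball s (Metric.mem_closedBall_self hr0.le)).1, fun n hn => ?_⟩
  have hd : DiffContOnCl ℂ (logKernel a κ) (Metric.ball s r) :=
    DifferentiableOn.diffContOnCl fun z hz =>
      (hball z (Metric.closure_ball_subset_closedBall hz)).1.differentiableAt.differentiableWithinAt
  refine (norm_iteratedDeriv_le_of_forall_mem_sphere_norm_le n hr0 hd fun z hz =>
      (hball z (Metric.sphere_subset_closedBall hz)).2).trans ?_
  have f1 : (n.factorial : ℝ) ≤ 24 := by
    have : n.factorial ≤ (4 : ℕ).factorial := Nat.factorial_le hn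
    exact_mod_cast this
  have f2 : r₀ ^ 4 * T ^ (-(4 / 10) : ℝ) ≤ r ^ n := by
    have : r ^ 4 ≤ r ^ n := pow_le_pow_of_le_one hr0.le (by linarith) hn
    refine le_trans (le_of_eq ?_) this
    rw [hr, mul_pow, ← Real.rpow_natCast (T ^ _), ← Real.rpow_mul hT0.le]
    norm_num
  calc _ ≤ 24 * (36 * D * T ^ (-(19 / 10) : ℝ)) / (r₀ ^ 4 * T ^ (-(4 / 10) : ℝ)) := by gcongr
    _ = 24 * (36 * D) / r₀ ^ 4 * (T ^ (-(19 / 10) : ℝ) / T ^ (-(4 / 10) : ℝ)) := by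
      field_simp
    _ = _ := by
      rw [← Real.rpow_sub hT0]; norm_num

lemma iteratedDeriv_comp_line {g : ℂ → ℂ} {σ ω : ℂ} (hg : ∀ y : ℝ, AnalyticAt ℂ g (σ + y * ω))
    (n : ℕ) : iteratedDeriv n (fun y : ℝ => g (σ + y * ω)) =
      fun y : ℝ => ω ^ n * iteratedDeriv n g (σ + y * ω) := by
  induction n with
  | zero => ext y; simp
  | succ n ih =>
    rw [iteratedDeriv_succ, ih]
    ext y
    have h1 : HasDerivAt (iteratedDeriv n g) (iteratedDeriv (n + 1) g (σ + y * ω)) (σ + y * ω) := by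
      rw [iteratedDeriv_succ]
      refine DifferentiableAt.hasDerivAt ?_
      rw [iteratedDeriv_eq_iterate]
      exact ((hg y).iterated_deriv n).differentiableAt
    have h2 : HasDerivAt (fun y : ℝ => σ + y * ω) ω y := by
      have : HasDerivAt (fun y : ℝ => (y : ℂ)) 1 y := HasDerivAt.ofReal_comp (hasDerivAt_id y)
      simpa using (this.mul_const ω).const_add σ
    have h3 := (HasDerivAt.comp y h1 h2).const_mul (ω ^ n)
    refine h3.deriv.trans ?_
    ring

end PowerSaving
end Decay

section MellinRiesz
open MeasureTheory Set Filter Topology Finset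

lemma hasMellin_indicator_Ioi {c : ℝ} (hc : 0 < c) (a : ℂ) {s : ℂ} (hs : s.re + a.re < 0) :
    HasMellin ((Set.Ioi c).indicator fun t : ℝ => (t : ℂ) ^ a) s (-(c : ℂ) ^ (s + a) / (s + a)) :=
      by
  have h1 : (s + a - 1).re < -1 := by simp; linarith
  have heq : ∀ t ∈ Set.Ioi (0 : ℝ), (t : ℂ) ^ (s - 1) • (Set.Ioi c).indicator (fun t : ℝ => (t :
      ℂ) ^ a) t
      = (Set.Ioi c).indicator (fun t : ℝ => (t : ℂ) ^ (s + a - 1)) t := by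
    intro t ht
    by_cases h : t ∈ Set.Ioi c
    · rw [indicator_of_mem h, indicator_of_mem h, smul_eq_mul,
        ← Complex.cpow_add _ _ (by exact_mod_cast (ne_of_gt ht))]
      congr 1; ring
    · rw [indicator_of_notMem h, indicator_of_notMem h, smul_zero]
  have hsub : Set.Ioi (0 : ℝ) ∩ Set.Ioi c = Set.Ioi c := by
    rw [Set.inter_eq_right]; exact Set.Ioi_subset_Ioi hc.le
  constructor
  · refine (integrableOn_congr_fun heq measurableSet_Ioi).2 ?_
    rw [IntegrableOn, integrable_indicator_iff measurableSet_Ioi, IntegrableOn,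
      Measure.restrict_restrict measurableSet_Ioi, Set.inter_comm, hsub]
    exact integrableOn_Ioi_cpow_of_lt h1 hc
  · rw [mellin, setIntegral_congr_fun measurableSet_Ioi heq,
      setIntegral_indicator measurableSet_Ioi,
      hsub, integral_Ioi_cpow_of_lt h1 hc]
    rw [sub_add_cancel]

lemma hasMellin_max_sub {c : ℝ} (hc : 0 < c) {s : ℂ} (hs : 0 < s.re) :
    HasMellin (fun t : ℝ => ((max 0 (t - c) : ℝ) : ℂ)) (-s - 1) ((c : ℂ) ^ (-s) / (s * (s +
      1))) := by
  have h1 := hasMellin_indicator_Ioi hc 1 (s := -s - 1) (by simpa using hs)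
  have h2 := hasMellin_indicator_Ioi hc 0 (s := -s - 1) (by simp; linarith)
  have h3 := h1.1.const_smul (1:ℂ)
  have h4 : MellinConvergent (fun t => (c : ℂ) • (Set.Ioi c).indicator (fun t : ℝ => (t :
      ℂ) ^ (0 : ℂ)) t)
    (-s - 1) := h2.1.const_smul (c : ℂ)
  have h5 := hasMellin_sub h1.1 h4
  have hs0 : s ≠ 0 := by rintro rfl; simp at hs
  have hs1 : s + 1 ≠ 0 := by
    intro h; have := congrArg Complex.re h; simp at this; linarith
  have hc0 : (c : ℂ) ≠ 0 := by exact_mod_cast hc.ne'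
  convert h5 using 1
  · ext t
    by_cases h : t ∈ Set.Ioi c
    · rw [indicator_of_mem h, indicator_of_mem h, max_eq_right (by simpa using h.le)]
      simp
    · rw [indicator_of_notMem h, indicator_of_notMem h, max_eq_left (by simpa using h)]
      simp
  · rw [mellin_const_smul, h1.2, h2.2]
    have e1 : (c : ℂ) ^ (-s - 1 + 0) = (c : ℂ) ^ (-s) / c := by
      rw [add_zero, Complex.cpow_sub _ _ hc0, Complex.cpow_one]
    have e3 : -s - 1 + 0 ≠ 0 := by
      intro h; apply hs1; linear_combination -h
    rw [e1, show -s - 1 + 1 = -s by ring, show -s - 1 + 0 = -(s + 1) by ring, smul_eq_mul]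
    field_simp
    ring

lemma hasMellin_max_sub_one_sq {s : ℂ} (hs : 1 < s.re) :
    HasMellin (fun t : ℝ => (((max 0 (t - 1)) ^ 2 / 2 : ℝ) : ℂ)) (-s - 1)
      (1 / ((s - 1) * (s * (s + 1)))) := by
  have h2 := hasMellin_indicator_Ioi one_pos 2 (s := -s - 1) (by simp; linarith)
  have h1 := hasMellin_indicator_Ioi one_pos 1 (s := -s - 1) (by simp; linarith)
  have h0 := hasMellin_indicator_Ioi one_pos 0 (s := -s - 1) (by simp; linarith)
  have h3 := hasMellin_sub (hasMellin_add (h2.1.div_const 2) (h0.1.div_const 2)).1 h1.1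
  have hs0 : s ≠ 0 := by rintro rfl; simp at hs; linarith
  have hs1 : s + 1 ≠ 0 := by
    intro h; have := congrArg Complex.re h; simp at this; linarith
  have hs2 : s - 1 ≠ 0 := by
    intro h; have := congrArg Complex.re h; simp at this; linarith
  have hf : (fun t : ℝ => (((max 0 (t - 1)) ^ 2 / 2 : ℝ) : ℂ)) = fun t =>
      (Set.Ioi 1).indicator (fun t : ℝ => (t : ℂ) ^ (2 : ℂ)) t / 2 +
        (Set.Ioi 1).indicator (fun t : ℝ => (t : ℂ) ^ (0 : ℂ)) t / 2 -
        (Set.Ioi 1).indicator (fun t : ℝ => (t : ℂ) ^ (1 : ℂ)) t := by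
    ext t
    by_cases h : t ∈ Set.Ioi (1 : ℝ)
    · simp only [indicator_of_mem h, max_eq_right (show (0 : ℝ) ≤ t - 1 by simpa using h.le)]
      simp; ring
    · simp only [indicator_of_notMem h, max_eq_left (show t - 1 ≤ 0 by simpa using h)]
      simp
  rw [hf]
  refine ⟨h3.1, h3.2.trans ?_⟩
  rw [(hasMellin_add (h2.1.div_const 2) (h0.1.div_const 2)).2, mellin_div_const,
    mellin_div_const, h1.2, h2.2, h0.2]
  simp only [Complex.ofReal_one, Complex.one_cpow]
  have e1 : -s - 1 + 2 = -(s - 1) := by ring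
  have e2 : -s - 1 + 0 = -(s + 1) := by ring
  have e3 : -s - 1 + 1 = -s := by ring
  rw [e1, e2, e3]
  field_simp
  ring

lemma continuous_rieszSum (a : ℕ → ℝ) : Continuous (rieszSum a) := by
  rw [continuous_iff_continuousAt]
  intro x
  have h1 : (fun y => ∑ n ∈ range (⌊x⌋₊ + 1), a n * max 0 (y - n)) =ᶠ[𝓝 x] rieszSum a := by
    have hx : x < (⌊x⌋₊ + 1 : ℕ) := by exact_mod_cast Nat.lt_floor_add_one x
    filter_upwards [Iio_mem_nhds hx] with y hy
    exact (rieszSum_eq a (le_of_lt hy)).symm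
  exact ContinuousAt.congr (by fun_prop) h1

lemma hasSum_rieszSum (a : ℕ → ℝ) (t : ℝ) : HasSum (fun n : ℕ => a n *
    max 0 (t - n)) (rieszSum a t) := by
  refine hasSum_sum_of_ne_finset_zero fun n hn => ?_
  rw [Finset.mem_range, not_lt] at hn
  have : t ≤ n := (Nat.lt_floor_add_one t).le.trans (by exact_mod_cast hn)
  rw [max_eq_left (by linarith), mul_zero]

lemma rieszSum_of_le_one {a : ℕ → ℝ} (h0 : a 0 = 0) {t : ℝ} (ht : t ≤ 1) : rieszSum a t = 0 := by
  rw [rieszSum_eq a (M := 1) (by exact_mod_cast ht)]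
  simp [h0]

lemma rieszSum_nonneg {a : ℕ → ℝ} (ha : ∀ n, 0 ≤ a n) (t : ℝ) : 0 ≤ rieszSum a t :=
  (hasSum_rieszSum a t).nonneg fun n => mul_nonneg (ha n) (le_max_left _ _)

lemma norm_lseries_term {a : ℕ → ℝ} (ha : ∀ n, 0 ≤ a n) (s : ℂ) {n : ℕ} (hn : n ≠ 0) :
    ‖LSeries.term (fun n => (a n : ℂ)) s n‖ = a n / (n : ℝ) ^ s.re := by
  rw [LSeries.norm_term_eq, if_neg hn, Complex.norm_real, Real.norm_of_nonneg (ha n)]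

lemma rieszSum_le_rpow {a : ℕ → ℝ} (ha : ∀ n, 0 ≤ a n) (h0 : a 0 = 0) {σ : ℝ} (hσ : 0 ≤ σ)
    (hsum : LSeriesSummable (fun n => (a n : ℂ)) σ) {t : ℝ} (ht : 0 < t) :
    rieszSum a t ≤ (∑' n, ‖LSeries.term (fun n => (a n : ℂ)) σ n‖) * t ^ (1 + σ) := by
  refine hasSum_le (fun n => ?_) (hasSum_rieszSum a t)
    ((Summable.norm hsum).hasSum.mul_right (t ^ (1 + σ)))
  rcases eq_or_ne n 0 with rfl | hn
  · simp [h0]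
  have hn0 : (0 : ℝ) < n := by exact_mod_cast Nat.pos_of_ne_zero hn
  rw [norm_lseries_term ha _ hn, Complex.ofReal_re]
  rcases le_total t n with h | h
  · rw [max_eq_left (by linarith), mul_zero]
    have := ha n
    positivity
  · rw [max_eq_right (by linarith), div_mul_eq_mul_div, le_div_iff₀ (by positivity), mul_assoc,
      Real.rpow_add ht, Real.rpow_one]
    have := ha n
    have h2 : (n : ℝ) ^ σ ≤ t ^ σ := Real.rpow_le_rpow hn0.le h hσ
    gcongr
    linarith

lemma mellinConvergent_rieszSum {a : ℕ → ℝ} (ha : ∀ n, 0 ≤ a n) (h0 : a 0 = 0)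
    (hsum : ∀ σ : ℝ, 1 < σ → LSeriesSummable (fun n => (a n : ℂ)) σ) {s : ℂ} (hs : 1 < s.re) :
    MellinConvergent (fun t => (rieszSum a t : ℂ)) (-s - 1) := by
  set σ := (1 + s.re) / 2 with hσ
  refine mellinConvergent_of_isBigO_rpow (a := -(1 + σ)) (b := -s.re - 2) ?_ ?_ ?_ ?_ ?_
  · exact ((Complex.continuous_ofReal.comp (continuous_rieszSum
      a)).locallyIntegrable).locallyIntegrableOn _
  · refine Asymptotics.IsBigO.of_bound (∑' n, ‖LSeries.term (fun n => (a n : ℂ)) σ n‖) ?_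
    filter_upwards [eventually_gt_atTop 0] with t ht
    rw [Complex.norm_real, Real.norm_of_nonneg (rieszSum_nonneg ha t), neg_neg,
      Real.norm_of_nonneg (by positivity)]
    exact rieszSum_le_rpow ha h0 (by linarith) (hsum σ (by linarith)) ht
  · simp; linarith
  · refine Asymptotics.IsBigO.of_bound 1 ?_
    filter_upwards [Ioo_mem_nhdsGT one_pos] with t ht
    rw [rieszSum_of_le_one h0 ht.2.le]
    simp
  · simp

lemma hasMellin_rieszSum {a : ℕ → ℝ} (ha : ∀ n, 0 ≤ a n) (h0 : a 0 = 0)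
    (hsum : ∀ σ : ℝ, 1 < σ → LSeriesSummable (fun n => (a n : ℂ)) σ) {s : ℂ} (hs : 1 < s.re) :
    HasMellin (fun t => (rieszSum a t : ℂ)) (-s - 1)
      (LSeries (fun n => (a n : ℂ)) s / (s * (s + 1))) := by
  refine ⟨mellinConvergent_rieszSum ha h0 hsum hs, ?_⟩
  have hterm : ∀ w : ℂ, 1 < w.re → ∀ n : ℕ,
      HasMellin (fun t => (a n : ℂ) • ((max 0 (t - n) : ℝ) : ℂ)) (-w - 1)
        (LSeries.term (fun n => (a n : ℂ)) w n / (w * (w + 1))) := by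
    intro w hw n
    rcases eq_or_ne n 0 with rfl | hn
    · simp [h0, HasMellin, MellinConvergent, mellin, LSeries.term_zero]
    · have hn0 : (0 : ℝ) < n := by exact_mod_cast Nat.pos_of_ne_zero hn
      have h1 := hasMellin_max_sub hn0 (s := w) (by linarith)
      have h2 := hasMellin_const_smul h1.1 (a n : ℂ)
      refine ⟨h2.1, h2.2.trans ?_⟩
      rw [h1.2, LSeries.term_of_ne_zero hn, smul_eq_mul, Complex.cpow_neg, Complex.ofReal_natCast]
      ring
  have hnorm : ∀ n : ℕ, ∀ t ∈ Set.Ioi (0 : ℝ),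
      ((‖(t : ℂ) ^ (-s - 1 - 1) • (a n : ℂ) • ((max 0 (t - n) : ℝ) : ℂ)‖ : ℝ) : ℂ) =
        (t : ℂ) ^ (-(s.re : ℂ) - 1 - 1) • (a n : ℂ) • ((max 0 (t - n) : ℝ) : ℂ) := by
    intro n t ht
    rw [norm_smul, norm_smul, Complex.norm_cpow_eq_rpow_re_of_pos ht, Complex.norm_real,
      Complex.norm_real, Real.norm_of_nonneg (ha n), Real.norm_of_nonneg (le_max_left _ _)]
    push_cast
    rw [Complex.ofReal_cpow (le_of_lt ht)]
    simp
  have hσ : 1 < ((s.re : ℝ) : ℂ).re := by simpa using hs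
  have key := hasSum_integral_of_summable_integral_norm (μ := volume.restrict (Set.Ioi (0 : ℝ)))
    (F := fun (n : ℕ) (t : ℝ) => (t : ℂ) ^ (-s - 1 - 1) • (a n : ℂ) • ((max 0 (t - n) : ℝ) : ℂ))
    (fun n => (hterm s hs n).1) ?_
  · have e1 : ∀ t : ℝ, ∑' n : ℕ, (t : ℂ) ^ (-s - 1 - 1) • (a n : ℂ) • ((max 0 (t - n) : ℝ) : ℂ) =
        (t : ℂ) ^ (-s - 1 - 1) • (rieszSum a t : ℂ) := by
      intro t
      refine HasSum.tsum_eq (HasSum.const_smul _ ?_)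
      have := (hasSum_rieszSum a t).mapL Complex.ofRealCLM
      simpa using this
    simp only [e1] at key
    refine key.unique ?_
    have := (hsum s.re hs).of_re_le_re (s' := s) (by simp)
    refine (this.hasSum.div_const (s * (s + 1))).congr_fun fun n => ?_
    exact (hterm s hs n).2
  · have e2 : ∀ n : ℕ, ((∫ t in Set.Ioi (0 : ℝ), ‖(t : ℂ) ^ (-s - 1 - 1) • (a n : ℂ) •
        ((max 0 (t - n) : ℝ) : ℂ)‖ : ℝ) : ℂ) =
        LSeries.term (fun n => (a n : ℂ)) (s.re : ℂ) n / ((s.re : ℂ) * ((s.re : ℂ) + 1)) := by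
      intro n
      rw [← (hterm (s.re : ℂ) hσ n).2, mellin]
      refine (integral_ofReal (𝕜 := ℂ)).symm.trans ?_
      exact setIntegral_congr_fun measurableSet_Ioi (hnorm n)
    have := (hsum s.re hs).div_const ((s.re : ℂ) * ((s.re : ℂ) + 1))
    rw [← Complex.summable_ofReal]
    exact this.congr fun n => (e2 n).symm

end MellinRiesz

section PrimeNumberTheorem
open MeasureTheory Set Filter Topology FourierTransform

namespace PowerSaving

variable {a Λ : ℕ → ℝ} {κ C δ : ℝ}

lemma logKernel_eq (h : PowerSaving a κ C δ) (hΛ : IsVonMangoldt a Λ) {s : ℂ} (hs : 1 < s.re)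
    (hs0 : regZeta a κ s ≠ 0) :
    logKernel a κ s = LSeries (fun n => (Λ n : ℂ)) s / (s * (s + 1)) -
      1 / ((s - 1) * (s * (s + 1))) := by
  have hs1 : s - 1 ≠ 0 := by
    intro h; have := congrArg Complex.re h; simp at this; linarith
  have hL := h.hasDerivAt_lseries hΛ hs
  have hZ : regZeta a κ =ᶠ[𝓝 s] fun s => (s - 1) * LSeries (fun n => (a n : ℂ)) s := by
    filter_upwards [(isOpen_lt continuous_const Complex.continuous_re).mem_nhds hs] with w hw
    exact h.regZeta_eq hw
  have hd : deriv (regZeta a κ) s = LSeries (fun n => (a n : ℂ)) s + (s - 1) *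
      -(LSeries (fun n => (Λ n : ℂ)) s * LSeries (fun n => (a n : ℂ)) s) := by
    rw [hZ.deriv_eq]
    refine (((hasDerivAt_id s).sub_const 1).mul hL).deriv.trans ?_
    simp
  rw [h.regZeta_eq hs] at hs0
  have hL0 := right_ne_zero_of_mul hs0
  have e : deriv (regZeta a κ) s / regZeta a κ s =
      1 / (s - 1) - LSeries (fun n => (Λ n : ℂ)) s := by
    rw [hd, h.regZeta_eq hs]
    field_simp
    ring
  rw [logKernel, e, neg_sub, sub_div, div_div]

lemma hasMellin_rieszSum_sub (h : PowerSaving a κ C δ) (hΛ : IsVonMangoldt a Λ) {s : ℂ}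
    (hs : 1 < s.re) (hs0 : regZeta a κ s ≠ 0) :
    HasMellin (fun t => ((rieszSum Λ t : ℝ) : ℂ) - (((max 0 (t - 1)) ^ 2 / 2 : ℝ) : ℂ)) (-s - 1)
      (logKernel a κ s) := by
  have h1 := hasMellin_rieszSum hΛ.nonneg hΛ.map_zero
    (fun σ hσ => h.lseriesSummable_vonMangoldt hΛ (by simpa using hσ)) hs
  have h2 := hasMellin_max_sub_one_sq hs
  have h3 := hasMellin_sub h1.1 h2.1
  rw [h1.2, h2.2, ← h.logKernel_eq hΛ hs hs0] at h3
  exact h3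

lemma integrable_of_norm_le {G : ℝ → ℂ} (hG : Continuous G) {K : ℝ}
    (hb : ∀ y, ‖G y‖ ≤ K * (1 + ‖y‖) ^ (-(3 / 2) : ℝ)) :
    Integrable G ∧ ∫ y, ‖G y‖ ≤ K * ∫ y : ℝ, (1 + ‖y‖) ^ (-(3 / 2) : ℝ) := by
  have h1 : Integrable fun y : ℝ => K * (1 + ‖y‖) ^ (-(3 / 2) : ℝ) :=
    (integrable_one_add_norm (by simp; norm_num)).const_mul K
  have h2 : Integrable G := h1.mono' hG.aestronglyMeasurable (ae_of_all _ hb)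
  exact ⟨h2, by rw [← integral_const_mul]; exact integral_mono h2.norm h1 hb⟩

lemma pow_mul_norm_fourier_le {G : ℝ → ℂ} {K : ℝ} (hG : ContDiff ℝ 4 G)
    (hb : ∀ n ≤ 4, ∀ y, ‖iteratedDeriv n G y‖ ≤
      (2 * Real.pi) ^ n * (K * (1 + ‖y‖) ^ (-(3 / 2) : ℝ)))
    (ξ : ℝ) : |ξ| ^ 4 * ‖𝓕 G ξ‖ ≤ K * ∫ y : ℝ, (1 + ‖y‖) ^ (-(3 / 2) : ℝ) := by
  have hI : ∀ n ≤ 4, Integrable (iteratedDeriv n G) ∧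
      ∫ y, ‖iteratedDeriv n G y‖ ≤ (2 * Real.pi) ^ n * K * ∫ y : ℝ, (1 + ‖y‖) ^ (-(3 / 2) : ℝ) := by
    intro n hn
    refine integrable_of_norm_le (hG.continuous_iteratedDeriv n (by exact_mod_cast hn)) fun y => ?_
    rw [mul_assoc]; exact hb n hn y
  have h1 := congrFun (Real.fourier_iteratedDeriv (N := 4) hG
    (fun n hn => (hI n (by exact_mod_cast hn)).1) (n := 4) (by norm_num)) ξ
  have h2 : ‖𝓕 (iteratedDeriv 4 G) ξ‖ ≤ ∫ y, ‖iteratedDeriv 4 G y‖ := by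
    rw [Real.fourier_eq]
    refine (norm_integral_le_integral_norm _).trans (le_of_eq ?_)
    congr 1
    ext y
    rw [Circle.norm_smul]
  rw [h1, norm_smul, norm_pow, norm_mul, norm_mul, norm_mul] at h2
  have h3 := h2.trans (hI 4 le_rfl).2
  simp only [Complex.norm_I, Complex.norm_ofNat, Complex.norm_real, Real.norm_eq_abs,
    abs_of_pos Real.pi_pos, mul_one, mul_pow (2 * Real.pi) |ξ| 4] at h3
  have : 0 < (2 * Real.pi) ^ 4 := by positivity
  rw [mul_assoc, mul_assoc] at h3
  exact le_of_mul_le_mul_left h3 this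

lemma exists_abs_rieszSum_sub_le (h : PowerSaving a κ C δ) (hΛ : IsVonMangoldt a Λ) :
    ∃ D : ℝ, ∀ x, 1 ≤ x → |rieszSum Λ x - (x - 1) ^ 2 / 2| * Real.log x ^ 4 ≤ D * x ^ 2 := by
  obtain ⟨K, hK, hb⟩ := h.exists_norm_iteratedDeriv_logKernel_le hΛ
  obtain ⟨β, _, hβ, -, -, hlog⟩ := h.exists_norm_logDeriv_regZeta_le hΛ
  set J := ∫ y : ℝ, (1 + ‖y‖) ^ (-(3 / 2) : ℝ) with hJ
  set f : ℝ → ℂ := fun t => ((rieszSum Λ t : ℝ) : ℂ) - (((max 0 (t - 1)) ^ 2 / 2 : ℝ) : ℂ) with hf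
  have hne : ∀ s : ℂ, 1 < s.re → s.re ≤ 3 / 2 → regZeta a κ s ≠ 0 := fun s h1 h2 =>
    (hlog s (by have : 0 < β * (1 + |s.im|) ^ (-(1 / 10) : ℝ) := by positivity
                linarith) (by linarith)).1
  have hmel : ∀ s : ℂ, 1 < s.re → s.re ≤ 3 / 2 → mellin f (-s - 1) = logKernel a κ s :=
    fun s h1 h2 => (h.hasMellin_rieszSum_sub hΛ h1 (hne s h1 h2)).2
  have hfc : Continuous f := by
    have := continuous_rieszSum Λ
    fun_prop
  have key : ∀ σ : ℝ, 1 < σ → σ ≤ 3 / 2 → ∀ x, 1 ≤ x →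
      ‖f x‖ * Real.log x ^ 4 ≤ K * J * x ^ (σ + 1) := by
    intro σ h1 h2 x hx
    have hx0 : 0 < x := by linarith
    set ω : ℂ := -(2 * Real.pi * Complex.I) with hω
    have hωn : ‖ω‖ = 2 * Real.pi := by
      rw [hω, norm_neg]; simp [abs_of_pos Real.pi_pos]
    have hre : ∀ y : ℝ, ((σ : ℂ) + y * ω).re = σ := by intro y; simp [hω]
    have him : ∀ y : ℝ, |((σ : ℂ) + y * ω).im| = 2 * Real.pi * |y| := by
      intro y; simp [hω, abs_mul, abs_of_pos Real.pi_pos]; ring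
    have hline : ∀ y : ℝ, AnalyticAt ℂ (logKernel a κ) (σ + y * ω) ∧ ∀ n ≤ 4,
        ‖iteratedDeriv n (logKernel a κ) (σ + y * ω)‖ ≤ K * (1 + ‖y‖) ^ (-(3 / 2) : ℝ) := by
      intro y
      have := hb (σ + y * ω) (by rw [hre]; exact h1) (by rw [hre]; exact h2)
      refine ⟨this.1, fun n hn => (this.2 n hn).trans ?_⟩
      rw [him, Real.norm_eq_abs]
      refine mul_le_mul_of_nonneg_left ?_ hK.le
      refine Real.rpow_le_rpow_of_nonpos (by positivity) ?_ (by norm_num)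
      have : (1 : ℝ) ≤ 2 * Real.pi := by have := Real.pi_gt_three; linarith
      nlinarith [abs_nonneg y]
    set G : ℝ → ℂ := fun y => logKernel a κ (σ + y * ω) with hG
    have hiter := iteratedDeriv_comp_line (fun y => (hline y).1)
    have hGd : ContDiff ℝ 4 G := by
      rw [contDiff_iff_contDiffAt]
      intro y
      have h3 : ContDiffAt ℝ 4 (logKernel a κ) (σ + y * ω) :=
        (hline y).1.contDiffAt.restrict_scalars ℝ
      refine ContDiffAt.comp (f := fun y : ℝ => (σ : ℂ) + y * ω) y h3 ?_
      have : ContDiff ℝ 4 fun y : ℝ => (y : ℂ) := Complex.ofRealCLM.contDiff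
      fun_prop
    have hfour := pow_mul_norm_fourier_le (K := K) hGd (fun n hn y => by
      rw [hG, hiter n]
      simp only [norm_mul, norm_pow, hωn]
      gcongr
      exact (hline y).2 n hn) (Real.log x)
    have hV : Complex.VerticalIntegrable (mellin f) (-σ - 1) := by
      have hi : Integrable fun y : ℝ => logKernel a κ (σ - y * Complex.I) := by
        refine (integrable_of_norm_le (K := K) ?_ fun y => ?_).1
        · rw [continuous_iff_continuousAt]
          intro y
          have := (hb (σ - y * Complex.I) (by simpa using h1) (by simpa using h2)).1.continuousAt
          exact ContinuousAt.comp (f := fun y : ℝ => (σ : ℂ) - y * Complex.I) this (by fun_prop)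
        · have := (hb (σ - y * Complex.I) (by simpa using h1) (by simpa using h2)).2 0 (by norm_num)
          simpa using this
      refine hi.congr (ae_of_all _ fun y => ?_)
      have := hmel (σ - y * Complex.I) (by simpa using h1) (by simpa using h2)
      simp only [← this]
      congr 1
      push_cast
      ring
    have hinv := mellinInv_mellin_eq (-σ - 1) f hx0
      (by
        have := (h.hasMellin_rieszSum_sub hΛ (s := σ) (by simpa using h1)
          (hne _ (by simpa using h1) (by simpa using h2))).1
        push_cast
        exact this) hV hfc.continuousAt
    rw [mellinInv_eq_fourierInv _ _ hx0] at hinv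
    have hGm : (fun y : ℝ => mellin f (((-σ - 1 : ℝ) : ℂ) + 2 * Real.pi * y * Complex.I)) = G := by
      ext y
      simp only [hG]
      rw [← hmel _ (by rw [hre]; exact h1) (by rw [hre]; exact h2), hω]
      congr 1
      push_cast
      ring
    rw [hGm, Real.fourierInv_eq_fourier_neg, neg_neg] at hinv
    rw [← hinv, norm_smul]
    have e : (-((-σ - 1 : ℝ) : ℂ)) = ((σ + 1 : ℝ) : ℂ) := by push_cast; ring
    rw [e, Complex.norm_cpow_eq_rpow_re_of_pos hx0, Complex.ofReal_re]
    rw [abs_of_nonneg (Real.log_nonneg hx)] at hfour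
    have : 0 < x ^ (σ + 1) := by positivity
    nlinarith
  refine ⟨K * J, fun x hx => ?_⟩
  have hx0 : 0 < x := by linarith
  have e1 : ‖f x‖ = |rieszSum Λ x - (x - 1) ^ 2 / 2| := by
    rw [hf]
    simp only
    rw [max_eq_right (by linarith), ← Complex.ofReal_sub, Complex.norm_real, Real.norm_eq_abs]
  rw [← e1]
  have hlim : Tendsto (fun σ : ℝ => K * J * x ^ (σ + 1)) (𝓝[>] 1) (𝓝 (K * J * x ^ 2)) := by
    have : Continuous fun σ : ℝ => K * J * x ^ (σ + 1) :=
      continuous_const.mul (Real.continuous_const_rpow hx0.ne' |>.comp (by fun_prop))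
    have h2 := this.tendsto 1
    norm_num at h2
    exact h2.mono_left nhdsWithin_le_nhds
  refine ge_of_tendsto hlim ?_
  filter_upwards [Ioc_mem_nhdsGT (show (1 : ℝ) < 3 / 2 by norm_num)] with σ hσ
  exact key σ hσ.1 hσ.2 x hx

lemma one_add_log_sq_le {x : ℝ} (hx : 1 ≤ x) : (1 + Real.log x) ^ 2 ≤ 4 * x := by
  have hx0 : 0 < x := by linarith
  have h1 := Real.log_le_sub_one_of_pos (Real.sqrt_pos.2 hx0)
  rw [Real.log_sqrt hx0.le] at h1
  have h2 := Real.log_nonneg hx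
  have h3 := Real.sq_sqrt hx0.le
  nlinarith [Real.sqrt_nonneg x]

/-- A one-sided prime number theorem with a double logarithmic saving. -/
lemma exists_sub_le_sum_vonMangoldt (h : PowerSaving a κ C δ) (hΛ : IsVonMangoldt a Λ) :
    ∃ D : ℝ, 0 < D ∧ ∀ x, 1 ≤ x →
      x - D * x / (1 + Real.log x) ^ 2 ≤ ∑ n ∈ Finset.range (⌊x⌋₊ + 1), Λ n := by
  obtain ⟨D₀, hD₀⟩ := h.exists_abs_rieszSum_sub_le hΛ
  set D := max D₀ 0 with hD
  have hD0 : 0 ≤ D := le_max_right _ _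
  have hR : ∀ x, 1 ≤ x → |rieszSum Λ x - (x - 1) ^ 2 / 2| * Real.log x ^ 4 ≤ D * x ^ 2 :=
    fun x hx => (hD₀ x hx).trans (by gcongr; exact le_max_left _ _)
  refine ⟨13 + 9 / 4 * (1 / 2 + 17 * D), by positivity, fun x hx => ?_⟩
  have hx0 : 0 < x := by linarith
  have hl0 := Real.log_nonneg hx
  set l := Real.log x with hl
  have hsum0 : 0 ≤ ∑ n ∈ Finset.range (⌊x⌋₊ + 1), Λ n := Finset.sum_nonneg fun n _ => hΛ.nonneg n
  have hp : 0 < (1 + l) ^ 2 := by positivity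
  rcases lt_or_ge l 2 with hl2 | hl2
  · refine le_trans ?_ hsum0
    rw [sub_nonpos, le_div_iff₀ hp, mul_comm]
    have : (1 + l) ^ 2 ≤ 9 := by nlinarith
    gcongr
    linarith
  have hx4 : 4 ≤ x := by
    have h1 : Real.exp 2 ≤ x := by
      rw [← Real.exp_log hx0]; exact Real.exp_le_exp.2 hl2
    have h2 : (2 : ℝ) * 2 ≤ Real.exp 2 := by
      rw [show (2 : ℝ) = 1 + 1 by norm_num, Real.exp_add]
      have := Real.exp_one_gt_d9
      nlinarith
    linarith
  set H := x / l ^ 2 with hH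
  have hH0 : 0 < H := by positivity
  have hHl : H * l ^ 2 = x := by rw [hH]; field_simp
  have hHx : H ≤ x / 4 := by rw [hH]; gcongr; nlinarith
  have h1 := rieszSum_sub_le_mul_sum hΛ.nonneg (x := x) hH0.le
  have h2 := hR x hx
  have h3 := hR (x - H) (by linarith)
  have hlog : l / 2 ≤ Real.log (x - H) := by
    rw [hl, ← Real.log_sqrt hx0.le]
    refine Real.log_le_log (Real.sqrt_pos.2 hx0) ?_
    rw [Real.sqrt_le_left (by linarith)]
    nlinarith
  have h4 : |rieszSum Λ (x - H) - (x - H - 1) ^ 2 / 2| * (l ^ 4 / 16) ≤ D * x ^ 2 := by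
    calc _ ≤ |rieszSum Λ (x - H) - (x - H - 1) ^ 2 / 2| * Real.log (x - H) ^ 4 := by
          gcongr
          calc l ^ 4 / 16 = (l / 2) ^ 4 := by ring
            _ ≤ _ := by gcongr
      _ ≤ D * (x - H) ^ 2 := h3
      _ ≤ _ := by gcongr <;> linarith
  have hl4 : 0 < l ^ 4 := by positivity
  have h5 : |rieszSum Λ x - (x - 1) ^ 2 / 2| ≤ D * H ^ 2 := by
    rw [← mul_le_mul_iff_left₀ hl4]
    refine h2.trans (le_of_eq ?_)
    rw [← hHl]; ring
  have h6 : |rieszSum Λ (x - H) - (x - H - 1) ^ 2 / 2| ≤ 16 * D * H ^ 2 := by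
    rw [← mul_le_mul_iff_left₀ (show 0 < l ^ 4 / 16 by positivity)]
    refine h4.trans (le_of_eq ?_)
    nth_rw 1 [← hHl]; ring
  have h7 := (abs_le.1 h5).1
  have h8 := (abs_le.1 h6).2
  have h9 : H * (x - 1 - (1 / 2 + 17 * D) * H) ≤ H * ∑ n ∈ Finset.range (⌊x⌋₊ + 1), Λ n := by
    nlinarith
  have h10 := le_of_mul_le_mul_left h9 hH0
  refine le_trans ?_ h10
  have h11 : 1 ≤ 4 * x / (1 + l) ^ 2 := by
    rw [le_div_iff₀ hp, one_mul]; exact one_add_log_sq_le hx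
  have h12 : H ≤ 9 / 4 * (x / (1 + l) ^ 2) := by
    rw [hH, ← mul_div_assoc, div_le_div_iff₀ (by positivity) hp]
    nlinarith [mul_nonneg hx0.le (show 0 ≤ (5 * l + 2) * (l - 2) by
      exact mul_nonneg (by linarith) (by linarith))]
  have h13 : (1 / 2 + 17 * D) * H ≤ (1 / 2 + 17 * D) * (9 / 4 * (x / (1 + l) ^ 2)) := by gcongr
  have h14 : 0 ≤ x / (1 + l) ^ 2 := by positivity
  have h15 : (13 + 9 / 4 * (1 / 2 + 17 * D)) * x / (1 + l) ^ 2 =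
      9 * (x / (1 + l) ^ 2) + 4 * x / (1 + l) ^ 2 +
        (1 / 2 + 17 * D) * (9 / 4 * (x / (1 + l) ^ 2)) := by ring
  linarith

end PowerSaving
end PrimeNumberTheorem

section VonMangoldt
open Ideal UniqueFactorizationMonoid nonZeroDivisors

variable (K : Type*) [Field K] [NumberField K]

lemma finite_setOf_absNorm_eq (n : ℕ) : {I : Ideal (𝓞 K) | I ≠ ⊥ ∧ absNorm I = n}.Finite :=
  Set.Finite.subset (finite_setOfPred_absNorm_le n) fun _ hI => le_of_eq hI.2

lemma finite_setOf_isPrime_absNorm_le (x : ℝ) :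
    {P : Ideal (𝓞 K) | P.IsPrime ∧ P ≠ ⊥ ∧ (absNorm P : ℝ) ≤ x}.Finite :=
  Set.Finite.subset (finite_setOfPred_absNorm_le ⌊x⌋₊) fun _ hP => Nat.le_floor hP.2.2

/-- The ideals of norm `n`. -/
noncomputable def idealsOfNorm (n : ℕ) : Finset (Ideal (𝓞 K)) :=
  (finite_setOf_absNorm_eq K n).toFinset

/-- The nonzero prime ideals of norm at most `x`. -/
noncomputable def primesLE (x : ℝ) : Finset (Ideal (𝓞 K)) :=
  (finite_setOf_isPrime_absNorm_le K x).toFinset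

variable {K}

@[simp] lemma mem_idealsOfNorm {n : ℕ} {I : Ideal (𝓞 K)} :
    I ∈ idealsOfNorm K n ↔ I ≠ ⊥ ∧ absNorm I = n := by simp [idealsOfNorm]

@[simp] lemma mem_primesLE {x : ℝ} {P : Ideal (𝓞 K)} :
    P ∈ primesLE K x ↔ P.IsPrime ∧ P ≠ ⊥ ∧ (absNorm P : ℝ) ≤ x := by simp [primesLE]

lemma card_idealsOfNorm (n : ℕ) : (idealsOfNorm K n).card = idealCard K n := by
  rw [idealCard, ← Fintype.card_coe, ← Nat.card_eq_fintype_card]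
  exact Nat.card_congr
    { toFun := fun I => ⟨⟨I, mem_nonZeroDivisors_of_ne_zero (mem_idealsOfNorm.1 I.2).1⟩,
        (mem_idealsOfNorm.1 I.2).2⟩
      invFun := fun I => ⟨I.1, mem_idealsOfNorm.2 ⟨nonZeroDivisors.coe_ne_zero I.1, I.2⟩⟩
      left_inv := fun _ => rfl
      right_inv := fun _ => rfl }

lemma two_le_absNorm {P : Ideal (𝓞 K)} (hP : P.IsPrime) (hP0 : P ≠ ⊥) : 2 ≤ absNorm P := by
  have h0 : absNorm P ≠ 0 := by rwa [Ne, absNorm_eq_zero_iff]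
  have h1 : absNorm P ≠ 1 := by rw [Ne, absNorm_eq_one_iff]; exact hP.ne_top
  omega

open Classical in
lemma log_absNorm_eq_sum {I : Ideal (𝓞 K)} (hI : I ≠ ⊥) {n : ℕ} (hn : absNorm I ≤ n) :
    Real.log (absNorm I) = ∑ P ∈ primesLE K n, ∑ k ∈ Finset.Icc 1 n,
      if P ^ k ∣ I then Real.log (absNorm P) else 0 := by
  have h1 : Real.log (absNorm I) =
      ((normalizedFactors I).map fun P => Real.log (absNorm P)).sum := by
    have hs : ∀ s : Multiset (Ideal (𝓞 K)), (∀ P ∈ s, P ≠ ⊥) →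
        Real.log (absNorm s.prod) = (s.map fun P => Real.log (absNorm P)).sum := by
      intro s
      induction s using Multiset.induction_on with
      | empty => simp
      | cons P s ih =>
        intro h
        have h2 : s.prod ≠ ⊥ := Multiset.prod_ne_zero fun h0 =>
          h ⊥ (Multiset.mem_cons_of_mem h0) rfl
        have h3 := h P (Multiset.mem_cons_self P s)
        rw [Multiset.prod_cons, Multiset.map_cons, Multiset.sum_cons, _root_.map_mul, Nat.cast_mul,
          Real.log_mul, ih fun Q hQ => h Q (Multiset.mem_cons_of_mem hQ)]
        · rwa [Nat.cast_ne_zero, Ne, absNorm_eq_zero_iff]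
        · rwa [Nat.cast_ne_zero, Ne, absNorm_eq_zero_iff]
    rw [← hs _ fun P hP => (prime_of_normalized_factor P hP).ne_zero,
      Ideal.prod_normalizedFactors_eq_self hI]
  have hdvd : ∀ P ∈ normalizedFactors I, absNorm P ≤ n := fun P hP =>
    (Nat.le_of_dvd (Nat.pos_of_ne_zero (by rwa [Ne, absNorm_eq_zero_iff]))
      (_root_.map_dvd absNorm (dvd_of_mem_normalizedFactors hP))).trans hn
  rw [h1, Finset.sum_multiset_map_count, Finset.sum_subset (s₂ := primesLE K n)]
  · refine Finset.sum_congr rfl fun P hP => ?_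
    rw [mem_primesLE] at hP
    have hirr : Irreducible P := (prime_of_isPrime hP.2.1 hP.1).irreducible
    have h2 : ∀ k : ℕ, P ^ k ∣ I ↔ k ≤ (normalizedFactors I).count P := by
      intro k
      rw [pow_dvd_iff_le_emultiplicity, emultiplicity_eq_count_normalizedFactors hirr hI,
        normalize_eq, Nat.cast_le]
    simp_rw [h2]
    rw [← Finset.sum_filter, Finset.sum_const]
    congr 1
    have h3 : (normalizedFactors I).count P ≤ n := by
      have h4 : P ^ (normalizedFactors I).count P ∣ I := (h2 _).2 le_rfl
      have h5 := Nat.le_of_dvd (Nat.pos_of_ne_zero (by rwa [Ne, absNorm_eq_zero_iff]))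
        (_root_.map_dvd absNorm h4)
      rw [map_pow] at h5
      have h6 := Nat.pow_le_pow_left (two_le_absNorm hP.1 hP.2.1) ((normalizedFactors I).count P)
      exact (Nat.lt_two_pow_self.le).trans (h6.trans (h5.trans hn))
    have h7 : Finset.filter (fun k => k ≤ (normalizedFactors I).count P) (Finset.Icc 1 n) =
        Finset.Icc 1 ((normalizedFactors I).count P) := by
      ext k; simp; omega
    rw [h7]; simp
  · intro P hP
    rw [Multiset.mem_toFinset] at hP
    have := prime_of_normalized_factor P hP
    exact mem_primesLE.2 ⟨isPrime_of_prime this, this.ne_zero, by exact_mod_cast hdvd P hP⟩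
  · intro P _ hP
    rw [Multiset.mem_toFinset] at hP
    rw [Multiset.count_eq_zero_of_notMem hP, zero_smul]

variable (K) in
/-- The von Mangoldt function of `K`, summed over all ideals of a given norm. -/
noncomputable def idealVonMangoldt (n : ℕ) : ℝ :=
  ∑ P ∈ primesLE K n, ∑ k ∈ Finset.Icc 1 n, if absNorm P ^ k = n then Real.log (absNorm P) else 0

lemma idealVonMangoldt_eq {m n : ℕ} (hm : m ≠ 0) (hmn : m ≤ n) : idealVonMangoldt K m =
    ∑ P ∈ primesLE K n, ∑ k ∈ Finset.Icc 1 n,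
      if absNorm P ^ k = m then Real.log (absNorm P) else 0 := by
  have hmn' : (m : ℝ) ≤ n := by exact_mod_cast hmn
  rw [idealVonMangoldt, Finset.sum_subset (s₂ := primesLE K n)]
  · refine Finset.sum_congr rfl fun P hP => Finset.sum_subset (Finset.Icc_subset_Icc_right hmn) ?_
    intro k hk hk'
    rw [mem_primesLE] at hP
    rw [if_neg]
    rintro rfl
    simp only [Finset.mem_Icc, not_and, not_le] at hk hk'
    have h6 := Nat.pow_le_pow_left (two_le_absNorm hP.1 hP.2.1) k
    have := Nat.lt_two_pow_self (n := k)
    have := hk' hk.1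
    omega
  · intro P hP
    rw [mem_primesLE] at hP ⊢
    exact ⟨hP.1, hP.2.1, hP.2.2.trans hmn'⟩
  · intro P hP hP'
    rw [mem_primesLE] at hP hP'
    refine Finset.sum_eq_zero fun k hk => ?_
    rw [if_neg]
    rintro rfl
    refine hP' ⟨hP.1, hP.2.1, ?_⟩
    rw [Finset.mem_Icc] at hk
    have h0 : absNorm P ≠ 0 := by have := two_le_absNorm hP.1 hP.2.1; omega
    exact_mod_cast Nat.le_self_pow (by omega) _

lemma card_filter_dvd (J : Ideal (𝓞 K)) (hJ : J ≠ ⊥) {n : ℕ} (hn : n ≠ 0) [DecidablePred (J ∣ ·)] :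
    ((idealsOfNorm K n).filter (J ∣ ·)).card =
      ∑ p ∈ n.divisorsAntidiagonal, if absNorm J = p.2 then idealCard K p.1 else 0 := by
  have hJ0 : absNorm J ≠ 0 := by rwa [Ne, absNorm_eq_zero_iff]
  by_cases hd : absNorm J ∣ n
  · obtain ⟨m, rfl⟩ := hd
    have hm : m ≠ 0 := right_ne_zero_of_mul hn
    rw [Finset.sum_eq_single (m, absNorm J), if_pos rfl, ← card_idealsOfNorm]
    · symm
      refine Finset.card_bij (fun I _ => J * I) ?_ ?_ ?_
      · intro I hI
        rw [mem_idealsOfNorm] at hI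
        rw [Finset.mem_filter, mem_idealsOfNorm, _root_.map_mul, hI.2]
        exact ⟨⟨mul_ne_zero hJ hI.1, rfl⟩, dvd_mul_right _ _⟩
      · intro I _ I' _ h
        exact mul_left_cancel₀ hJ h
      · intro I hI
        rw [Finset.mem_filter, mem_idealsOfNorm] at hI
        obtain ⟨⟨h1, h2⟩, I', rfl⟩ := hI
        refine ⟨I', ?_, rfl⟩
        rw [_root_.map_mul] at h2
        exact mem_idealsOfNorm.2 ⟨right_ne_zero_of_mul h1, mul_left_cancel₀ hJ0 h2⟩
    · rintro ⟨p, q⟩ hpq hne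
      rw [Nat.mem_divisorsAntidiagonal] at hpq
      rw [if_neg]
      rintro h
      simp only at h
      subst h
      apply hne
      have : p = m := by
        have := hpq.1
        simp only at this
        rw [mul_comm] at this
        exact mul_left_cancel₀ hJ0 this
      rw [this]
    · intro h
      exact absurd (Nat.mem_divisorsAntidiagonal.2 ⟨mul_comm _ _, hn⟩) h
  · rw [Finset.sum_eq_zero, Finset.card_eq_zero, Finset.filter_eq_empty_iff]
    · intro I hI h
      rw [mem_idealsOfNorm] at hI
      exact hd (hI.2 ▸ _root_.map_dvd absNorm h)
    · rintro ⟨p, q⟩ hpq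
      rw [Nat.mem_divisorsAntidiagonal] at hpq
      rw [if_neg]
      rintro h
      exact hd ⟨p, by rw [← hpq.1, h, mul_comm]⟩

theorem isVonMangoldt_idealVonMangoldt :
    IsVonMangoldt (fun n => (idealCard K n : ℝ)) (idealVonMangoldt K) where
  nonneg n := Finset.sum_nonneg fun P _ => Finset.sum_nonneg fun k _ => by
    split_ifs
    · exact Real.log_natCast_nonneg _
    · exact le_rfl
  map_zero := by simp [idealVonMangoldt]
  convolution n := by
    classical
    rcases eq_or_ne n 0 with rfl | hn
    · simp
    have h1 : (idealCard K n : ℝ) * Real.log n =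
        ∑ I ∈ idealsOfNorm K n, Real.log (absNorm I) := by
      rw [← card_idealsOfNorm, ← nsmul_eq_mul, ← Finset.sum_const]
      exact Finset.sum_congr rfl fun I hI => by rw [(mem_idealsOfNorm.1 hI).2]
    rw [h1, Finset.sum_congr rfl fun I hI => log_absNorm_eq_sum (mem_idealsOfNorm.1 hI).1
      (mem_idealsOfNorm.1 hI).2.le, Finset.sum_comm,
      Finset.sum_congr rfl fun p hp => by
        rw [idealVonMangoldt_eq (n := n) (Nat.ne_zero_of_mem_divisorsAntidiagonal hp).2
          (Nat.divisor_le (Nat.snd_mem_divisors_of_mem_antidiagonal hp)), Finset.mul_sum],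
      Finset.sum_comm]
    refine Finset.sum_congr rfl fun P hP => ?_
    simp_rw [Finset.mul_sum]
    rw [Finset.sum_comm, Finset.sum_comm (s := idealsOfNorm K n)]
    refine Finset.sum_congr rfl fun k _ => ?_
    rw [← Finset.sum_filter, Finset.sum_const, nsmul_eq_mul,
      card_filter_dvd _ (pow_ne_zero k (mem_primesLE.1 hP).2.1) hn, Nat.cast_sum, Finset.sum_mul]
    refine Finset.sum_congr rfl fun p _ => ?_
    rw [map_pow]
    split_ifs <;> simp

end VonMangoldt

section Theta
open Ideal nonZeroDivisors

variable (K : Type*) [Field K] [NumberField K]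

/-- The number of nonzero ideals of norm at most `x`. -/
noncomputable def idealCount (x : ℝ) : ℕ :=
    Set.ncard {I : Ideal (𝓞 K) | I ≠ ⊥ ∧ (absNorm I : ℝ) ≤ x}

/-- The Chebyshev theta function of `K`. -/
noncomputable def idealTheta (x : ℝ) : ℝ := ∑ P ∈ primesLE K x, Real.log (absNorm P)

lemma finite_setOf_absNorm_le (x : ℝ) : {I : Ideal (𝓞 K) | I ≠ ⊥ ∧ (absNorm I : ℝ) ≤ x}.Finite :=
  Set.Finite.subset (finite_setOfPred_absNorm_le ⌊x⌋₊) fun _ hP => Nat.le_floor hP.2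

lemma idealCount_eq (x : ℝ) :
    idealCount K x = Nat.card {I : (Ideal (𝓞 K))⁰ // (absNorm (I : Ideal (𝓞 K)) : ℝ) ≤ x} := by
  rw [idealCount, ← Nat.card_coe_set_eq]
  exact Nat.card_congr
    { toFun := fun I => ⟨⟨I, mem_nonZeroDivisors_of_ne_zero I.2.1⟩, I.2.2⟩
      invFun := fun I => ⟨I.1, nonZeroDivisors.coe_ne_zero I.1, I.2⟩
      left_inv := fun _ => rfl
      right_inv := fun _ => rfl }

lemma one_le_idealCount {x : ℝ} (hx : 1 ≤ x) : 1 ≤ idealCount K x := by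
  rw [idealCount, Nat.one_le_iff_ne_zero, Ne, Set.ncard_eq_zero (finite_setOf_absNorm_le K x),
    ← Ne, ← Set.nonempty_iff_ne_empty]
  exact ⟨⊤, top_ne_bot, by simpa using hx⟩

lemma idealCard_one : idealCard K 1 = 1 := by
  rw [← card_idealsOfNorm, Finset.card_eq_one]
  refine ⟨⊤, ?_⟩
  ext I
  rw [mem_idealsOfNorm, Finset.mem_singleton, absNorm_eq_one_iff]
  constructor
  · exact fun h => h.2
  · rintro rfl; exact ⟨top_ne_bot, rfl⟩

lemma exists_powerSaving : ∃ κ C δ : ℝ, PowerSaving (fun n => (idealCard K n : ℝ)) κ C δ := by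
  obtain ⟨κ, C, δ, hκ, hδ, hδ1, h⟩ := exists_sum_idealCard_sub_le K
  exact ⟨κ, C, δ, fun n => Nat.cast_nonneg _, by simp [idealCard_zero], by simp [idealCard_one],
    hκ, hδ, hδ1, h⟩

lemma exists_idealCount_le : ∃ c C : ℝ, 0 < c ∧ 0 < C ∧ ∀ x : ℝ, 1 ≤ x →
    c * x ≤ idealCount K x ∧ idealCount K x ≤ C * x := by
  obtain ⟨κ, C, δ, hκ, hδ, hδ1, h⟩ := exists_sum_idealCard_sub_le K
  have hC : 0 ≤ C := by
    have := (abs_nonneg _).trans (h 1 le_rfl)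
    simpa using this
  obtain ⟨X, hX1, hX⟩ : ∃ X : ℝ, 1 ≤ X ∧ ∀ x, X ≤ x → C * x ^ (-δ) ≤ κ / 2 := by
    have h1 := ((tendsto_rpow_neg_atTop hδ).const_mul C)
    rw [mul_zero] at h1
    have h2 := (h1.eventually (gt_mem_nhds (show 0 < κ / 2 by positivity))).and
      (Filter.eventually_ge_atTop 1)
    obtain ⟨X, hX⟩ := Filter.eventually_atTop.1 h2
    exact ⟨max X 1, le_max_right _ _, fun x hx => (hX x ((le_max_left _ _).trans hx)).1.le⟩
  have hXi : 0 < X⁻¹ := by positivity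
  refine ⟨min (κ / 2) X⁻¹, κ + C, lt_min (by positivity) hXi, by positivity, fun x hx => ?_⟩
  have hx0 : 0 < x := by linarith
  have h1 := h x hx
  rw [sum_idealCard K x hx0.le, ← idealCount_eq] at h1
  have h2 := abs_le.1 h1
  constructor
  · rcases le_total X x with h3 | h3
    · have h4 : x ^ (1 - δ) = x * x ^ (-δ) := by
        rw [sub_eq_add_neg, Real.rpow_add hx0, Real.rpow_one]
      have h5 := hX x h3
      have h6 : min (κ / 2) X⁻¹ * x ≤ κ / 2 * x := by gcongr; exact min_le_left _ _
      have h7 : C * x ^ (1 - δ) ≤ κ / 2 * x := by rw [h4]; nlinarith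
      linarith [h2.1]
    · have h6 : min (κ / 2) X⁻¹ * x ≤ X⁻¹ * X := by gcongr; exact min_le_right _ _
      rw [inv_mul_cancel₀ (by linarith)] at h6
      exact h6.trans (by exact_mod_cast one_le_idealCount K hx)
  · have h4 : x ^ (1 - δ) ≤ x := by
      calc x ^ (1 - δ) ≤ x ^ (1 : ℝ) := Real.rpow_le_rpow_of_exponent_le hx (by linarith)
        _ = x := Real.rpow_one x
    nlinarith [h2.2]

lemma card_primesLE_le (x : ℝ) : (primesLE K x).card ≤ idealCount K x := by
  rw [idealCount, ← Set.ncard_coe_finset]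
  refine Set.ncard_le_ncard (fun P hP => ?_) (finite_setOf_absNorm_le K x)
  exact (mem_primesLE.1 hP).2

lemma one_add_log_pow_three_le {x : ℝ} (hx : 1 ≤ x) :
    Real.log x * (1 + Real.log x) ^ 2 ≤ 343 * √x := by
  have hx0 : 0 < x := by linarith
  have h1 := Real.log_le_rpow_div hx0.le (show (0 : ℝ) < 1 / 6 by norm_num)
  have h2 : 1 ≤ x ^ (1 / 6 : ℝ) := Real.one_le_rpow hx (by norm_num)
  have h3 := Real.log_nonneg hx
  have h4 : Real.log x ≤ 7 * x ^ (1 / 6 : ℝ) := by linarith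
  have h5 : 1 + Real.log x ≤ 7 * x ^ (1 / 6 : ℝ) := by linarith
  calc _ ≤ 7 * x ^ (1 / 6 : ℝ) * (7 * x ^ (1 / 6 : ℝ)) ^ 2 := by gcongr
    _ = 343 * (x ^ (1 / 6 : ℝ)) ^ 3 := by ring
    _ = _ := by
      rw [← Real.rpow_natCast, ← Real.rpow_mul hx0.le, Real.sqrt_eq_rpow]; norm_num

variable {K} in
lemma sum_pow_le {P : Ideal (𝓞 K)} (hP : P.IsPrime) (hP0 : P ≠ ⊥) {x : ℝ} (hx : 1 ≤ x) :
    (∑ k ∈ Finset.Icc 1 ⌊x⌋₊, ∑ n ∈ Finset.range (⌊x⌋₊ + 1),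
      if absNorm P ^ k = n then Real.log (absNorm P) else 0) ≤
    Real.log (absNorm P) + if (absNorm P : ℝ) ≤ √x then Real.log x else 0 := by
  have hx0 : 0 < x := by linarith
  have h2 := two_le_absNorm hP hP0
  have h2' : (2 : ℝ) ≤ absNorm P := by exact_mod_cast h2
  have hl : 0 < Real.log (absNorm P) := Real.log_pos (by linarith)
  have e : ∀ k : ℕ, (∑ n ∈ Finset.range (⌊x⌋₊ + 1),
      if absNorm P ^ k = n then Real.log (absNorm P) else 0) =
      if (absNorm P : ℝ) ^ k ≤ x then Real.log (absNorm P) else 0 := by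
    intro k
    rw [Finset.sum_ite_eq]
    congr 1
    rw [Finset.mem_range, Nat.lt_succ_iff, Nat.le_floor_iff hx0.le, Nat.cast_pow]
  simp_rw [e]
  rw [← Finset.sum_filter, Finset.sum_const, nsmul_eq_mul]
  set S := Finset.filter (fun k => (absNorm P : ℝ) ^ k ≤ x) (Finset.Icc 1 ⌊x⌋₊) with hS
  split_ifs with h
  · have h3 : S ⊆ Finset.Icc 1 ⌊Real.log x / Real.log (absNorm P)⌋₊ := by
      intro k hk
      rw [hS, Finset.mem_filter, Finset.mem_Icc] at hk
      rw [Finset.mem_Icc]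
      refine ⟨hk.1.1, Nat.le_floor ?_⟩
      rw [le_div_iff₀ hl, ← Real.log_pow]
      exact Real.log_le_log (by positivity) hk.2
    have h4 := Finset.card_le_card h3
    rw [Nat.card_Icc, Nat.add_sub_cancel] at h4
    have h5 : (S.card : ℝ) ≤ Real.log x / Real.log (absNorm P) :=
      (Nat.cast_le.2 h4).trans (Nat.floor_le (div_nonneg (Real.log_nonneg hx) hl.le))
    rw [le_div_iff₀ hl] at h5
    linarith
  · have h3 : S ⊆ {1} := by
      intro k hk
      rw [hS, Finset.mem_filter, Finset.mem_Icc] at hk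
      rw [Finset.mem_singleton]
      by_contra hk1
      apply h
      rw [Real.le_sqrt (by positivity) hx0.le]
      refine le_trans (pow_le_pow_right₀ (by linarith) ?_) hk.2
      omega
    have h4 := Finset.card_le_card h3
    rw [Finset.card_singleton] at h4
    have h5 : (S.card : ℝ) ≤ 1 := by exact_mod_cast h4
    rw [add_zero]
    nlinarith

/-- A one-sided prime ideal theorem. -/
theorem exists_sub_le_idealTheta : ∃ D : ℝ, 0 < D ∧ ∀ x, 1 ≤ x →
    x - D * x / (1 + Real.log x) ^ 2 ≤ idealTheta K x := by
  obtain ⟨κ, C, δ, hps⟩ := exists_powerSaving K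
  obtain ⟨D, hD, h⟩ := hps.exists_sub_le_sum_vonMangoldt isVonMangoldt_idealVonMangoldt
  obtain ⟨c, C, hc, hC, hcount⟩ := exists_idealCount_le K
  refine ⟨D + 343 * C, by positivity, fun x hx => ?_⟩
  have hx0 : 0 < x := by linarith
  have h1 : ∑ n ∈ Finset.range (⌊x⌋₊ + 1), idealVonMangoldt K n ≤
      idealTheta K x + C * √x * Real.log x := by
    have e1 : ∀ n ∈ Finset.range (⌊x⌋₊ + 1), idealVonMangoldt K n =
        ∑ P ∈ primesLE K (⌊x⌋₊ : ℕ), ∑ k ∈ Finset.Icc 1 ⌊x⌋₊,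
          if absNorm P ^ k = n then Real.log (absNorm P) else 0 := by
      intro n hn
      rcases eq_or_ne n 0 with rfl | hn0
      · rw [isVonMangoldt_idealVonMangoldt.map_zero]
        symm
        refine Finset.sum_eq_zero fun P hP => Finset.sum_eq_zero fun k _ => ?_
        rw [if_neg]
        have := two_le_absNorm (mem_primesLE.1 hP).1 (mem_primesLE.1 hP).2.1
        exact pow_ne_zero _ (by omega)
      · exact idealVonMangoldt_eq hn0 (Nat.lt_succ_iff.1 (Finset.mem_range.1 hn))
    have e2 : primesLE K (⌊x⌋₊ : ℕ) = primesLE K x := by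
      ext P
      rw [mem_primesLE, mem_primesLE, Nat.cast_le, Nat.le_floor_iff hx0.le]
    rw [Finset.sum_congr rfl e1, Finset.sum_comm, e2]
    calc _ ≤ ∑ P ∈ primesLE K x, (Real.log (absNorm P) +
          if (absNorm P : ℝ) ≤ √x then Real.log x else 0) := by
          refine Finset.sum_le_sum fun P hP => ?_
          rw [Finset.sum_comm]
          rw [mem_primesLE] at hP
          exact sum_pow_le hP.1 hP.2.1 hx
      _ = idealTheta K x + ((primesLE K x).filter fun P => (absNorm P : ℝ) ≤ √x).card *
            Real.log x := by
          rw [Finset.sum_add_distrib, ← Finset.sum_filter, Finset.sum_const, nsmul_eq_mul,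
            idealTheta]
      _ ≤ _ := by
          gcongr
          · exact Real.log_nonneg hx
          have h2 : ((primesLE K x).filter fun P => (absNorm P : ℝ) ≤ √x) ⊆ primesLE K √x := by
            intro P hP
            rw [Finset.mem_filter, mem_primesLE] at hP
            exact mem_primesLE.2 ⟨hP.1.1, hP.1.2.1, hP.2⟩
          have h3 := (Finset.card_le_card h2).trans (card_primesLE_le K √x)
          exact (Nat.cast_le.2 h3).trans (hcount √x (Real.one_le_sqrt.2 hx)).2
  have h2 := h x hx
  have hl := Real.log_nonneg hx
  have hp : 0 < (1 + Real.log x) ^ 2 := by positivity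
  have h3 : C * √x * Real.log x ≤ 343 * C * x / (1 + Real.log x) ^ 2 := by
    rw [le_div_iff₀ hp]
    have h4 := one_add_log_pow_three_le hx
    calc _ = C * √x * (Real.log x * (1 + Real.log x) ^ 2) := by ring
      _ ≤ C * √x * (343 * √x) := by gcongr
      _ = 343 * C * (√x * √x) := by ring
      _ = _ := by rw [Real.mul_self_sqrt hx0.le]
  have h5 : (D + 343 * C) * x / (1 + Real.log x) ^ 2 =
      D * x / (1 + Real.log x) ^ 2 + 343 * C * x / (1 + Real.log x) ^ 2 := by ring
  linarith

end Theta

section Psi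
open Ideal UniqueFactorizationMonoid

variable (K : Type) [Field K] [NumberField K]

/-- The nonzero ideals of norm at most `x` all of whose prime factors have norm at most `y`. -/
noncomputable def smoothIdeals (x y : ℝ) : Finset (Ideal (𝓞 K)) :=
  ((finite_setOf_absNorm_le K x).subset
    (t := {I : Ideal (𝓞 K) | I ≠ ⊥ ∧ (absNorm I : ℝ) ≤ x ∧ ∃ s : Multiset (Ideal (𝓞 K)),
      (∀ P ∈ s, P.IsPrime ∧ (absNorm P : ℝ) ≤ y) ∧ I = s.prod}) fun _ hI =>
        ⟨hI.1, hI.2.1⟩).toFinset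

variable {K}

lemma mem_smoothIdeals {x y : ℝ} {I : Ideal (𝓞 K)} : I ∈ smoothIdeals K x y ↔
    I ≠ ⊥ ∧ (absNorm I : ℝ) ≤ x ∧ ∃ s : Multiset (Ideal (𝓞 K)),
      (∀ P ∈ s, P.IsPrime ∧ (absNorm P : ℝ) ≤ y) ∧ I = s.prod := by
  simp [smoothIdeals]

lemma psiK_eq_card (x y : ℝ) : psiK K x y = (smoothIdeals K x y).card := by
  rw [psiK, ← Set.ncard_coe_finset]
  congr 1
  ext I
  rw [Finset.mem_coe, mem_smoothIdeals, Set.mem_ofPred_eq]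

lemma psiK_mono {x x' : ℝ} (h : x ≤ x') (y : ℝ) : psiK K x y ≤ psiK K x' y := by
  rw [psiK_eq_card, psiK_eq_card]
  refine Finset.card_le_card fun I hI => ?_
  rw [mem_smoothIdeals] at hI ⊢
  exact ⟨hI.1, hI.2.1.trans h, hI.2.2⟩

lemma psiK_of_le {x y : ℝ} (h : x ≤ y) : psiK K x y = idealCount K x := by
  rw [psiK, idealCount]
  congr 1
  ext I
  refine ⟨fun hI => ⟨hI.1, hI.2.1⟩, fun hI => ⟨hI.1, hI.2, normalizedFactors I, fun P hP => ?_,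
    (Ideal.prod_normalizedFactors_eq_self hI.1).symm⟩⟩
  refine ⟨isPrime_of_prime (prime_of_normalized_factor P hP), ?_⟩
  refine le_trans ?_ (hI.2.trans h)
  rw [Nat.cast_le]
  exact Nat.le_of_dvd (Nat.pos_of_ne_zero (by rw [Ne, absNorm_eq_zero_iff]; exact hI.1))
      (_root_.map_dvd absNorm (dvd_of_mem_normalizedFactors hP))

lemma one_le_psiK {x : ℝ} (hx : 1 ≤ x) (y : ℝ) : 1 ≤ psiK K x y := by
  rw [psiK_eq_card, Nat.one_le_iff_ne_zero, Finset.card_ne_zero]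
  exact ⟨1, mem_smoothIdeals.2 ⟨one_ne_zero, by simpa using hx, 0, by simp, by simp⟩⟩

lemma sum_log_mul_psiK_le (x y : ℝ) :
    ∑ P ∈ primesLE K y, Real.log (absNorm P) * psiK K (x / absNorm P) y ≤
      psiK K x y * Real.log x := by
  classical
  have h1 : ∀ I ∈ smoothIdeals K x y,
      (∑ P ∈ primesLE K y, if P ∣ I then Real.log (absNorm P) else 0) ≤ Real.log x := by
    intro I hI
    rw [mem_smoothIdeals] at hI
    have hI0 : absNorm I ≠ 0 := by rw [Ne, absNorm_eq_zero_iff]; exact hI.1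
    have h2 : Real.log (absNorm I) ≤ Real.log x :=
      Real.log_le_log (by exact_mod_cast Nat.pos_of_ne_zero hI0) hI.2.1
    refine le_trans ?_ h2
    rw [log_absNorm_eq_sum hI.1 le_rfl, ← Finset.sum_filter]
    have h3 : (primesLE K y).filter (· ∣ I) ⊆ primesLE K (absNorm I) := by
      intro P hP
      rw [Finset.mem_filter, mem_primesLE] at hP
      refine mem_primesLE.2 ⟨hP.1.1, hP.1.2.1, ?_⟩
      exact_mod_cast Nat.le_of_dvd (Nat.pos_of_ne_zero hI0) (_root_.map_dvd absNorm hP.2)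
    have h0 : ∀ P : Ideal (𝓞 K), ∀ k : ℕ, 0 ≤ if P ^ k ∣ I then Real.log (absNorm P) else 0 := by
      intro P k
      split_ifs
      · exact Real.log_natCast_nonneg _
      · exact le_rfl
    refine le_trans (Finset.sum_le_sum fun P hP => ?_) (Finset.sum_le_sum_of_subset_of_nonneg h3
      fun P _ _ => Finset.sum_nonneg fun k _ => h0 P k)
    refine le_trans ?_ (Finset.single_le_sum (f := fun k => if P ^ k ∣ I then Real.log (absNorm P)
      else 0) (fun k _ => h0 P k) (Finset.mem_Icc.2 ⟨le_rfl, Nat.pos_of_ne_zero hI0⟩))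
    simp only [pow_one]
    rw [if_pos (Finset.mem_filter.1 hP).2]
  calc _ ≤ ∑ P ∈ primesLE K y, ∑ I ∈ smoothIdeals K x y,
        if P ∣ I then Real.log (absNorm P) else 0 := by
        refine Finset.sum_le_sum fun P hP => ?_
        rw [mem_primesLE] at hP
        rw [← Finset.sum_filter, Finset.sum_const, nsmul_eq_mul, mul_comm]
        refine mul_le_mul_of_nonneg_right ?_ (Real.log_natCast_nonneg _)
        rw [psiK_eq_card, Nat.cast_le]
        have hN : (0 : ℝ) < absNorm P := by
          have := two_le_absNorm hP.1 hP.2.1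
          exact_mod_cast (by omega : 0 < absNorm P)
        refine Finset.card_le_card_of_injOn (fun J => P * J) (fun J hJ => ?_)
          (fun J _ J' _ h => mul_left_cancel₀ hP.2.1 h)
        rw [Finset.mem_coe, mem_smoothIdeals] at hJ
        obtain ⟨h1, h2, s, hs, rfl⟩ := hJ
        rw [Finset.mem_coe, Finset.mem_filter, mem_smoothIdeals]
        refine ⟨⟨mul_ne_zero hP.2.1 h1, ?_, P ::ₘ s, ?_, (Multiset.prod_cons _ _).symm⟩,
          dvd_mul_right _ _⟩
        · rw [le_div_iff₀ hN] at h2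
          rw [_root_.map_mul, Nat.cast_mul, mul_comm]
          exact h2
        · intro Q hQ
          rcases Multiset.mem_cons.1 hQ with rfl | hQ
          · exact ⟨hP.1, hP.2.2⟩
          · exact hs Q hQ
    _ = ∑ I ∈ smoothIdeals K x y, ∑ P ∈ primesLE K y,
        if P ∣ I then Real.log (absNorm P) else 0 := Finset.sum_comm
    _ ≤ ∑ I ∈ smoothIdeals K x y, Real.log x := Finset.sum_le_sum h1
    _ = _ := by rw [Finset.sum_const, nsmul_eq_mul, psiK_eq_card]

variable (K) in
lemma exists_sum_log_div_absNorm_le : ∃ M : ℝ, 0 < M ∧ ∀ z : ℝ, 1 ≤ z →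
    ∑ P ∈ primesLE K z, Real.log (absNorm P) / absNorm P ≤ M * Real.log z := by
  obtain ⟨c, C, hc, hC, h⟩ := exists_idealCount_le K
  refine ⟨C / c, by positivity, fun z hz => ?_⟩
  have hz0 : 0 < z := by linarith
  have h1 := sum_log_mul_psiK_le (K := K) z z
  rw [psiK_of_le le_rfl] at h1
  have h2 : c * z * ∑ P ∈ primesLE K z, Real.log (absNorm P) / absNorm P ≤
      ∑ P ∈ primesLE K z, Real.log (absNorm P) * psiK K (z / absNorm P) z := by
    rw [Finset.mul_sum]
    refine Finset.sum_le_sum fun P hP => ?_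
    rw [mem_primesLE] at hP
    have h2 := two_le_absNorm hP.1 hP.2.1
    have hN : (1 : ℝ) ≤ absNorm P := by exact_mod_cast (by omega : 1 ≤ absNorm P)
    have hN0 : (0 : ℝ) < absNorm P := by linarith
    rw [psiK_of_le (div_le_self hz0.le hN)]
    calc _ = Real.log (absNorm P) * (c * (z / absNorm P)) := by field_simp
      _ ≤ _ := mul_le_mul_of_nonneg_left (h _ ((one_le_div hN0).2 hP.2.2)).1
          (Real.log_natCast_nonneg _)
  have h3 : (idealCount K z : ℝ) * Real.log z ≤ C * z * Real.log z :=
    mul_le_mul_of_nonneg_right (h z hz).2 (Real.log_nonneg hz)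
  have h4 := h2.trans (h1.trans h3)
  rw [div_mul_eq_mul_div, le_div_iff₀ hc]
  refine le_of_mul_le_mul_left ?_ hz0
  linarith

end Psi

section Partial
open Ideal MeasureTheory

lemma rpow_sub_one_eq_add_integral {n y β : ℝ} (hn : 0 < n) (hy : n ≤ y) :
    n ^ (β - 1) = y ^ (β - 1) + (1 - β) * ∫ t in n..y, t ^ (β - 2) := by
  have h : ∫ t in n..y, (1 - β) * t ^ (β - 2) = -y ^ (β - 1) - -n ^ (β - 1) := by
    refine intervalIntegral.integral_eq_sub_of_hasDerivAt (f := fun t => -t ^ (β - 1))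
      (fun t ht => ?_) ?_
    · rw [Set.uIcc_of_le hy] at ht
      have := (Real.hasDerivAt_rpow_const (p := β - 1) (Or.inl (hn.trans_le ht.1).ne')).neg
      refine this.congr_deriv ?_
      rw [show β - 1 - 1 = β - 2 by ring]
      ring
    · refine ContinuousOn.intervalIntegrable fun t ht => ?_
      rw [Set.uIcc_of_le hy] at ht
      exact (continuousAt_const.mul (Real.continuousAt_rpow_const _ _
        (Or.inl (hn.trans_le ht.1).ne'))).continuousWithinAt
  rw [intervalIntegral.integral_const_mul] at h
  linarith

lemma rpow_div_one_add_log_sq_le {y β t : ℝ} (hy : 1 < y) (hβ : 0 < β) (ht : 1 ≤ t) :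
    t ^ (β - 1) / (1 + Real.log t) ^ 2 ≤
      y ^ (β / 2) * (t⁻¹ / (1 + Real.log t) ^ 2) + 4 / Real.log y ^ 2 * t ^ (β - 1) := by
  have hL : 0 < Real.log y := Real.log_pos hy
  have ht0 : 0 < t := by linarith
  have hlt : 0 ≤ Real.log t := Real.log_nonneg ht
  have hb : 0 < t ^ (β - 1) := Real.rpow_pos_of_pos ht0 _
  have hy0 : 0 < y ^ (β / 2) := Real.rpow_pos_of_pos (by linarith) _
  rcases le_total (Real.log t) (Real.log y / 2) with h | h
  · have h1 : t ^ (β - 1) ≤ y ^ (β / 2) * t⁻¹ := by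
      rw [Real.rpow_sub_one ht0.ne', div_eq_mul_inv]
      refine mul_le_mul_of_nonneg_right ?_ (by positivity)
      rw [Real.rpow_def_of_pos ht0, Real.rpow_def_of_pos (by linarith : 0 < y)]
      refine Real.exp_le_exp.2 ?_
      nlinarith
    have h2 : t ^ (β - 1) / (1 + Real.log t) ^ 2 ≤
        y ^ (β / 2) * t⁻¹ / (1 + Real.log t) ^ 2 := by gcongr
    rw [← mul_div_assoc]
    have : 0 ≤ 4 / Real.log y ^ 2 * t ^ (β - 1) := by positivity
    linarith
  · have h1 : t ^ (β - 1) / (1 + Real.log t) ^ 2 ≤ t ^ (β - 1) / (Real.log y / 2) ^ 2 := by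
      gcongr
      linarith
    have h2 : t ^ (β - 1) / (Real.log y / 2) ^ 2 = 4 / Real.log y ^ 2 * t ^ (β - 1) := by
      field_simp
      norm_num
    have : 0 ≤ y ^ (β / 2) * (t⁻¹ / (1 + Real.log t) ^ 2) := by positivity
    linarith

variable (K : Type) [Field K] [NumberField K]

lemma sum_log_mul_rpow_eq {y : ℝ} (hy : 1 < y) (β : ℝ) :
    ∑ P ∈ primesLE K y, Real.log (absNorm P) * (absNorm P : ℝ) ^ (β - 1) =
      idealTheta K y * y ^ (β - 1) + (1 - β) * ∫ t in 1..y, idealTheta K t * t ^ (β - 2) ∧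
    IntervalIntegrable (fun t => idealTheta K t * t ^ (β - 2)) volume 1 y := by
  classical
  have hN : ∀ P ∈ primesLE K y, (1 : ℝ) ≤ absNorm P ∧ (absNorm P : ℝ) ≤ y := by
    intro P hP
    rw [mem_primesLE] at hP
    have := two_le_absNorm hP.1 hP.2.1
    exact ⟨by exact_mod_cast (by omega : 1 ≤ absNorm P), hP.2.2⟩
  have hg : IntervalIntegrable (fun t : ℝ => t ^ (β - 2)) volume 1 y := by
    refine ContinuousOn.intervalIntegrable fun t ht => ?_
    rw [Set.uIcc_of_le hy.le] at ht
    exact (Real.continuousAt_rpow_const _ _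
      (Or.inl (by linarith [ht.1]))).continuousWithinAt
  set f : Ideal (𝓞 K) → ℝ → ℝ := fun P =>
    (Set.Ici (absNorm P : ℝ)).indicator (fun t => t ^ (β - 2)) with hf
  have hfi : ∀ P, IntervalIntegrable (f P) volume 1 y := by
    intro P
    rw [intervalIntegrable_iff] at hg ⊢
    exact hg.indicator measurableSet_Ici
  have hfv : ∀ P ∈ primesLE K y, ∫ t in 1..y, f P t = ∫ t in (absNorm P : ℝ)..y, t ^ (β - 2) := by
    intro P hP
    obtain ⟨h1, h2⟩ := hN P hP
    rw [intervalIntegral.integral_of_le hy.le, intervalIntegral.integral_of_le h2,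
      integral_indicator measurableSet_Ici, Measure.restrict_restrict measurableSet_Ici]
    refine setIntegral_congr_set ?_
    have h3 : (Set.Ici (absNorm P : ℝ) : Set ℝ) =ᵐ[volume] Set.Ioi (absNorm P : ℝ) :=
      Ioi_ae_eq_Ici.symm
    have h4 : Set.Ioc (absNorm P : ℝ) y = Set.Ioi (absNorm P : ℝ) ∩ Set.Ioc 1 y := by
      ext t
      simp only [Set.mem_Ioc, Set.mem_inter_iff, Set.mem_Ioi]
      exact ⟨fun h => ⟨h.1, by linarith, h.2⟩, fun h => ⟨h.1, h.2.2⟩⟩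
    rw [h4]
    exact h3.inter (Filter.EventuallyEq.refl _ _)
  have hθ : Set.EqOn (fun t => ∑ P ∈ primesLE K y, Real.log (absNorm P) * f P t)
      (fun t => idealTheta K t * t ^ (β - 2)) (Set.uIcc 1 y) := by
    intro t ht
    rw [Set.uIcc_of_le hy.le] at ht
    have h5 : primesLE K t = (primesLE K y).filter fun P => (absNorm P : ℝ) ≤ t := by
      ext P
      rw [Finset.mem_filter, mem_primesLE, mem_primesLE]
      exact ⟨fun h => ⟨⟨h.1, h.2.1, h.2.2.trans ht.2⟩, h.2.2⟩, fun h => ⟨h.1.1, h.1.2.1, h.2⟩⟩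
    simp only [idealTheta]
    rw [h5, Finset.sum_filter, Finset.sum_mul]
    refine Finset.sum_congr rfl fun P _ => ?_
    simp only [hf, Set.indicator_apply, Set.mem_Ici]
    split_ifs <;> simp
  have hi : IntervalIntegrable (fun t => ∑ P ∈ primesLE K y, Real.log (absNorm P) * f P t)
      volume 1 y := by
    have := IntervalIntegrable.sum (primesLE K y) (f := fun P t => Real.log (absNorm P) * f P t)
      (μ := volume) (a := 1) (b := y) fun P _ => (hfi P).const_mul _
    refine this.congr fun t _ => ?_
    simp
  constructor
  · rw [← intervalIntegral.integral_congr hθ, intervalIntegral.integral_finsetSum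
      fun P _ => (hfi P).const_mul _, idealTheta, Finset.sum_mul, Finset.mul_sum,
      ← Finset.sum_add_distrib]
    refine Finset.sum_congr rfl fun P hP => ?_
    obtain ⟨h1, h2⟩ := hN P hP
    rw [intervalIntegral.integral_const_mul, hfv P hP,
      rpow_sub_one_eq_add_integral (by linarith) h2 (β := β)]
    ring
  · refine hi.congr fun t ht => hθ (Set.uIoc_subset_uIcc ht)

lemma exists_le_sum_log_mul_rpow : ∃ E : ℝ, 0 < E ∧ ∀ y β : ℝ, 1 < y → 0 < β → β ≤ 1 →
    (y ^ β - 1) / β - E * y ^ β / (β * Real.log y ^ 2) - E * y ^ (β / 2) ≤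
      ∑ P ∈ primesLE K y, Real.log (absNorm P) * (absNorm P : ℝ) ^ (β - 1) := by
  obtain ⟨D, hD, hθ⟩ := exists_sub_le_idealTheta K
  refine ⟨5 * D, by positivity, fun y β hy hβ hβ1 => ?_⟩
  obtain ⟨hsum, hθint⟩ := sum_log_mul_rpow_eq K hy β
  have hL : 0 < Real.log y := Real.log_pos hy
  have hy0 : 0 < y := by linarith
  have hyβ : 1 ≤ y ^ β := Real.one_le_rpow hy.le hβ.le
  have hyβ2 : 1 ≤ y ^ (β / 2) := Real.one_le_rpow hy.le (by positivity)
  set b : ℝ → ℝ := fun t => (1 - 4 * D / Real.log y ^ 2) * t ^ (β - 1) -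
    D * y ^ (β / 2) * (t⁻¹ / (1 + Real.log t) ^ 2) with hb
  have hpos : ∀ t ∈ Set.Icc 1 y, 0 < t ∧ 0 < 1 + Real.log t := fun t ht =>
    ⟨by linarith [ht.1], by linarith [Real.log_nonneg ht.1]⟩
  have hbc : ContinuousOn b (Set.Icc 1 y) := by
    intro t ht
    obtain ⟨h1, h2⟩ := hpos t ht
    refine ContinuousAt.continuousWithinAt ?_
    have h3 : ContinuousAt (fun t : ℝ => t ^ (β - 1)) t :=
      Real.continuousAt_rpow_const _ _ (Or.inl h1.ne')
    have h4 : ContinuousAt Real.log t := Real.continuousAt_log h1.ne'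
    refine (continuousAt_const.mul h3).sub (continuousAt_const.mul
      ((continuousAt_inv₀ h1.ne').div ((continuousAt_const.add h4).pow 2) (by positivity)))
  have hbi : IntervalIntegrable b volume 1 y := by
    refine ContinuousOn.intervalIntegrable ?_
    rwa [Set.uIcc_of_le hy.le]
  have hbv : ∫ t in 1..y, b t = ((1 - 4 * D / Real.log y ^ 2) * (y ^ β / β) +
      D * y ^ (β / 2) * (1 + Real.log y)⁻¹) - ((1 - 4 * D / Real.log y ^ 2) * ((1 : ℝ) ^ β / β) +
      D * y ^ (β / 2) * (1 + Real.log 1)⁻¹) := by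
    refine intervalIntegral.integral_eq_sub_of_hasDerivAt
      (f := fun t => (1 - 4 * D / Real.log y ^ 2) * (t ^ β / β) +
      D * y ^ (β / 2) * (1 + Real.log t)⁻¹) (fun t ht => ?_) hbi
    rw [Set.uIcc_of_le hy.le] at ht
    obtain ⟨h1, h2⟩ := hpos t ht
    have h3 := (Real.hasDerivAt_rpow_const (p := β) (Or.inl h1.ne')).div_const β
    have h4 := ((Real.hasDerivAt_log h1.ne').const_add 1).inv h2.ne'
    refine ((h3.const_mul (1 - 4 * D / Real.log y ^ 2)).add
      (h4.const_mul (D * y ^ (β / 2)))).congr_deriv ?_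
    simp only [hb]
    field_simp
    ring
  have hmono : ∫ t in 1..y, b t ≤ ∫ t in 1..y, idealTheta K t * t ^ (β - 2) := by
    refine intervalIntegral.integral_mono_on hy.le hbi hθint fun t ht => ?_
    obtain ⟨h1, h2⟩ := hpos t ht
    have h3 := rpow_div_one_add_log_sq_le hy hβ ht.1
    have h4 : t ^ (β - 1) = t * t ^ (β - 2) := by
      rw [show β - 1 = 1 + (β - 2) by ring, Real.rpow_add h1, Real.rpow_one]
    have h5 : (t - D * t / (1 + Real.log t) ^ 2) * t ^ (β - 2) ≤ idealTheta K t * t ^ (β - 2) :=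
      mul_le_mul_of_nonneg_right (hθ t ht.1) (Real.rpow_nonneg h1.le _)
    refine le_trans ?_ h5
    have h6 : (t - D * t / (1 + Real.log t) ^ 2) * t ^ (β - 2) =
        t ^ (β - 1) - D * (t ^ (β - 1) / (1 + Real.log t) ^ 2) := by
      rw [h4]
      ring
    rw [h6]
    have h7 := mul_le_mul_of_nonneg_left h3 hD.le
    simp only [hb]
    have h8 : 4 * D / Real.log y ^ 2 * t ^ (β - 1) =
        D * (4 / Real.log y ^ 2 * t ^ (β - 1)) := by ring
    nlinarith
  rw [hsum]
  have h1 : y ^ β - D * (y ^ β / Real.log y ^ 2) ≤ idealTheta K y * y ^ (β - 1) := by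
    have h2 := mul_le_mul_of_nonneg_right (hθ y hy.le) (Real.rpow_nonneg hy0.le (β - 1))
    refine le_trans ?_ h2
    have h3 : y ^ β = y * y ^ (β - 1) := by
      rw [show β = 1 + (β - 1) by ring, Real.rpow_add hy0, Real.rpow_one]
      ring_nf
    have h4 : (y - D * y / (1 + Real.log y) ^ 2) * y ^ (β - 1) =
        y ^ β - D * (y ^ β / (1 + Real.log y) ^ 2) := by rw [h3]; ring
    rw [h4]
    have h5 : y ^ β / (1 + Real.log y) ^ 2 ≤ y ^ β / Real.log y ^ 2 := by
      gcongr
      linarith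
    nlinarith
  have h2 : (1 - β) * ∫ t in 1..y, b t ≤ (1 - β) * ∫ t in 1..y, idealTheta K t * t ^ (β - 2) :=
    mul_le_mul_of_nonneg_left hmono (by linarith)
  have h3 : (y ^ β - 1) / β - 4 * D * (y ^ β / (β * Real.log y ^ 2)) - D * y ^ (β / 2) ≤
      ∫ t in 1..y, b t := by
    rw [hbv, Real.one_rpow, Real.log_one]
    have h4 : 0 ≤ D * y ^ (β / 2) * (1 + Real.log y)⁻¹ := by positivity
    have h5 : 0 ≤ 4 * D / Real.log y ^ 2 / β := by positivity
    have h6 : (1 - 4 * D / Real.log y ^ 2) * (y ^ β / β) - (1 - 4 * D / Real.log y ^ 2) * (1 / β) =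
      (y ^ β - 1) / β - 4 * D * (y ^ β / (β * Real.log y ^ 2)) + 4 * D / Real.log y ^ 2 / β := by
      field_simp
      ring
    simp only [add_zero, inv_one, mul_one]
    linarith
  have h4 := mul_le_mul_of_nonneg_left h3 (by linarith : 0 ≤ 1 - β)
  have h5 : 0 ≤ D * (y ^ β / (β * Real.log y ^ 2)) := by positivity
  have h6 : y ^ β / Real.log y ^ 2 = β * (y ^ β / (β * Real.log y ^ 2)) := by field_simp
  have h7 : (1 - β) * ((y ^ β - 1) / β) = (y ^ β - 1) / β - (y ^ β - 1) := by field_simp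
  have h8 : 5 * D * y ^ β / (β * Real.log y ^ 2) = 5 * (D * (y ^ β / (β * Real.log y ^ 2))) := by
    ring
  rw [h6] at h1
  have h9 : 0 ≤ D * y ^ (β / 2) := by positivity
  rw [h8]
  have h10 : 0 ≤ β * (D * (y ^ β / (β * Real.log y ^ 2))) := by positivity
  have h11 : 0 ≤ β * (D * y ^ (β / 2)) := by positivity
  have h12 : β * (D * (y ^ β / (β * Real.log y ^ 2))) ≤ 1 * (D * (y ^ β / (β * Real.log y ^ 2))) :=
    mul_le_mul_of_nonneg_right hβ1 h5
  linarith

end Partial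

section Base
open Ideal

variable (K : Type) [Field K] [NumberField K]

lemma exists_half_log_le_sum_log_div : ∃ Y : ℝ, 1 < Y ∧ ∀ y, Y ≤ y →
    Real.log y / 2 ≤ ∑ P ∈ primesLE K y, Real.log (absNorm P) / absNorm P := by
  obtain ⟨E, hE, h⟩ := exists_le_sum_log_mul_rpow K
  refine ⟨Real.exp (16 * E + 1), Real.one_lt_exp_iff.2 (by positivity), fun y hy => ?_⟩
  have hy0 : 0 < y := (Real.exp_pos _).trans_le hy
  have hL : 16 * E + 1 ≤ Real.log y := (Real.le_log_iff_exp_le hy0).2 hy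
  have hL0 : 0 < Real.log y := by linarith
  have hy1 : 1 < y := (Real.log_pos_iff hy0.le).1 hL0
  have h1 := h y (Real.log y)⁻¹ hy1 (by positivity) (inv_le_one_of_one_le₀ (by linarith))
  have he : y ^ (Real.log y)⁻¹ = Real.exp 1 := by
    rw [Real.rpow_def_of_pos hy0, mul_inv_cancel₀ hL0.ne']
  have he2 : y ^ ((Real.log y)⁻¹ / 2) ≤ Real.exp 1 := by
    rw [← he]
    exact Real.rpow_le_rpow_of_exponent_le hy1.le (by linarith [inv_pos.2 hL0])
  have h2 : ∑ P ∈ primesLE K y, Real.log (absNorm P) * (absNorm P : ℝ) ^ ((Real.log y)⁻¹ - 1) ≤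
      Real.exp 1 * ∑ P ∈ primesLE K y, Real.log (absNorm P) / absNorm P := by
    rw [Finset.mul_sum]
    refine Finset.sum_le_sum fun P hP => ?_
    rw [mem_primesLE] at hP
    have hN : (0 : ℝ) < absNorm P := by
      have := two_le_absNorm hP.1 hP.2.1
      exact_mod_cast (by omega : 0 < absNorm P)
    rw [Real.rpow_sub_one hN.ne', mul_div_assoc', mul_div_assoc', mul_comm]
    refine div_le_div_of_nonneg_right (mul_le_mul_of_nonneg_right ?_
      (Real.log_natCast_nonneg _)) hN.le
    rw [← he]
    exact Real.rpow_le_rpow hN.le hP.2.2 (by positivity)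
  have h3 := h1.trans h2
  rw [he] at h3
  have h4 : (Real.exp 1 - 1) / (Real.log y)⁻¹ = (Real.exp 1 - 1) * Real.log y := by simp
  have h5 : E * Real.exp 1 / ((Real.log y)⁻¹ * Real.log y ^ 2) = E * Real.exp 1 / Real.log y := by
    field_simp
  have h6 : E * Real.exp 1 / Real.log y ≤ E * Real.exp 1 :=
    div_le_self (by positivity) (by linarith)
  have h7 : E * y ^ ((Real.log y)⁻¹ / 2) ≤ E * Real.exp 1 := mul_le_mul_of_nonneg_left he2 hE.le
  rw [h4, h5] at h3
  have h8 := Real.exp_one_gt_d9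
  have h9 := Real.exp_one_lt_d9
  set S := ∑ P ∈ primesLE K y, Real.log (absNorm P) / (absNorm P : ℝ)
  refine le_of_mul_le_mul_left ?_ (Real.exp_pos 1)
  nlinarith

lemma exists_mul_le_psiK_aux : ∃ B Y : ℝ, 0 < B ∧ 1 < Y ∧ ∀ k : ℕ, ∃ c : ℝ, 0 < c ∧
    ∀ y, Y ≤ y → ∀ x, 1 ≤ x → Real.log x ≤ (1 + k / B) * Real.log y → c * x ≤ psiK K x y := by
  obtain ⟨M, hM, hMz⟩ := exists_sum_log_div_absNorm_le K
  obtain ⟨Y, hY, hYs⟩ := exists_half_log_le_sum_log_div K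
  obtain ⟨c₀, C₀, hc₀, -, hcount⟩ := exists_idealCount_le K
  have hB : (0 : ℝ) < 4 * M + 1 := by positivity
  refine ⟨4 * M + 1, Y, hB, hY, fun k => ?_⟩
  induction k with
  | zero =>
    refine ⟨c₀, hc₀, fun y hy x hx hxy => ?_⟩
    have hy0 : 0 < y := by linarith
    simp only [Nat.cast_zero, zero_div, add_zero, one_mul] at hxy
    rw [psiK_of_le ((Real.log_le_log_iff (by linarith) hy0).1 hxy)]
    exact (hcount x hx).1
  | succ k ih =>
    obtain ⟨c, hc, h⟩ := ih
    set κ : ℝ := 1 + (k + 1 : ℕ) / (4 * M + 1) with hκ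
    have hκ1 : 1 ≤ κ := by
      rw [hκ]
      have : (0 : ℝ) ≤ (k + 1 : ℕ) / (4 * M + 1) := by positivity
      linarith
    refine ⟨c / (4 * κ), by positivity, fun y hy x hx hxy => ?_⟩
    have hx0 : 0 < x := by linarith
    have hy0 : 0 < y := by linarith
    have hL : 0 < Real.log y := Real.log_pos (by linarith)
    rcases le_or_gt (Real.log x) ((1 + k / (4 * M + 1)) * Real.log y) with hle | hgt
    · refine le_trans ?_ (h y hy x hx hle)
      refine mul_le_mul_of_nonneg_right ?_ hx0.le
      exact div_le_self hc.le (by linarith)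
    · have hyx : y ≤ x := by
        refine (Real.log_le_log_iff hy0 hx0).1 ?_
        have : 0 ≤ (k : ℝ) / (4 * M + 1) * Real.log y := by positivity
        linarith
      have hlx : 0 < Real.log x := hL.trans_le (Real.log_le_log hy0 hyx)
      set z : ℝ := Real.exp (Real.log y / (4 * M + 1)) with hz
      have hlz : Real.log z = Real.log y / (4 * M + 1) := Real.log_exp _
      have hz1 : 1 ≤ z := Real.one_le_exp (by positivity)
      have hzy : z ≤ y := by
        rw [hz, ← Real.le_log_iff_exp_le hy0]
        exact div_le_self hL.le (by linarith)
      have hsub : primesLE K z ⊆ primesLE K y := fun P hP => by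
        rw [mem_primesLE] at hP ⊢
        exact ⟨hP.1, hP.2.1, hP.2.2.trans hzy⟩
      have h1 := Finset.sum_sdiff hsub (f := fun P => Real.log (absNorm P) / (absNorm P : ℝ))
      have h2 := hMz z hz1
      have h3 := hYs y hy
      have h4 : M * Real.log z ≤ Real.log y / 4 := by
        rw [hlz, ← mul_div_assoc, div_le_div_iff₀ hB (by norm_num)]
        nlinarith
      have h5 : Real.log y / 4 ≤ ∑ P ∈ primesLE K y \ primesLE K z,
          Real.log (absNorm P) / (absNorm P : ℝ) := by linarith
      have h6 : c * x * ∑ P ∈ primesLE K y \ primesLE K z,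
          Real.log (absNorm P) / (absNorm P : ℝ) ≤
          ∑ P ∈ primesLE K y, Real.log (absNorm P) * psiK K (x / absNorm P) y := by
        rw [Finset.mul_sum]
        refine le_trans (Finset.sum_le_sum fun P hP => ?_)
          (Finset.sum_le_sum_of_subset_of_nonneg (Finset.sdiff_subset (t := primesLE K z))
          fun P _ _ => mul_nonneg (Real.log_natCast_nonneg _) (Nat.cast_nonneg _))
        rw [Finset.mem_sdiff, mem_primesLE, mem_primesLE] at hP
        obtain ⟨⟨hP1, hP2, hP3⟩, hP4⟩ := hP
        have hN : (0 : ℝ) < absNorm P := by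
          have := two_le_absNorm hP1 hP2
          exact_mod_cast (by omega : 0 < absNorm P)
        have hPz : z < absNorm P := by
          by_contra! hcon
          exact hP4 ⟨hP1, hP2, hcon⟩
        have h7 := h y hy (x / absNorm P) ((one_le_div hN).2 (hP3.trans hyx)) (by
          rw [Real.log_div hx0.ne' hN.ne']
          have h8 := Real.log_le_log (Real.exp_pos _) hPz.le
          rw [← hz, hlz] at h8
          have h9 : κ * Real.log y = (1 + k / (4 * M + 1)) * Real.log y +
              Real.log y / (4 * M + 1) := by
            rw [hκ]
            push_cast
            ring
          linarith)
        calc _ = Real.log (absNorm P) * (c * (x / absNorm P)) := by ring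
          _ ≤ _ := mul_le_mul_of_nonneg_left h7 (Real.log_natCast_nonneg _)
      have h7 := h6.trans (sum_log_mul_psiK_le x y)
      have h8 : c * x * (Real.log y / 4) ≤ c * x * ∑ P ∈ primesLE K y \ primesLE K z,
          Real.log (absNorm P) / (absNorm P : ℝ) := mul_le_mul_of_nonneg_left h5 (by positivity)
      have h9 : (psiK K x y : ℝ) * Real.log x ≤ psiK K x y * (κ * Real.log y) :=
        mul_le_mul_of_nonneg_left hxy (Nat.cast_nonneg _)
      have h10 := h8.trans (h7.trans h9)
      rw [div_mul_eq_mul_div, div_le_iff₀ (by positivity)]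
      refine le_of_mul_le_mul_right ?_ hL
      linarith

lemma exists_mul_le_psiK (n : ℝ) : ∃ c Y : ℝ, 0 < c ∧ 1 < Y ∧
    ∀ y, Y ≤ y → ∀ x, 1 ≤ x → Real.log x ≤ n * Real.log y → c * x ≤ psiK K x y := by
  obtain ⟨B, Y, hB, hY, h⟩ := exists_mul_le_psiK_aux K
  obtain ⟨k, hk⟩ := exists_nat_ge (B * n)
  obtain ⟨c, hc, h⟩ := h k
  refine ⟨c, Y, hc, hY, fun y hy x hx hxy => h y hy x hx (hxy.trans ?_)⟩
  refine mul_le_mul_of_nonneg_right ?_ (Real.log_nonneg (by linarith))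
  have : n ≤ k / B := (le_div_iff₀' hB).2 hk
  linarith

end Base

section Calc
open Set

/-- The exponent in the lower bound for `ψ_K(x, y)`, as a function of `u = log x / log y`. -/
noncomputable def smoothExponent (A u : ℝ) : ℝ :=
  u * (Real.log u + Real.log (Real.log u) - 1 + (Real.log (Real.log u) - 1) / Real.log u +
    A * (Real.log (Real.log u) / Real.log u) ^ 2)

/-- A lower approximation to the derivative of `smoothExponent`. -/
noncomputable def smoothSlope (A u : ℝ) : ℝ :=
  Real.log u + Real.log (Real.log u) + Real.log (Real.log u) / Real.log u +
    A * (Real.log (Real.log u) / Real.log u) ^ 2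

lemma hasDerivAt_log_log {u : ℝ} (hu : 1 < u) :
    HasDerivAt (fun v => Real.log (Real.log v)) (u⁻¹ / Real.log u) u :=
  (Real.hasDerivAt_log (by linarith)).log (Real.log_pos hu).ne'

lemma hasDerivAt_log_log_div_log {u : ℝ} (hu : 1 < u) :
    HasDerivAt (fun v => Real.log (Real.log v) / Real.log v)
      (u⁻¹ * (1 - Real.log (Real.log u)) / Real.log u ^ 2) u := by
  have hl := Real.log_pos hu
  refine ((hasDerivAt_log_log hu).div (Real.hasDerivAt_log (by linarith)) hl.ne').congr_deriv ?_
  field_simp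

lemma hasDerivAt_smoothExponent (A : ℝ) {u : ℝ} (hu : 1 < u) :
    HasDerivAt (smoothExponent A) (Real.log u + Real.log (Real.log u) +
      Real.log (Real.log u) / Real.log u + (2 - Real.log (Real.log u)) / Real.log u ^ 2 +
      A * ((Real.log (Real.log u) / Real.log u) ^ 2 + 2 * (Real.log (Real.log u) / Real.log u) *
        (1 - Real.log (Real.log u)) / Real.log u ^ 2)) u := by
  have hl := Real.log_pos hu
  have hu0 : u ≠ 0 := by linarith
  have h1 := Real.hasDerivAt_log hu0
  have h2 := hasDerivAt_log_log hu
  have h3 := hasDerivAt_log_log_div_log hu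
  have h4 := (h2.sub_const 1).div h1 hl.ne'
  refine ((hasDerivAt_id u).mul ((((h1.add h2).sub_const 1).add h4).add
    ((h3.pow 2).const_mul A))).congr_deriv ?_
  simp only [id, Pi.add_apply, Pi.div_apply, Pi.pow_apply, Nat.reduceSub, pow_one, Nat.cast_ofNat]
  field_simp
  ring

lemma hasDerivAt_smoothSlope (A : ℝ) {u : ℝ} (hu : 1 < u) :
    HasDerivAt (smoothSlope A) (u⁻¹ / Real.log u ^ 2 * (Real.log u ^ 2 + Real.log u +
      (1 + 2 * A * (Real.log (Real.log u) / Real.log u)) * (1 - Real.log (Real.log u)))) u := by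
  have hl := Real.log_pos hu
  have hu0 : u ≠ 0 := by linarith
  have h1 := Real.hasDerivAt_log hu0
  have h2 := hasDerivAt_log_log hu
  have h3 := hasDerivAt_log_log_div_log hu
  refine (((h1.add h2).add h3).add ((h3.pow 2).const_mul A)).congr_deriv ?_
  simp only [Nat.reduceSub, pow_one, Nat.cast_ofNat]
  field_simp
  ring

lemma log_sq_le_four_mul {x : ℝ} (hx : 1 ≤ x) : Real.log x ^ 2 ≤ 4 * x := by
  have h1 : Real.log x ≤ 2 * √x := by
    have h2 := Real.log_le_sub_one_of_pos (Real.sqrt_pos.2 (by linarith : 0 < x))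
    rw [Real.log_sqrt (by linarith)] at h2
    linarith
  have h3 := Real.log_nonneg hx
  calc Real.log x ^ 2 ≤ (2 * √x) ^ 2 := by gcongr
    _ = 4 * x := by rw [mul_pow, Real.sq_sqrt (by linarith)]; norm_num

lemma one_le_log_of_three_le {x : ℝ} (hx : 3 ≤ x) : 1 ≤ Real.log x := by
  rw [Real.le_log_iff_exp_le (by linarith)]
  linarith [Real.exp_one_lt_d9]

lemma smoothSlope_le_deriv {A u : ℝ} (hA : 0 ≤ A) (hl : 4 ≤ Real.log u) :
    smoothSlope (A / 2 - 1) u ≤ Real.log u + Real.log (Real.log u) +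
      Real.log (Real.log u) / Real.log u + (2 - Real.log (Real.log u)) / Real.log u ^ 2 +
      A * ((Real.log (Real.log u) / Real.log u) ^ 2 + 2 * (Real.log (Real.log u) / Real.log u) *
        (1 - Real.log (Real.log u)) / Real.log u ^ 2) := by
  have h2 : 1 ≤ Real.log (Real.log u) := one_le_log_of_three_le (by linarith)
  rw [smoothSlope]
  set l := Real.log u
  set m := Real.log l
  have hl0 : 0 < l := by linarith
  have h3 : -(m / l) ^ 2 ≤ (2 - m) / l ^ 2 := by
    rw [div_pow, ← neg_div]
    gcongr
    nlinarith
  have h4 : (m / l) ^ 2 / 2 ≤ (m / l) ^ 2 + 2 * (m / l) * (1 - m) / l ^ 2 := by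
    have : (m / l) ^ 2 + 2 * (m / l) * (1 - m) / l ^ 2 - (m / l) ^ 2 / 2 =
        m / l ^ 3 * (m * (l / 2 - 2) + 2) := by
      field_simp
      ring
    have h5 : 0 ≤ m / l ^ 3 * (m * (l / 2 - 2) + 2) := by
      have : 0 ≤ m * (l / 2 - 2) := mul_nonneg (by linarith) (by linarith)
      positivity
    linarith
  have h5 := mul_le_mul_of_nonneg_left h4 hA
  linarith

lemma monotoneOn_smoothSlope {A Λ : ℝ} (hA : 0 ≤ A) (hΛ : 9 ≤ Λ) (hAΛ : A ≤ Λ) :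
    MonotoneOn (smoothSlope A) (Ici (Real.exp Λ)) := by
  have hu : ∀ u ∈ Ici (Real.exp Λ), 1 < u ∧ Λ ≤ Real.log u := fun u hu =>
    ⟨(Real.one_lt_exp_iff.2 (by linarith)).trans_le hu,
      (Real.le_log_iff_exp_le ((Real.exp_pos _).trans_le hu)).2 hu⟩
  refine monotoneOn_of_hasDerivWithinAt_nonneg (convex_Ici _) (fun u h =>
    (hasDerivAt_smoothSlope A (hu u h).1).continuousAt.continuousWithinAt)
    (fun u h => (hasDerivAt_smoothSlope A (hu u (interior_subset h)).1).hasDerivWithinAt)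
    fun u h => ?_
  obtain ⟨h1, hl⟩ := hu u (interior_subset h)
  have h2 : 1 ≤ Real.log (Real.log u) := one_le_log_of_three_le (by linarith)
  have h3 := log_sq_le_four_mul (by linarith : 1 ≤ Real.log u)
  set l := Real.log u
  set m := Real.log l
  have hl0 : 0 < l := by linarith
  have h4 : m ≤ l := (Real.log_le_sub_one_of_pos hl0).trans (by linarith)
  have h5 : A * (m / l) * m ≤ 4 * l := by
    have : A * (m / l) * m = A / l * m ^ 2 := by ring
    rw [this]
    have h6 : A / l ≤ 1 := (div_le_one hl0).2 (by linarith)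
    nlinarith [sq_nonneg m]
  have h6 : 0 ≤ A * (m / l) := by positivity
  refine mul_nonneg (by positivity) ?_
  nlinarith

lemma four_mul_sq_le_exp {x : ℝ} (hx : 24 ≤ x) : 4 * x ^ 2 ≤ Real.exp x := by
  have h := Real.pow_div_factorial_le_exp x (by linarith) 3
  refine le_trans ?_ h
  rw [show ((Nat.factorial 3 : ℕ) : ℝ) = 6 by norm_num [Nat.factorial], le_div_iff₀ (by norm_num)]
  nlinarith [sq_nonneg x]

lemma mul_smoothSlope_le_sub {A u t : ℝ} (hA : 0 ≤ A) (hut : 1 < u - t)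
    (hl : 24 ≤ Real.log (u - t)) (ht : 0 ≤ t) (ht1 : t ≤ 1) :
    t * smoothSlope A u ≤ smoothExponent (2 * A + 4) u - smoothExponent (2 * A + 4) (u - t) := by
  have hv : ∀ v ∈ Icc (u - t) u, 1 < v ∧ 24 ≤ Real.log v := fun v hv =>
    ⟨by linarith [hv.1], hl.trans (Real.log_le_log (by linarith) hv.1)⟩
  obtain ⟨hu1, hlu⟩ := hv u ⟨by linarith, le_rfl⟩
  have h := (convex_Icc (u - t) u).mul_sub_le_image_sub_of_le_deriv
    (f := smoothExponent (2 * A + 4)) (C := smoothSlope A u)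
    (fun v h => (hasDerivAt_smoothExponent _ (hv v h).1).continuousAt.continuousWithinAt)
    (fun v h => (hasDerivAt_smoothExponent _
      (hv v (interior_subset h)).1).differentiableAt.differentiableWithinAt)
    (fun v h => ?_) (u - t) ⟨le_rfl, by linarith⟩ u ⟨by linarith, le_rfl⟩ (by linarith)
  · rw [sub_sub_cancel] at h
    linarith
  · replace h := interior_subset h
    obtain ⟨hv1, hlv⟩ := hv v h
    rw [(hasDerivAt_smoothExponent _ hv1).deriv]
    refine le_trans ?_ (smoothSlope_le_deriv (by positivity) (by linarith))
    rw [smoothSlope, smoothSlope, show (2 * A + 4) / 2 - 1 = A + 1 by ring]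
    have h2 : 1 ≤ Real.log (Real.log u) := one_le_log_of_three_le (by linarith)
    have h2v : 1 ≤ Real.log (Real.log v) := one_le_log_of_three_le (by linarith)
    have hlvu : Real.log v ≤ Real.log u := Real.log_le_log (by linarith) h.2
    have hq : Real.log (Real.log u) / Real.log u ≤ Real.log (Real.log v) / Real.log v :=
      Real.log_div_self_antitoneOn (by linarith [Real.exp_one_lt_d9] : Real.exp 1 ≤ Real.log v)
        (by linarith [Real.exp_one_lt_d9] : Real.exp 1 ≤ Real.log u) hlvu
    have hu25 : 25 ≤ u := by
      have := Real.log_le_sub_one_of_pos (by linarith : 0 < u)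
      linarith
    have h3 : Real.log u - Real.log v ≤ 2 / u := by
      rw [← Real.log_div (by linarith) (by linarith)]
      refine (Real.log_le_sub_one_of_pos (div_pos (by linarith) (by linarith))).trans ?_
      have h4 : u / v - 1 = (u - v) / v := by field_simp
      rw [h4, div_le_div_iff₀ (by linarith) (by linarith)]
      have h5 : u - v ≤ 1 := by linarith [h.1]
      nlinarith
    have h4 : Real.log (Real.log u) - Real.log (Real.log v) ≤ 2 / u := by
      refine le_trans ?_ h3
      rw [← Real.log_div (by linarith) (by linarith)]
      refine (Real.log_le_sub_one_of_pos (div_pos (by linarith) (by linarith))).trans ?_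
      have h4 : Real.log u / Real.log v - 1 = (Real.log u - Real.log v) / Real.log v := by
        field_simp
      rw [h4]
      exact div_le_self (by linarith) (by linarith)
    have h5 : 4 / u ≤ (Real.log (Real.log u) / Real.log u) ^ 2 := by
      have h6 := four_mul_sq_le_exp hlu
      rw [Real.exp_log (by linarith)] at h6
      rw [div_pow, div_le_div_iff₀ (by linarith) (by positivity)]
      exact h6.trans (le_mul_of_one_le_left (by linarith) (one_le_pow₀ h2))
    have hq0 : 0 ≤ Real.log (Real.log u) / Real.log u := by positivity
    have h6 : (Real.log (Real.log u) / Real.log u) ^ 2 ≤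
        (Real.log (Real.log v) / Real.log v) ^ 2 := by gcongr
    have h7 : 4 / u = 2 / u + 2 / u := by ring
    nlinarith

lemma mul_mul_smoothSlope_le_exp {B u : ℝ} (hB : 1 ≤ B) (hu : 1 < u)
    (hl : 4 * B + 2 ≤ Real.log u) :
    (1 + B * (Real.log (Real.log u) / Real.log u) ^ 2) * (u * smoothSlope (4 * B + 2) u) ≤
      Real.exp (smoothSlope (4 * B + 2) u) := by
  have h2 : 1 ≤ Real.log (Real.log u) := one_le_log_of_three_le (by linarith)
  have hl0 : 0 < Real.log u := by linarith
  rw [smoothSlope, add_assoc _ _ (_ * _), Real.exp_add, Real.exp_add, Real.exp_log (by linarith),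
    Real.exp_log hl0]
  have hm : Real.log (Real.log u) ≤ Real.log u :=
    (Real.log_le_sub_one_of_pos hl0).trans (by linarith)
  set l := Real.log u
  set m := Real.log l
  set q := m / l with hq
  have hq0 : 0 < q := by positivity
  have hq1 : q ≤ 1 := (div_le_one hl0).2 hm
  have hmq : m = q * l := by rw [hq]; field_simp
  have h3 := Real.add_one_le_exp (q + (4 * B + 2) * q ^ 2)
  have h4 : q ≤ q ^ 2 * l := by
    rw [sq, mul_assoc, ← hmq]
    nlinarith
  have h5 : (1 + B * q ^ 2) * (u * (l + m + (q + (4 * B + 2) * q ^ 2))) ≤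
      u * l * ((1 + B * q ^ 2) * (1 + q + 2 * q ^ 2)) := by
    have h6 : l + m + (q + (4 * B + 2) * q ^ 2) ≤ l * (1 + q + 2 * q ^ 2) := by
      have h7 : (4 * B + 2) * q ^ 2 ≤ l * q ^ 2 := by gcongr
      rw [hmq]
      linarith
    have h8 := mul_le_mul_of_nonneg_left h6 (by positivity : 0 ≤ (1 + B * q ^ 2) * u)
    linarith
  refine h5.trans (mul_le_mul_of_nonneg_left (le_trans ?_ h3) (by positivity))
  have h6 : B * q ^ 2 * (1 + q + 2 * q ^ 2) ≤ B * q ^ 2 * 4 := by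
    refine mul_le_mul_of_nonneg_left ?_ (by positivity)
    nlinarith
  linarith

end Calc

section Final
open Ideal Set

lemma mul_log_le_of_smoothSlope_le {E y u : ℝ} (hE : 0 < E) (hy : 1 < y) (hu : 1 < u)
    (hl : 4 * (16 + 18 * E) + 2 ≤ Real.log u)
    (hθ : smoothSlope (4 * (16 + 18 * E) + 2) u ≤ Real.log y) {β : ℝ}
    (hβ : β = smoothSlope (4 * (16 + 18 * E) + 2) u / Real.log y) :
    u * Real.log y ≤
      (y ^ β - 1) / β - E * y ^ β / (β * Real.log y ^ 2) - E * y ^ (β / 2) := by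
  have hexp := mul_mul_smoothSlope_le_exp (B := 16 + 18 * E) (by linarith) hu hl
  have h2 : 1 ≤ Real.log (Real.log u) := one_le_log_of_three_le (by linarith)
  have hl0 : 0 < Real.log u := by linarith
  have hL : 0 < Real.log y := Real.log_pos hy
  have hq := log_sq_le_four_mul (by linarith : 1 ≤ Real.log u)
  have hlθ : Real.log u ≤ smoothSlope (4 * (16 + 18 * E) + 2) u := by
    have h3 : 0 ≤ Real.log (Real.log u) / Real.log u +
      (4 * (16 + 18 * E) + 2) * (Real.log (Real.log u) / Real.log u) ^ 2 := by positivity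
    rw [smoothSlope]
    linarith
  set θ := smoothSlope (4 * (16 + 18 * E) + 2) u
  set l := Real.log u
  set m := Real.log l
  set L := Real.log y
  set B := 16 + 18 * E with hB
  have hB0 : 0 < B := by positivity
  have hθ0 : 0 < θ := by linarith
  have hyβ : y ^ β = Real.exp θ := by
    rw [Real.rpow_def_of_pos (by linarith), hβ]
    congr 1
    change L * (θ / L) = θ
    field_simp
  have hyβ2 : y ^ (β / 2) = Real.exp (θ / 2) := by
    rw [Real.rpow_def_of_pos (by linarith), hβ]
    congr 1
    change L * (θ / L / 2) = θ / 2
    field_simp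
  have hX : Real.exp θ = Real.exp (θ / 2) * Real.exp (θ / 2) := by
    rw [← Real.exp_add]
    congr 1
    ring
  have hZ : l ^ 2 / 8 ≤ Real.exp (θ / 2) := by
    have h3 := Real.quadratic_le_exp_of_nonneg (by positivity : 0 ≤ θ / 2)
    nlinarith
  set X := Real.exp θ
  set Z := Real.exp (θ / 2)
  have hX0 : 0 < X := Real.exp_pos _
  have hZ1 : 1 ≤ Z := Real.one_le_exp (by positivity)
  set Q := (m / l) ^ 2 with hQ
  have hQl : 1 / l ^ 2 ≤ Q := by
    rw [hQ, div_pow]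
    gcongr
    exact one_le_pow₀ h2
  have hBQ : B * Q ≤ 1 := by
    rw [hQ, div_pow, mul_div_assoc', div_le_one (by positivity)]
    nlinarith
  have hQ0 : 0 < Q := by positivity
  have hZX : Z ≤ 8 * Q * X := by
    have h3 : 1 ≤ 8 * Q * Z := by
      have h4 : 1 / l ^ 2 * (l ^ 2 / 8) ≤ Q * Z := by gcongr
      have h5 : 1 / l ^ 2 * (l ^ 2 / 8) = 1 / 8 := by field_simp
      linarith
    rw [hX]
    nlinarith
  have hL2 : 1 / L ^ 2 ≤ Q := by
    refine le_trans ?_ hQl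
    gcongr
    linarith
  have hkey : u * θ ≤ X - 1 - E * X / L ^ 2 - E * Z := by
    have h3 : E * X / L ^ 2 = E * X * (1 / L ^ 2) := by ring
    have h4 : E * X * (1 / L ^ 2) ≤ E * X * Q := by gcongr
    have h5 : B * Q / 2 * X ≤ X - u * θ := by
      have h6 : 0 ≤ u * θ * (B * Q * (1 - B * Q)) :=
        mul_nonneg (by positivity) (mul_nonneg (by positivity) (by linarith))
      have h7 := mul_le_mul_of_nonneg_left hexp (by linarith : 0 ≤ 1 - B * Q / 2)
      linarith
    have h6 : E * Z ≤ E * (8 * Q * X) := by gcongr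
    have h7 : B * Q / 2 * X = 8 * Q * X + E * X * Q + E * (8 * Q * X) := by
      rw [hB]
      ring
    linarith
  rw [hyβ, hyβ2, hβ]
  have h3 : (X - 1) / (θ / L) - E * X / (θ / L * L ^ 2) = L / θ * (X - 1 - E * X / L ^ 2) := by
    field_simp
  have h4 : E * Z ≤ L / θ * (E * Z) := le_mul_of_one_le_left (by positivity)
    ((one_le_div hθ0).2 hθ)
  have h5 := mul_le_mul_of_nonneg_left hkey (by positivity : 0 ≤ L / θ)
  have h6 : L / θ * (u * θ) = u * L := by field_simp
  rw [h6] at h5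
  linarith

variable {K : Type} [Field K] [NumberField K]

lemma mul_exp_neg_smoothExponent_le_psiK {E c y : ℝ} (hE : 0 < E) (hc : 0 < c) (hy : 1 < y)
    (hsum : ∀ β : ℝ, 0 < β → β ≤ 1 →
      (y ^ β - 1) / β - E * y ^ β / (β * Real.log y ^ 2) - E * y ^ (β / 2) ≤
      ∑ P ∈ primesLE K y, Real.log (absNorm P) * (absNorm P : ℝ) ^ (β - 1))
    {A : ℝ} (hA : A = 4 * (16 + 18 * E) + 2)
    (hbase : ∀ x, 1 ≤ x → Real.log x ≤ (Real.exp A + 1) * Real.log y → c * x ≤ psiK K x y)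
    (k : ℕ) : ∀ u, Real.exp A ≤ u → u ≤ Real.exp A + 1 + k * (Real.log 2 / Real.log y) →
      smoothSlope A u ≤ Real.log y →
      c * Real.exp (u * Real.log y - smoothExponent (2 * A + 4) u) ≤
        psiK K (Real.exp (u * Real.log y)) y := by
  have hL : 0 < Real.log y := Real.log_pos hy
  have hA0 : 66 ≤ A := by linarith
  have hu1 : ∀ u, Real.exp A ≤ u → 1 < u ∧ A ≤ Real.log u := fun u hu =>
    ⟨(Real.one_lt_exp_iff.2 (by linarith)).trans_le hu,
      (Real.le_log_iff_exp_le ((Real.exp_pos _).trans_le hu)).2 hu⟩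
  have hsmall : ∀ u, Real.exp A ≤ u → u ≤ Real.exp A + 1 →
      c * Real.exp (u * Real.log y - smoothExponent (2 * A + 4) u) ≤
        psiK K (Real.exp (u * Real.log y)) y := by
    intro u hu hu'
    obtain ⟨h1, h2⟩ := hu1 u hu
    refine le_trans ?_ (hbase _ (Real.one_le_exp (by positivity)) ?_)
    · refine mul_le_mul_of_nonneg_left (Real.exp_le_exp.2 ?_) hc.le
      have h3 : 1 ≤ Real.log (Real.log u) := one_le_log_of_three_le (by linarith)
      have h4 : 0 ≤ (Real.log (Real.log u) - 1) / Real.log u :=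
        div_nonneg (by linarith) (by linarith)
      have h5 : 0 ≤ smoothExponent (2 * A + 4) u := by
        refine mul_nonneg (by linarith) ?_
        have : 0 ≤ (2 * A + 4) * (Real.log (Real.log u) / Real.log u) ^ 2 := by positivity
        linarith
      linarith
    · rw [Real.log_exp]
      exact mul_le_mul_of_nonneg_right hu' hL.le
  induction k with
  | zero =>
    intro u hu hu' _
    exact hsmall u hu (by simpa using hu')
  | succ k ih =>
    intro u hu hu' hθ
    rcases le_or_gt u (Real.exp A + 1) with hle | hgt
    · exact hsmall u hu hle
    obtain ⟨h1, hlu⟩ := hu1 u hu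
    set θ := smoothSlope A u with hθdef
    have hθ0 : 0 < θ := by
      have h3 : 1 ≤ Real.log (Real.log u) := one_le_log_of_three_le (by linarith)
      rw [hθdef, smoothSlope]
      have : 0 < Real.log u := by linarith
      positivity
    have hβ0 : 0 < θ / Real.log y := by positivity
    have h3 := (mul_log_le_of_smoothSlope_le hE hy h1 (hA ▸ hlu) (hA ▸ hθ) rfl).trans
      (hsum _ (hA ▸ hβ0) (hA ▸ (div_le_one hL).2 hθ))
    rw [← hA] at h3
    have h4 := sum_log_mul_psiK_le (K := K) (Real.exp (u * Real.log y)) y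
    rw [Real.log_exp] at h4
    set M := c * Real.exp (u * Real.log y - smoothExponent (2 * A + 4) u) with hM
    have hM0 : 0 < M := by positivity
    have h5 : M * ∑ P ∈ primesLE K y,
        Real.log (absNorm P) * (absNorm P : ℝ) ^ (θ / Real.log y - 1) ≤
        ∑ P ∈ primesLE K y, Real.log (absNorm P) *
          psiK K (Real.exp (u * Real.log y) / absNorm P) y := by
      rw [Finset.mul_sum]
      refine Finset.sum_le_sum fun P hP => ?_
      rw [mem_primesLE] at hP
      have hN2 : (2 : ℝ) ≤ absNorm P := by exact_mod_cast two_le_absNorm hP.1 hP.2.1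
      have hN : (0 : ℝ) < absNorm P := by linarith
      rw [mul_left_comm]
      refine mul_le_mul_of_nonneg_left ?_ (Real.log_natCast_nonneg _)
      have hlogN : 0 < Real.log (absNorm P) := Real.log_pos (by linarith)
      set t := Real.log (absNorm P) / Real.log y with ht
      have htL : t * Real.log y = Real.log (absNorm P) := by rw [ht]; field_simp
      have ht0 : 0 < t := by positivity
      have ht1 : t ≤ 1 := (div_le_one hL).2 (Real.log_le_log hN hP.2.2)
      have ht2 : Real.log 2 / Real.log y ≤ t :=
        div_le_div_of_nonneg_right (Real.log_le_log (by norm_num) hN2) hL.le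
      have hx : Real.exp (u * Real.log y) / absNorm P = Real.exp ((u - t) * Real.log y) := by
        rw [sub_mul, htL, Real.exp_sub, Real.exp_log hN]
      have hut : Real.exp A ≤ u - t := by linarith
      have hmono := monotoneOn_smoothSlope (A := A) (Λ := A) (by linarith) (by linarith) le_rfl
        (mem_Ici.2 hut) (mem_Ici.2 hu) (by linarith)
      have hih := ih (u - t) hut (by push_cast at hu'; linarith) (hmono.trans hθ)
      rw [hx]
      refine le_trans ?_ hih
      obtain ⟨hut1, hut2⟩ := hu1 _ hut
      have h6 := mul_smoothSlope_le_sub (A := A) (u := u) (t := t) (by linarith) hut1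
        (by linarith) ht0.le ht1
      rw [hM, mul_assoc, Real.rpow_def_of_pos hN, ← Real.exp_add]
      refine mul_le_mul_of_nonneg_left (Real.exp_le_exp.2 ?_) hc.le
      have h7 : Real.log (absNorm P) * (θ / Real.log y - 1) = t * θ - t * Real.log y := by
        rw [← htL]
        field_simp
      rw [h7]
      linarith
    have h6 := (mul_le_mul_of_nonneg_left h3 hM0.le).trans (h5.trans h4)
    exact le_of_mul_le_mul_right h6 (by positivity)

lemma mul_le_smoothExponent (A : ℝ) {u : ℝ} (hu : 3 ≤ u) :
    u * (Real.log u - 2 + A * (Real.log (Real.log u) / Real.log u) ^ 2) ≤ smoothExponent A u := by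
  have h1 := one_le_log_of_three_le hu
  have h2 := Real.log_nonneg h1
  refine mul_le_mul_of_nonneg_left ?_ (by linarith)
  have h3 : -1 ≤ (Real.log (Real.log u) - 1) / Real.log u := by
    rw [le_div_iff₀ (by linarith)]
    linarith
  linarith

lemma one_lt_log_three : 1 < Real.log 3 := by
  rw [Real.lt_log_iff_exp_lt (by norm_num)]
  linarith [Real.exp_one_lt_d9]

lemma sub_le_sub_smoothExponent {A C L u v : ℝ} (hA : 9 ≤ A) (hC : 2 * A + 4 ≤ C)
    (hv : Real.exp A ≤ v) (hvu : v ≤ u) (hL : L ≤ smoothSlope A v) :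
    L * (u - v) ≤ smoothExponent C u - smoothExponent C v := by
  have hw : ∀ w ∈ Icc v u, 1 < w ∧ A ≤ Real.log w := fun w h =>
    ⟨(Real.one_lt_exp_iff.2 (by linarith)).trans_le (hv.trans h.1),
      (Real.le_log_iff_exp_le ((Real.exp_pos _).trans_le (hv.trans h.1))).2 (hv.trans h.1)⟩
  refine (convex_Icc v u).mul_sub_le_image_sub_of_le_deriv (f := smoothExponent C)
    (fun w h => (hasDerivAt_smoothExponent _ (hw w h).1).continuousAt.continuousWithinAt)
    (fun w h => (hasDerivAt_smoothExponent _
      (hw w (interior_subset h)).1).differentiableAt.differentiableWithinAt)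
    (fun w h => ?_) v ⟨le_rfl, hvu⟩ u ⟨hvu, le_rfl⟩ hvu
  replace h := interior_subset h
  obtain ⟨h1, h2⟩ := hw w h
  rw [(hasDerivAt_smoothExponent _ h1).deriv]
  refine le_trans ?_ (smoothSlope_le_deriv (by linarith) (by linarith))
  have h3 := monotoneOn_smoothSlope (A := A) (Λ := A) (by linarith) hA le_rfl
        (mem_Ici.2 hv) (mem_Ici.2 (hv.trans h.1)) h.1
  refine hL.trans (h3.trans ?_)
  rw [smoothSlope, smoothSlope]
  have : A * (Real.log (Real.log w) / Real.log w) ^ 2 ≤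
      (C / 2 - 1) * (Real.log (Real.log w) / Real.log w) ^ 2 :=
    mul_le_mul_of_nonneg_right (by linarith) (sq_nonneg _)
  linarith

variable (K) in
lemma exists_exp_sub_smoothExponent_le_psiK : ∃ C : ℝ, 0 < C ∧ ∀ u y : ℝ, 3 ≤ u → 1 < y →
    Real.exp (u * Real.log y - smoothExponent C u) ≤ psiK K (Real.exp (u * Real.log y)) y := by
  obtain ⟨E, hE, hsum⟩ := exists_le_sum_log_mul_rpow K
  set A := 4 * (16 + 18 * E) + 2 with hA
  have hA66 : 66 ≤ A := by linarith
  obtain ⟨c, Y, hc, hY, hbase⟩ := exists_mul_le_psiK K (Real.exp A + 1)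
  set κ := Real.log (Real.log 3)
  have hκ : 0 < κ := Real.log_pos one_lt_log_three
  set L₀ := max (Real.log Y) (smoothSlope A (Real.exp A))
  have hL₀ : 0 < L₀ := (Real.log_pos hY).trans_le (le_max_left _ _)
  set R := A + L₀ + 3 with hR
  set G := 1 + |Real.log c| + L₀ with hG
  have hR0 : 0 < R := by positivity
  have hG0 : 0 < G := by positivity
  set C := 2 * A + 4 + |Real.log c| + G * R ^ 2 / κ ^ 2 with hC
  have hGR : 0 < G * R ^ 2 / κ ^ 2 := by positivity
  have habs : 0 ≤ |Real.log c| := abs_nonneg _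
  have hC0 : 0 < C := by linarith
  have hCG : ∀ u, 3 ≤ u → Real.log u ≤ R →
      G ≤ C * (Real.log (Real.log u) / Real.log u) ^ 2 := by
    intro u hu huR
    have h1 := one_le_log_of_three_le hu
    have h2 : κ / R ≤ Real.log (Real.log u) / Real.log u := by
      have h3 : κ ≤ Real.log (Real.log u) := Real.log_le_log (by linarith [one_lt_log_three])
        (Real.log_le_log (by norm_num) hu)
      gcongr
      linarith
    calc G = G * R ^ 2 / κ ^ 2 * (κ / R) ^ 2 := by field_simp
      _ ≤ C * (Real.log (Real.log u) / Real.log u) ^ 2 := by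
        gcongr
        linarith
  have hlogA : ∀ u, Real.exp A ≤ u → 1 < u ∧ A ≤ Real.log u := fun u hu =>
    ⟨(Real.one_lt_exp_iff.2 (by linarith)).trans_le hu,
      (Real.le_log_iff_exp_le ((Real.exp_pos _).trans_le hu)).2 hu⟩
  have hmain : ∀ u y, Y ≤ y → Real.exp A ≤ u → smoothSlope A u ≤ Real.log y →
      Real.exp (u * Real.log y - smoothExponent C u) ≤
        psiK K (Real.exp (u * Real.log y)) y := by
    intro u y hy hu hθ
    have hy1 : 1 < y := hY.trans_le hy
    have hL : 0 < Real.log y := Real.log_pos hy1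
    have hs : 0 < Real.log 2 / Real.log y := div_pos (Real.log_pos (by norm_num)) hL
    obtain ⟨k, hk⟩ := exists_nat_ge ((u - (Real.exp A + 1)) / (Real.log 2 / Real.log y))
    rw [div_le_iff₀ hs] at hk
    refine le_trans ?_ (mul_exp_neg_smoothExponent_le_psiK hE hc hy1 (fun β => hsum y β hy1) hA
      (hbase y hy) k u hu (by linarith) hθ)
    rw [← Real.exp_log hc, ← Real.exp_add, Real.exp_le_exp]
    obtain ⟨h1, h2⟩ := hlogA u hu
    have h3 : 1 ≤ Real.log (Real.log u) := one_le_log_of_three_le (by linarith)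
    have h4 : 1 ≤ u * (Real.log (Real.log u) / Real.log u) ^ 2 := by
      have h6 := four_mul_sq_le_exp (by linarith : 24 ≤ Real.log u)
      rw [Real.exp_log (by linarith)] at h6
      have h7 : 0 < Real.log u := by linarith
      rw [div_pow, mul_div_assoc', one_le_div (by positivity)]
      have h8 := le_mul_of_one_le_right (by linarith : 0 ≤ u) (one_le_pow₀ h3 (n := 2))
      nlinarith [sq_nonneg (Real.log u)]
    have h5 : smoothExponent C u = smoothExponent (2 * A + 4) u +
        (C - (2 * A + 4)) * (u * (Real.log (Real.log u) / Real.log u) ^ 2) := by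
      rw [smoothExponent, smoothExponent]
      ring
    rw [h5]
    have h6 : |Real.log c| * 1 ≤
        (C - (2 * A + 4)) * (u * (Real.log (Real.log u) / Real.log u) ^ 2) := by
      gcongr <;> linarith
    linarith [neg_abs_le (Real.log c)]
  refine ⟨C, hC0, fun u y hu hy => ?_⟩
  have hL : 0 < Real.log y := Real.log_pos hy
  have hlow := mul_le_smoothExponent C hu
  have hl1 := one_le_log_of_three_le hu
  have hx1 : 1 ≤ Real.exp (u * Real.log y) := Real.one_le_exp (by positivity)
  rcases lt_or_ge (Real.log y) L₀ with hsmall | hlarge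
  · have h1 : (1 : ℝ) ≤ psiK K (Real.exp (u * Real.log y)) y := by exact_mod_cast one_le_psiK hx1 y
    refine le_trans (Real.exp_le_one_iff.2 ?_) h1
    have h2 : L₀ ≤ Real.log u - 2 + C * (Real.log (Real.log u) / Real.log u) ^ 2 := by
      rcases le_total (Real.log u) R with h3 | h3
      · linarith [hCG u hu h3]
      · have : 0 ≤ C * (Real.log (Real.log u) / Real.log u) ^ 2 := by positivity
        linarith
    have h3 : u * Real.log y ≤
        u * (Real.log u - 2 + C * (Real.log (Real.log u) / Real.log u) ^ 2) :=
      mul_le_mul_of_nonneg_left (by linarith) (by linarith)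
    linarith
  have hyY : Y ≤ y := (Real.log_le_log_iff (by linarith) (by linarith)).1
    ((le_max_left _ _).trans hlarge)
  have hLθ : smoothSlope A (Real.exp A) ≤ Real.log y := (le_max_right _ _).trans hlarge
  rcases lt_or_ge u (Real.exp A) with huA | huA
  · refine le_trans ?_ (hbase y hyY _ hx1 (by
      rw [Real.log_exp]
      exact mul_le_mul_of_nonneg_right (by linarith) hL.le))
    rw [← Real.exp_log hc, ← Real.exp_add, Real.exp_le_exp]
    have h1 : Real.log u ≤ A := (Real.log_le_iff_le_exp (by linarith)).2 huA.le
    have h2 := hCG u hu (by linarith)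
    have h3 : u * |Real.log c| ≤
        u * (Real.log u - 2 + C * (Real.log (Real.log u) / Real.log u) ^ 2) :=
      mul_le_mul_of_nonneg_left (by linarith) (by linarith)
    have h4 : 1 * |Real.log c| ≤ u * |Real.log c| := mul_le_mul_of_nonneg_right (by linarith) habs
    linarith [neg_abs_le (Real.log c)]
  rcases le_or_gt (smoothSlope A u) (Real.log y) with hθ | hθ
  · exact hmain u y hyY huA hθ
  obtain ⟨v, hv, hvL⟩ := intermediate_value_Icc huA (f := smoothSlope A) (fun w hw =>
    (hasDerivAt_smoothSlope A (hlogA w hw.1).1).continuousAt.continuousWithinAt) ⟨hLθ, hθ.le⟩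
  have h1 := hmain v y hyY hv.1 hvL.le
  have h2 := sub_le_sub_smoothExponent (by linarith) (by linarith : 2 * A + 4 ≤ C) hv.1 hv.2 hvL.ge
  have h3 : (psiK K (Real.exp (v * Real.log y)) y : ℝ) ≤
      psiK K (Real.exp (u * Real.log y)) y := by
    exact_mod_cast psiK_mono (Real.exp_le_exp.2 (mul_le_mul_of_nonneg_right hv.2 hL.le)) y
  refine le_trans (Real.exp_le_exp.2 ?_) (h1.trans h3)
  linarith

end Final

/-- Moree, Stewart. There is a positive constant `c₁ = c₁(K)` such that
for all `x, y ≥ 1` with `u := ln x / ln y ≥ 3`,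
`ψ_K(x, y) ≥ x · exp[−u(ln(u ln u) − 1 + (ln ln u − 1)/ln u + c₁((ln ln u)/(ln u))²)]`. -/
theorem smoothness_roots_stmt1 (K : Type) [Field K] [NumberField K] :
    ∃ c₁ : ℝ, 0 < c₁ ∧ ∀ x y : ℝ, 1 ≤ x → 1 ≤ y → 3 ≤ Real.log x / Real.log y →
      (psiK K x y : ℝ) ≥ x * Real.exp
        (-(Real.log x / Real.log y *
          (Real.log (Real.log x / Real.log y * Real.log (Real.log x / Real.log y)) - 1 +
            (Real.log (Real.log (Real.log x / Real.log y)) - 1) /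
              Real.log (Real.log x / Real.log y) +
            c₁ * (Real.log (Real.log (Real.log x / Real.log y)) /
              Real.log (Real.log x / Real.log y)) ^ 2))) := by

  obtain ⟨C, hC, h⟩ := exists_exp_sub_smoothExponent_le_psiK K
  refine ⟨C, hC, fun x y hx hy hu => ?_⟩
  have hy1 : 1 < y := by
    rcases hy.eq_or_lt with rfl | hy
    · norm_num at hu
    · exact hy
  have hL : Real.log y ≠ 0 := (Real.log_pos hy1).ne'
  have hl := one_le_log_of_three_le hu
  have h1 := h _ y hu hy1
  rw [div_mul_cancel₀ _ hL, Real.exp_log (by linarith), sub_eq_add_neg, Real.exp_add,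
    Real.exp_log (by linarith), smoothExponent] at h1
  rwa [Real.log_mul (by linarith) (by linarith)]
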